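/- There is a constant K depending only on f₁ and f₂ such that for every integer q ≥ 2 and every δ ∈ (0,1/2) with δ ≥ 2c₄/q, one has E(q,δ) ≤ K(δ^{−1/2} q^{1/2} log q + δ^{5/4} q^{3/4} log(1/δ)). -/

import Mathlib

open Set Real
open scoped Classical

/-- Distance from a real number to the nearest integer. -/
noncomputable def nint (y : ℝ) : ℝ := |y - round y|

/-- A pair `(φ, ψ)`, with `ψ` playing the role of `φ'`, satisfying two-sided quadratic Taylor bounds. -/
structure QuadConvex (κ Λ : ℝ) (φ ψ : ℝ → ℝ) : Prop where
  pos : 0 < κ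
  lower : ∀ s t, κ * (t - s) ^ 2 ≤ φ t - φ s - ψ s * (t - s)
  upper : ∀ s t, φ t - φ s - ψ s * (t - s) ≤ Λ * (t - s) ^ 2

/-- The points of `V` are at pairwise distance at least `σ`. -/
def Separated (σ : ℝ) (V : Finset ℝ) : Prop :=
  ∀ x ∈ V, ∀ y ∈ V, x < y → x + σ ≤ y

lemma Separated.mono {σ : ℝ} {V W : Finset ℝ} (h : Separated σ V) (hW : W ⊆ V) :
    Separated σ W := fun x hx y hy => h x (hW hx) y (hW hy)

lemma sum_separated_le {σ τ K : ℝ} {f P : ℝ → ℝ} (hf0 : ∀ a, τ ≤ a → f a ≤ K + P a)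
    (hK : 0 ≤ K) (hP0 : ∀ a, τ ≤ a → 0 ≤ P a)
    (hf : ∀ a b, τ ≤ b → b + σ ≤ a → f a + P b ≤ P a)
    (hP : ∀ a b, τ ≤ a → a ≤ b → P a ≤ P b) (V : Finset ℝ) :
    Separated σ V → ∀ Y, τ ≤ Y → (∀ v ∈ V, τ ≤ v ∧ v ≤ Y) → ∑ v ∈ V, f v ≤ K + P Y := by
  induction V using Finset.induction_on_max with
  | empty => intro _ Y hY _; simpa using add_nonneg hK (hP0 Y hY)
  | insert a s hs ih =>
    intro hsep Y hY hV
    have ha : a ∉ s := fun h => lt_irrefl _ (hs a h)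
    rw [Finset.sum_insert ha]
    have haV := hV a (Finset.mem_insert_self _ _)
    rcases s.eq_empty_or_nonempty with rfl | ⟨b, hb⟩
    · simp only [Finset.sum_empty, add_zero]
      linarith [hf0 a haV.1, hP a Y haV.1 haV.2]
    · have hle : ∀ v ∈ s, τ ≤ v ∧ v ≤ a - σ := fun v hv =>
        ⟨(hV v (Finset.mem_insert_of_mem hv)).1, by
          linarith [hsep v (Finset.mem_insert_of_mem hv) a (Finset.mem_insert_self _ _) (hs v hv)]⟩
      have hτ : τ ≤ a - σ := (hle b hb).1.trans (hle b hb).2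
      have h1 := ih (hsep.mono (Finset.subset_insert _ _)) (a - σ) hτ hle
      linarith [hf a (a - σ) hτ (by linarith), hP a Y haV.1 haV.2]

lemma card_separated_le {σ u ℓ : ℝ} (hσ : 0 < σ) (hℓ : 0 ≤ ℓ) {V : Finset ℝ} (hV : Separated σ V)
    (hu : ∀ v ∈ V, u ≤ v ∧ v ≤ u + ℓ) : (V.card : ℝ) ≤ 1 + ℓ / σ := by
  have := sum_separated_le (σ := σ) (τ := u) (K := 1) (f := fun _ => 1) (P := fun y => (y - u) / σ)
    (fun a ha => by have : 0 ≤ (a - u) / σ := div_nonneg (by linarith) hσ.le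
                    linarith) zero_le_one
    (fun a ha => div_nonneg (by linarith) hσ.le)
    (fun a b hb hab => by
      rw [← sub_nonneg]
      have : (a - u) / σ - (1 + (b - u) / σ) = (a - b - σ) / σ := by field_simp; ring
      rw [this]; exact div_nonneg (by linarith) hσ.le)
    (fun a b _ hab => by gcongr) V hV (u + ℓ) (by linarith) hu
  simpa using this

lemma sum_inv_add_le_of_nonneg {σ η Y : ℝ} (hσ : 0 < σ) (hη : 0 < η) (hY : 0 ≤ Y) {V : Finset ℝ}
    (hV : Separated σ V) (hu : ∀ v ∈ V, 0 ≤ v ∧ v ≤ Y) :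
    ∑ v ∈ V, 1 / (η + v) ≤ 1 / η + 1 / σ * log (1 + Y / η) := by
  refine sum_separated_le (σ := σ) (τ := 0) (K := 1 / η) (f := fun v => 1 / (η + v))
    (P := fun y => 1 / σ * log (1 + y / η)) ?_ (by positivity) ?_ ?_ ?_ V hV Y hY hu
  · intro a ha
    have h1 : 0 ≤ log (1 + a / η) := log_nonneg (by have : 0 ≤ a / η := by positivity
                                                    linarith)
    have h2 : 1 / (η + a) ≤ 1 / η := one_div_le_one_div_of_le hη (by linarith)
    have h3 : 0 ≤ 1 / σ * log (1 + a / η) := by positivity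
    linarith
  · intro a ha
    have h1 : 0 ≤ log (1 + a / η) := log_nonneg (by have : 0 ≤ a / η := by positivity
                                                    linarith)
    positivity
  · intro a b hb hab
    have hb' : 0 < 1 + b / η := by positivity
    have ha0 : 0 < a := by linarith
    have ha' : 0 < 1 + a / η := by positivity
    have h1 := one_sub_inv_le_log_of_pos (div_pos ha' hb')
    rw [log_div ha'.ne' hb'.ne'] at h1
    have h2 : σ / (η + a) ≤ 1 - ((1 + a / η) / (1 + b / η))⁻¹ := by
      have : 1 - ((1 + a / η) / (1 + b / η))⁻¹ = (a - b) / (η + a) := by field_simp; ring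
      rw [this]; gcongr; linarith
    have h3 : 1 / (η + a) = 1 / σ * (σ / (η + a)) := by field_simp
    rw [h3, ← mul_add]
    gcongr
    linarith
  · intro a b ha hab
    have : 0 < 1 + a / η := by positivity
    gcongr

lemma separated_image_neg {σ : ℝ} {V : Finset ℝ} (hV : Separated σ V) :
    Separated σ (V.image fun v => -v) := by
  intro x hx y hy hxy
  obtain ⟨a, ha, rfl⟩ := Finset.mem_image.1 hx
  obtain ⟨b, hb, rfl⟩ := Finset.mem_image.1 hy
  linarith [hV b hb a ha (by linarith)]

/-- Splitting a sum of an even function over a separated set into its two halves. -/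
lemma sum_abs_le_of_halves {σ Y B : ℝ} {f : ℝ → ℝ}
    (hB : ∀ W : Finset ℝ, Separated σ W → (∀ v ∈ W, 0 ≤ v ∧ v ≤ Y) → ∑ v ∈ W, f v ≤ B)
    {V : Finset ℝ} (hV : Separated σ V) (hu : ∀ v ∈ V, |v| ≤ Y) :
    ∑ v ∈ V, f |v| ≤ 2 * B := by
  rw [← Finset.sum_filter_add_sum_filter_not V (fun v => 0 ≤ v)]
  have h1 : ∑ v ∈ V with 0 ≤ v, f |v| ≤ B := by
    rw [Finset.sum_congr rfl (g := f) fun v hv => by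
      rw [abs_of_nonneg (Finset.mem_filter.1 hv).2]]
    refine hB _ (hV.mono (Finset.filter_subset _ _)) fun v hv => ?_
    have := Finset.mem_filter.1 hv
    exact ⟨this.2, (le_abs_self v).trans (hu v this.1)⟩
  have h2 : ∑ v ∈ V with ¬ 0 ≤ v, f |v| ≤ B := by
    have : ∑ v ∈ V with ¬ 0 ≤ v, f |v| = ∑ v ∈ (V.filter fun v => ¬ 0 ≤ v).image (fun v => -v), f v := by
      rw [Finset.sum_image fun x _ y _ h => neg_injective h]
      refine Finset.sum_congr rfl fun v hv => ?_
      rw [abs_of_nonpos (by linarith [not_le.1 (Finset.mem_filter.1 hv).2])]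
    rw [this]
    refine hB _ (separated_image_neg (hV.mono (Finset.filter_subset _ _))) fun v hv => ?_
    obtain ⟨w, hw, rfl⟩ := Finset.mem_image.1 hv
    have := Finset.mem_filter.1 hw
    exact ⟨by linarith [not_le.1 this.2], (neg_le_abs w).trans (hu w this.1)⟩
  linarith

lemma sum_inv_add_abs_le {σ η Y : ℝ} (hσ : 0 < σ) (hη : 0 < η) (hY : 0 ≤ Y) {V : Finset ℝ}
    (hV : Separated σ V) (hu : ∀ v ∈ V, |v| ≤ Y) :
    ∑ v ∈ V, 1 / (η + |v|) ≤ 2 * (1 / η + 1 / σ * log (1 + Y / η)) :=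
  sum_abs_le_of_halves (f := fun v => 1 / (η + v))
    (fun _ hW h => sum_inv_add_le_of_nonneg hσ hη hY hW h) hV hu

lemma sum_inv_sq_le {σ τ : ℝ} (hσ : 0 < σ) (hτ : 0 < τ) {V : Finset ℝ}
    (hV : Separated σ V) (hu : ∀ v ∈ V, τ ≤ v) :
    ∑ v ∈ V, 1 / v ^ 2 ≤ 1 / τ ^ 2 + 1 / (σ * τ) := by
  rcases V.eq_empty_or_nonempty with rfl | hne
  · simp; positivity
  have key := sum_separated_le (σ := σ) (τ := τ) (K := 1 / τ ^ 2) (f := fun v => 1 / v ^ 2)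
    (P := fun y => 1 / σ * (1 / τ - 1 / y)) ?_ (by positivity) ?_ ?_ ?_ V hV (V.max' hne)
    (hu _ (V.max'_mem hne)) (fun v hv => ⟨hu v hv, V.le_max' v hv⟩)
  · refine key.trans ?_
    have hY : 0 < V.max' hne := hτ.trans_le (hu _ (V.max'_mem hne))
    have : 1 / σ * (1 / τ - 1 / V.max' hne) ≤ 1 / σ * (1 / τ) := by
      gcongr; have : 0 < 1 / V.max' hne := by positivity
      linarith
    rw [one_div_mul_one_div] at this
    linarith
  · intro a ha
    have h1 : 1 / a ^ 2 ≤ 1 / τ ^ 2 := by gcongr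
    have h2 : 0 ≤ 1 / τ - 1 / a := by
      have := one_div_le_one_div_of_le hτ ha
      linarith
    have : 0 ≤ 1 / σ * (1 / τ - 1 / a) := by positivity
    linarith
  · intro a ha
    have h2 : 0 ≤ 1 / τ - 1 / a := by
      have := one_div_le_one_div_of_le hτ ha
      linarith
    positivity
  · intro a b hb hab
    have hb0 : 0 < b := by linarith
    have ha0 : 0 < a := by linarith
    have : 1 / a ^ 2 ≤ 1 / σ * (1 / b - 1 / a) := by
      have h : 1 / σ * (1 / b - 1 / a) = (a - b) / σ * (1 / (a * b)) := by field_simp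
      have h1 : 1 ≤ (a - b) / σ := by rw [le_div_iff₀ hσ]; linarith
      have h2 : 1 / a ^ 2 ≤ 1 / (a * b) := by
        apply one_div_le_one_div_of_le (by positivity); nlinarith
      rw [h]
      calc 1 / a ^ 2 ≤ 1 * (1 / (a * b)) := by rw [one_mul]; exact h2
        _ ≤ _ := by gcongr
    have h4 : 1 / σ * (1 / τ - 1 / a) = 1 / σ * (1 / τ - 1 / b) + 1 / σ * (1 / b - 1 / a) := by ring
    linarith
  · intro a b ha hab
    have : 0 < a := by linarith
    gcongr

namespace QuadConvex

variable {κ Λ : ℝ} {φ ψ : ℝ → ℝ}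

lemma le (h : QuadConvex κ Λ φ ψ) : κ ≤ Λ := by
  have h1 := h.lower 0 1
  have h2 := h.upper 0 1
  linarith

lemma upper_pos (h : QuadConvex κ Λ φ ψ) : 0 < Λ := h.pos.trans_le h.le

lemma deriv_sub_le (h : QuadConvex κ Λ φ ψ) (s t : ℝ) : |ψ t - ψ s| ≤ 2 * Λ * |t - s| := by
  rcases eq_or_ne t s with rfl | hne
  · simp
  have h1 := h.upper s t
  have h2 := h.upper t s
  have h3 := h.lower s t
  have h4 := h.lower t s
  have hp : 0 < |t - s| := abs_pos.2 (sub_ne_zero.2 hne)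
  refine le_of_mul_le_mul_right ?_ hp
  rw [← abs_mul, mul_assoc, abs_mul_abs_self]
  have h5 : 0 ≤ κ * (t - s) ^ 2 := mul_nonneg h.pos.le (sq_nonneg _)
  rw [abs_le]
  constructor <;> nlinarith

lemma le_deriv_sub (h : QuadConvex κ Λ φ ψ) (s t : ℝ) : 2 * κ * |t - s| ≤ |ψ t - ψ s| := by
  rcases eq_or_ne t s with rfl | hne
  · simp
  have h3 := h.lower s t
  have h4 := h.lower t s
  have hp : 0 < |t - s| := abs_pos.2 (sub_ne_zero.2 hne)
  refine le_of_mul_le_mul_right ?_ hp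
  rw [← abs_mul, mul_assoc, abs_mul_abs_self]
  refine le_trans ?_ (le_abs_self _)
  nlinarith

lemma three_point_lower (h : QuadConvex κ Λ φ ψ) {t₁ t₂ t₃ : ℝ} (h₁ : t₁ < t₂) (h₂ : t₂ < t₃) :
    κ * ((t₂ - t₁) * (t₃ - t₂)) * (t₃ - t₁) ≤
      (t₂ - t₁) * (φ t₃ - φ t₁) - (t₃ - t₁) * (φ t₂ - φ t₁) := by
  have h3 := mul_le_mul_of_nonneg_left (h.lower t₂ t₃) (sub_pos.2 h₁).le
  have h4 := mul_le_mul_of_nonneg_left (h.lower t₂ t₁) (sub_pos.2 h₂).le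
  linarith

lemma three_point_upper (h : QuadConvex κ Λ φ ψ) {t₁ t₂ t₃ : ℝ} (h₁ : t₁ < t₂) (h₂ : t₂ < t₃) :
    (t₂ - t₁) * (φ t₃ - φ t₁) - (t₃ - t₁) * (φ t₂ - φ t₁) ≤
      Λ * ((t₂ - t₁) * (t₃ - t₂)) * (t₃ - t₁) := by
  have h3 := mul_le_mul_of_nonneg_left (h.upper t₂ t₃) (sub_pos.2 h₁).le
  have h4 := mul_le_mul_of_nonneg_left (h.upper t₂ t₁) (sub_pos.2 h₂).le
  linarith

lemma gap_mul_gap_le_of_collinear (h : QuadConvex κ Λ φ ψ) {t₁ t₂ t₃ ε σ β : ℝ} (h₁ : t₁ < t₂)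
    (h₂ : t₂ < t₃) (e₁ : |φ t₁ - (σ * t₁ + β)| ≤ ε) (e₂ : |φ t₂ - (σ * t₂ + β)| ≤ ε)
    (e₃ : |φ t₃ - (σ * t₃ + β)| ≤ ε) : (t₂ - t₁) * (t₃ - t₂) ≤ 4 * ε / κ := by
  have hlow := h.three_point_lower h₁ h₂
  have hp : 0 < t₃ - t₁ := by linarith
  have hε : 0 ≤ ε := (abs_nonneg _).trans e₁
  rw [le_div_iff₀' h.pos]
  refine le_of_mul_le_mul_right (hlow.trans ?_) hp
  rw [abs_le] at e₁ e₂ e₃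
  nlinarith [mul_le_mul_of_nonneg_left e₃.2 (sub_pos.2 h₁).le,
    mul_le_mul_of_nonneg_left e₁.1 (sub_pos.2 h₁).le,
    mul_le_mul_of_nonneg_left e₂.1 hp.le, mul_le_mul_of_nonneg_left e₁.2 hp.le,
    mul_nonneg hε (sub_pos.2 h₂).le]

/-- A set of at least three `g`-separated points where `φ` is `ε`-close to a line. -/
lemma card_near_line (h : QuadConvex κ Λ φ ψ) {ε σ β g : ℝ} (hg : 0 < g) {L : Finset ℝ}
    (hL : Separated g L) (hcard : 3 ≤ L.card) (hε : ∀ t ∈ L, |φ t - (σ * t + β)| ≤ ε) :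
    g ≤ √(4 * ε / κ) ∧ (L.card : ℝ) ≤ 4 * √(4 * ε / κ) / g ∧
      ∃ t ∈ L, |ψ t - σ| ≤ 2 * ε / g + Λ * √(4 * ε / κ) := by
  set ρ := √(4 * ε / κ) with hρ
  have hne : L.Nonempty := Finset.card_pos.1 (by omega)
  have hε0 : 0 ≤ ε := (abs_nonneg _).trans (hε _ hne.choose_spec)
  have hκ := h.pos
  have hρ0 : 0 ≤ ρ := Real.sqrt_nonneg _
  have hρ2 : ρ * ρ = 4 * ε / κ := Real.mul_self_sqrt (by positivity)
  set a := L.min' hne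
  set b := L.max' hne
  set L₁ := L.filter fun t => t ≤ a + ρ
  set L₂ := L.filter fun t => b - ρ ≤ t
  have hsub : L ⊆ L₁ ∪ L₂ := by
    intro t ht
    simp only [Finset.mem_union, Finset.mem_filter, L₁, L₂, ht, true_and]
    by_contra! hcon
    have h1 := h.gap_mul_gap_le_of_collinear (t₁ := a) (t₂ := t) (t₃ := b) (by linarith)
      (by linarith) (hε _ (L.min'_mem hne)) (hε _ ht) (hε _ (L.max'_mem hne))
    nlinarith
  have hu₁ : ∀ v ∈ L₁, a ≤ v ∧ v ≤ a + ρ := fun v hv =>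
    ⟨L.min'_le v (Finset.mem_filter.1 hv).1, (Finset.mem_filter.1 hv).2⟩
  have hu₂ : ∀ v ∈ L₂, b - ρ ≤ v ∧ v ≤ b - ρ + ρ := fun v hv =>
    ⟨(Finset.mem_filter.1 hv).2, by linarith [L.le_max' v (Finset.mem_filter.1 hv).1]⟩
  have hs₁ : L₁ ⊆ L := Finset.filter_subset _ _
  have hs₂ : L₂ ⊆ L := Finset.filter_subset _ _
  have hc₁ := card_separated_le hg hρ0 (hL.mono hs₁) hu₁
  have hc₂ := card_separated_le hg hρ0 (hL.mono hs₂) hu₂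
  have hc : L.card ≤ L₁.card + L₂.card :=
    (Finset.card_le_card hsub).trans (Finset.card_union_le _ _)
  have hcR : (L.card : ℝ) ≤ L₁.card + L₂.card := by exact_mod_cast hc
  obtain ⟨t, ht, t', ht', htt, htρ⟩ : ∃ t ∈ L, ∃ t' ∈ L, t < t' ∧ t' ≤ t + ρ := by
    have : ∃ W ⊆ L, 1 < W.card ∧ ∃ u, ∀ v ∈ W, u ≤ v ∧ v ≤ u + ρ := by
      rcases lt_or_ge 1 L₁.card with h1 | h1
      · exact ⟨L₁, hs₁, h1, a, hu₁⟩
      · exact ⟨L₂, hs₂, by omega, b - ρ, hu₂⟩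
    obtain ⟨W, hW, hW1, u, hu⟩ := this
    obtain ⟨x, hx, y, hy, hxy⟩ := Finset.one_lt_card.1 hW1
    rcases lt_or_gt_of_ne hxy with h1 | h1
    · exact ⟨x, hW hx, y, hW hy, h1, by linarith [(hu x hx).1, (hu y hy).2]⟩
    · exact ⟨y, hW hy, x, hW hx, h1, by linarith [(hu y hy).1, (hu x hx).2]⟩
  have hgap := hL t ht t' ht' htt
  have hgρ : g ≤ ρ := by linarith
  refine ⟨hgρ, ?_, t, ht, ?_⟩
  · have : 1 ≤ ρ / g := by rwa [le_div_iff₀ hg, one_mul]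
    have h4 : 4 * ρ / g = 4 * (ρ / g) := by ring
    rw [h4]; linarith
  · have hτ : 0 < t' - t := by linarith
    have h1 := h.upper t t'
    have h2 := h.lower t t'
    have e1 := abs_le.1 (hε t ht)
    have e2 := abs_le.1 (hε t' ht')
    have h3 : |ψ t - σ| * (t' - t) ≤ 2 * ε + Λ * (t' - t) ^ 2 := by
      rw [← abs_of_pos hτ, ← abs_mul, abs_of_pos hτ, abs_le]
      have : 0 ≤ κ * (t' - t) ^ 2 := by positivity
      have := mul_le_mul_of_nonneg_right h.le (sq_nonneg (t' - t))
      constructor <;> nlinarith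
    have h4 : |ψ t - σ| ≤ 2 * ε / (t' - t) + Λ * (t' - t) := by
      rw [← le_div_iff₀ hτ] at h3
      refine h3.trans (le_of_eq ?_)
      field_simp
    refine h4.trans ?_
    have := h.upper_pos
    gcongr <;> linarith

/-- Two near-tangent lines with the same slope have nearly the same intercept. -/
lemma intercept_sub_le (h : QuadConvex κ Λ φ ψ) {σ β β' ε E t t' : ℝ}
    (ht : |φ t - (σ * t + β)| ≤ ε) (ht' : |φ t' - (σ * t' + β')| ≤ ε)
    (hE : |ψ t - σ| ≤ E) (hE' : |ψ t' - σ| ≤ E) :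
    |β - β'| ≤ E ^ 2 * (1 / κ + Λ / κ ^ 2) + 2 * ε := by
  have hκ := h.pos
  have hΛ := h.upper_pos
  have h1 := h.le_deriv_sub t t'
  have h2 : |t' - t| ≤ E / κ := by
    rw [le_div_iff₀ hκ]
    have h3 : |ψ t' - ψ t| ≤ 2 * E := by
      rw [abs_le] at *
      constructor <;> linarith
    linarith
  have h3 : |φ t' - φ t - ψ t * (t' - t)| ≤ Λ * |t' - t| ^ 2 := by
    rw [sq_abs, abs_le]
    have := h.lower t t'
    have := h.upper t t'
    have : 0 ≤ κ * (t' - t) ^ 2 := by positivity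
    constructor <;> nlinarith
  have h4 : |(ψ t - σ) * (t' - t)| ≤ E * (E / κ) := by
    rw [abs_mul]
    have : 0 ≤ E := (abs_nonneg _).trans hE
    gcongr
  have h5 : Λ * |t' - t| ^ 2 ≤ Λ * (E / κ) ^ 2 := by gcongr
  have h6 : E ^ 2 * (1 / κ + Λ / κ ^ 2) = E * (E / κ) + Λ * (E / κ) ^ 2 := by field_simp
  rw [h6]
  have h7 := h3.trans h5
  rw [abs_le] at ht ht' h7 h4 ⊢
  constructor <;> nlinarith

end QuadConvex

/-- `t` is the abscissa of a rational point of denominator at most `M` lying vertically within `ε` of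
the graph of `φ`. -/
def NearRational (φ : ℝ → ℝ) (M ε t : ℝ) : Prop :=
  ∃ a b : ℤ, ∃ d : ℕ, 0 < d ∧ (d : ℝ) ≤ M ∧ t = a / d ∧ |φ t - b / d| ≤ ε

namespace QuadConvex

variable {κ Λ : ℝ} {φ ψ : ℝ → ℝ}

/-- Three rational points of small denominator on a short arc near a convex curve are collinear. -/
lemma collinear_of_close (h : QuadConvex κ Λ φ ψ) {M ε ℓ : ℝ}
    (hsmall : M ^ 3 * (Λ * ℓ ^ 3 + 4 * ε * ℓ) < 1)
    {a₁ b₁ a₂ b₂ a₃ b₃ : ℤ} {d₁ d₂ d₃ : ℕ} (hd₁ : 0 < d₁) (hd₂ : 0 < d₂) (hd₃ : 0 < d₃)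
    (hM₁ : (d₁ : ℝ) ≤ M) (hM₂ : (d₂ : ℝ) ≤ M) (hM₃ : (d₃ : ℝ) ≤ M)
    {t₁ t₂ t₃ : ℝ} (ht₁ : t₁ = a₁ / d₁) (ht₂ : t₂ = a₂ / d₂) (ht₃ : t₃ = a₃ / d₃)
    (e₁ : |φ t₁ - b₁ / d₁| ≤ ε) (e₂ : |φ t₂ - b₂ / d₂| ≤ ε) (e₃ : |φ t₃ - b₃ / d₃| ≤ ε)
    (h₁ : t₁ < t₂) (h₂ : t₂ < t₃) (hℓ : t₃ - t₁ ≤ ℓ) :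
    (t₂ - t₁) * ((b₃ / d₃ : ℝ) - b₁ / d₁) = (t₃ - t₁) * ((b₂ / d₂ : ℝ) - b₁ / d₁) := by
  have hΛ := h.upper_pos
  have hε : 0 ≤ ε := (abs_nonneg _).trans e₁
  have hD₁ : (0 : ℝ) < d₁ := by exact_mod_cast hd₁
  have hD₂ : (0 : ℝ) < d₂ := by exact_mod_cast hd₂
  have hD₃ : (0 : ℝ) < d₃ := by exact_mod_cast hd₃
  have hup := h.three_point_upper h₁ h₂
  have hlo := h.three_point_lower h₁ h₂
  set A := (t₂ - t₁) * ((b₃ / d₃ : ℝ) - b₁ / d₁) - (t₃ - t₁) * ((b₂ / d₂ : ℝ) - b₁ / d₁) with hA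
  have hp : 0 < t₂ - t₁ := by linarith
  have hq : 0 < t₃ - t₂ := by linarith
  have hpq : 0 < t₃ - t₁ := by linarith
  have hℓ0 : 0 < ℓ := by linarith
  have hAle : |A| ≤ Λ * ℓ ^ 3 + 4 * ε * ℓ := by
    have h3 : Λ * ((t₂ - t₁) * (t₃ - t₂)) * (t₃ - t₁) ≤ Λ * (ℓ * ℓ) * ℓ := by
      gcongr <;> linarith
    have h4 : 0 ≤ κ * ((t₂ - t₁) * (t₃ - t₂)) * (t₃ - t₁) := by
      have := h.pos; positivity
    have h5 : 4 * ε * (t₃ - t₁) ≤ 4 * ε * ℓ := by gcongr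
    rw [abs_le] at e₁ e₂ e₃ ⊢
    have k1 := mul_le_mul_of_nonneg_left e₃.1 hp.le
    have k2 := mul_le_mul_of_nonneg_left e₃.2 hp.le
    have k3 := mul_le_mul_of_nonneg_left e₁.1 hp.le
    have k4 := mul_le_mul_of_nonneg_left e₁.2 hp.le
    have k5 := mul_le_mul_of_nonneg_left e₂.1 hpq.le
    have k6 := mul_le_mul_of_nonneg_left e₂.2 hpq.le
    have k7 := mul_le_mul_of_nonneg_left e₁.1 hpq.le
    have k8 := mul_le_mul_of_nonneg_left e₁.2 hpq.le
    have k9 := mul_nonneg hε hq.le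
    constructor <;> nlinarith
  have hM : 0 < M := hD₁.trans_le hM₁
  have hint : ∃ z : ℤ, (d₁ * d₂ * d₃ : ℝ) * A = z := by
    refine ⟨a₂ * b₃ * d₁ - a₂ * b₁ * d₃ - a₁ * d₂ * b₃ - a₃ * b₂ * d₁ + a₃ * b₁ * d₂ + a₁ * d₃ * b₂, ?_⟩
    rw [hA, ht₁, ht₂, ht₃]
    push_cast
    field_simp
    ring
  obtain ⟨z, hz⟩ := hint
  have hlt : |(z : ℝ)| < 1 := by
    rw [← hz, abs_mul, abs_of_pos (by positivity)]
    refine lt_of_le_of_lt ?_ hsmall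
    have : (d₁ * d₂ * d₃ : ℝ) ≤ M ^ 3 := by
      calc (d₁ * d₂ * d₃ : ℝ) ≤ M * M * M := by gcongr
        _ = M ^ 3 := by ring
    gcongr
  have hz0 : z = 0 := by
    have : |z| < 1 := by exact_mod_cast hlt
    exact Int.abs_lt_one_iff.1 this
  rw [hz0, Int.cast_zero] at hz
  have : A = 0 := by
    rcases mul_eq_zero.1 hz with h | h
    · exact absurd h (by positivity)
    · exact h
  linarith

end QuadConvex

/-- Two points of a line with bounded denominators are separated in terms of the least common
denominator of slope and intercept. -/
lemma exists_line_denominator {σ β M : ℝ} {L : Finset ℝ} (hcard : 2 ≤ L.card)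
    (hL : ∀ t ∈ L, ∃ a b : ℤ, ∃ d : ℕ, 0 < d ∧ (d : ℝ) ≤ M ∧ t = a / d ∧ σ * t + β = b / d) :
    ∃ m : ℕ, 0 < m ∧ (∃ u : ℤ, m * σ = u) ∧ (∃ v : ℤ, m * β = v) ∧ Separated (m / M ^ 2) L := by
  let P : ℕ → Prop := fun m => 0 < m ∧ (∃ u : ℤ, m * σ = u) ∧ (∃ v : ℤ, m * β = v)
  have key : ∀ t ∈ L, ∀ t' ∈ L, t < t' → ∃ k : ℕ, P k ∧ (k : ℝ) ≤ M ^ 2 * (t' - t) := by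
    intro t ht t' ht' htt
    obtain ⟨a, b, d, hd, hdM, rfl, hy⟩ := hL t ht
    obtain ⟨a', b', d', hd', hdM', rfl, hy'⟩ := hL t' ht'
    have hD : (0 : ℝ) < d := by exact_mod_cast hd
    have hD' : (0 : ℝ) < d' := by exact_mod_cast hd'
    rw [div_lt_div_iff₀ hD hD'] at htt
    have hpos : 0 < a' * d - a * d' := by
      have : a * (d' : ℤ) < a' * d := by exact_mod_cast htt
      linarith
    have hcast : (((a' * d - a * d').toNat : ℕ) : ℝ) = a' * d - a * d' := by
      have : (((a' * d - a * d').toNat : ℕ) : ℤ) = a' * d - a * d' := Int.toNat_of_nonneg hpos.le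
      exact_mod_cast this
    have hy₁ : σ * a + β * d = b := by field_simp at hy; linarith
    have hy₂ : σ * a' + β * d' = b' := by field_simp at hy'; linarith
    refine ⟨(a' * d - a * d').toNat, ⟨by omega, ⟨b' * d - b * d', ?_⟩, ⟨a' * b - b' * a, ?_⟩⟩, ?_⟩
    · rw [hcast]; push_cast; rw [← hy₁, ← hy₂]; ring
    · rw [hcast]; push_cast; rw [← hy₁, ← hy₂]; ring
    · rw [hcast]
      have h1 : (a' * d - a * d' : ℝ) = d * d' * ((a' : ℝ) / d' - a / d) := by field_simp
      have h2 : 0 ≤ (a' : ℝ) / d' - a / d := by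
        rw [sub_nonneg, div_le_div_iff₀ hD hD']; exact htt.le
      rw [h1, pow_two]
      have : 0 ≤ M := hD.le.trans hdM
      gcongr
  obtain ⟨x, hx, y, hy, hxy⟩ := Finset.one_lt_card.1 (by omega : 1 < L.card)
  have hex : ∃ k, P k := by
    rcases lt_or_gt_of_ne hxy with h | h
    · exact (key x hx y hy h).imp fun _ h => h.1
    · exact (key y hy x hx h).imp fun _ h => h.1
  obtain ⟨_, _, d, hd, hdM, _⟩ := hL x hx
  have hM : 0 < M := (show (0 : ℝ) < d by exact_mod_cast hd).trans_le hdM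
  refine ⟨Nat.find hex, (Nat.find_spec hex).1, (Nat.find_spec hex).2.1, (Nat.find_spec hex).2.2, ?_⟩
  intro t ht t' ht' htt
  obtain ⟨k, hk, hkM⟩ := key t ht t' ht' htt
  have h1 : (Nat.find hex : ℝ) ≤ k := by exact_mod_cast Nat.find_min' hex hk
  have h2 : (Nat.find hex : ℝ) / M ^ 2 ≤ t' - t := by
    rw [div_le_iff₀ (by positivity)]
    linarith
  linarith

lemma exists_small_parameter {κ Λ : ℝ} (hκ : 0 < κ) (hΛ : 0 < Λ) : ∃ ν : ℝ, 0 < ν ∧ ν ≤ 1 ∧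
    κ * ν ^ 2 / 4 ≤ 1 / 8 ∧
    (8 * (κ * ν ^ 2 / 4) ^ 2 + 2 * Λ ^ 2 * ν ^ 3) * (1 / κ + Λ / κ ^ 2)
      + 2 * (κ * ν ^ 2 / 4) * ν < 1 := by
  set A := 1 / κ + Λ / κ ^ 2 with hA
  have hA0 : 0 < A := by positivity
  set B := (κ ^ 2 / 2 + 2 * Λ ^ 2) * A + κ / 2 with hB
  have hB0 : 0 < B := by positivity
  refine ⟨1 / (2 + 2 * κ + B), by positivity, ?_, ?_, ?_⟩
  · rw [div_le_one (by positivity)]; linarith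
  · set ν := 1 / (2 + 2 * κ + B) with hν
    have h0 : 0 < ν := by positivity
    have h1 : ν * (2 + 2 * κ + B) = 1 := by rw [hν]; field_simp
    have h2 : ν ≤ 1 := by nlinarith [mul_pos h0 hκ, mul_pos h0 hB0]
    have h3 : κ * ν ≤ 1 / 2 := by nlinarith [mul_pos h0 hκ, mul_pos h0 hB0]
    nlinarith [mul_pos h0 hκ]
  · set ν := 1 / (2 + 2 * κ + B) with hν
    have h0 : 0 < ν := by positivity
    have h1 : ν * (2 + 2 * κ + B) = 1 := by rw [hν]; field_simp
    have h2 : ν ≤ 1 := by nlinarith [mul_pos h0 hκ, mul_pos h0 hB0]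
    have h3 : B * ν < 1 := by nlinarith [mul_pos h0 hκ, mul_pos h0 hB0]
    refine lt_of_le_of_lt ?_ h3
    have h4 : ν ^ 4 ≤ ν := pow_le_of_le_one h0.le h2 (by norm_num)
    have h5 : ν ^ 3 ≤ ν := pow_le_of_le_one h0.le h2 (by norm_num)
    calc _ = (κ ^ 2 / 2 * ν ^ 4 + 2 * Λ ^ 2 * ν ^ 3) * A + κ / 2 * ν ^ 3 := by ring
      _ ≤ (κ ^ 2 / 2 * ν + 2 * Λ ^ 2 * ν) * A + κ / 2 * ν := by gcongr
      _ = B * ν := by rw [hB]; ring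

namespace QuadConvex

variable {κ Λ : ℝ} {φ ψ : ℝ → ℝ}

lemma abs_deriv_le (h : QuadConvex κ Λ φ ψ) {t T : ℝ} (ht : |t| ≤ T) :
    |ψ t| ≤ |ψ 0| + 2 * Λ * T := by
  have h1 := h.deriv_sub_le 0 t
  have h2 : 2 * Λ * |t - 0| ≤ 2 * Λ * T := by
    have := h.upper_pos
    rw [sub_zero]; gcongr
  have h3 : |ψ t| ≤ |ψ t - ψ 0| + |ψ 0| := by
    simpa using abs_add_le (ψ t - ψ 0) (ψ 0)
  linarith

/-- Rational points near the curve that lie on a line with at least three such points. -/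
lemma card_rich_le (h : QuadConvex κ Λ φ ψ) {T ν M ε : ℝ} (hT : 0 ≤ T) (hν0 : 0 < ν) (hν1 : ν ≤ 1)
    (hc8 : κ * ν ^ 2 / 4 ≤ 1 / 8)
    (hν : (8 * (κ * ν ^ 2 / 4) ^ 2 + 2 * Λ ^ 2 * ν ^ 3) * (1 / κ + Λ / κ ^ 2)
      + 2 * (κ * ν ^ 2 / 4) * ν < 1)
    (hM : 1 ≤ M) (hε0 : 0 ≤ ε) (hε : ε * M ^ 2 ≤ κ * ν ^ 2 / 4) {S R : Finset ℝ} {y : ℝ → ℝ}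
    (hS : ∀ t ∈ S, |t| ≤ T ∧ |φ t - y t| ≤ ε ∧
      ∃ a b : ℤ, ∃ d : ℕ, 0 < d ∧ (d : ℝ) ≤ M ∧ t = a / d ∧ y t = b / d)
    (hR : ∀ t ∈ R, t ∈ S ∧ ∃ σ β, y t = σ * t + β ∧ 3 ≤ (S.filter fun t => y t = σ * t + β).card) :
    (R.card : ℝ) ≤
      (2 * (|ψ 0| + 2 * Λ * T + 2 + Λ) + 1) * (16 / κ) * (ε * M ^ 4) := by
  have hκ := h.pos
  have hΛ := h.upper_pos
  set ρ := √(4 * ε / κ) with hρ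
  have hρ0 : 0 ≤ ρ := Real.sqrt_nonneg _
  have hρ2 : ρ ^ 2 = 4 * ε / κ := Real.sq_sqrt (by positivity)
  have hM0 : 0 < M := by linarith
  set c := κ * ν ^ 2 / 4 with hc
  have hc0 : 0 < c := by positivity
  have hρM : ρ * M ≤ ν := by
    refine le_of_sq_le_sq ?_ hν0.le
    rw [mul_pow, hρ2]
    calc 4 * ε / κ * M ^ 2 = 4 / κ * (ε * M ^ 2) := by ring
      _ ≤ 4 / κ * c := by gcongr
      _ = ν ^ 2 := by rw [hc]; field_simp
  have hρν : ρ ≤ ν := by nlinarith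
  have hεc : ε ≤ c := by
    have : 1 ≤ M ^ 2 := one_le_pow₀ hM
    nlinarith
  let E : ℕ → ℝ := fun m => 2 * ε / (m / M ^ 2) + Λ * ρ
  let L : ℝ → ℝ → Finset ℝ := fun σ β => S.filter fun t => y t = σ * t + β
  let Rich : ℕ → ℤ → ℝ → ℝ → Prop := fun m u σ β =>
    0 < m ∧ m * σ = u ∧ (∃ v : ℤ, m * β = v) ∧ m / M ^ 2 ≤ ρ ∧
      ((L σ β).card : ℝ) ≤ 4 * ρ / (m / M ^ 2) ∧ ∃ t ∈ L σ β, |ψ t - σ| ≤ E m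
  have hLε : ∀ σ β, ∀ t ∈ L σ β, |φ t - (σ * t + β)| ≤ ε := by
    intro σ β t ht
    have := Finset.mem_filter.1 ht
    rw [← this.2]; exact (hS t this.1).2.1
  have hRich : ∀ t ∈ R, ∃ m : ℕ, ∃ u : ℤ, ∃ σ β, y t = σ * t + β ∧ Rich m u σ β := by
    intro t ht
    obtain ⟨_, σ, β, hy, hcard⟩ := hR t ht
    obtain ⟨m, hm, ⟨u, hu⟩, hv, hsep⟩ := exists_line_denominator (σ := σ) (β := β) (M := M)
      (L := L σ β) (by show 2 ≤ (S.filter _).card; omega) (by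
        intro t ht
        have h1 := Finset.mem_filter.1 ht
        obtain ⟨a, b, d, hd, hdM, hta, hyb⟩ := (hS t h1.1).2.2
        exact ⟨a, b, d, hd, hdM, hta, by rw [← h1.2]; exact hyb⟩)
    have hm' : (0 : ℝ) < m := by exact_mod_cast hm
    obtain ⟨k1, k2, k3⟩ := h.card_near_line (by positivity) hsep hcard (hLε σ β)
    exact ⟨m, u, σ, β, hy, hm, hu, hv, k1, k2, k3⟩
  have hmρ : ∀ {m u σ β}, Rich m u σ β → (m : ℝ) ≤ ρ * M ^ 2 := by
    rintro m u σ β ⟨_, _, _, h1, _⟩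
    rwa [div_le_iff₀ (by positivity)] at h1
  have hE : ∀ {m u σ β}, Rich m u σ β → E m ≤ 2 * c / m + Λ * ρ ∧ E m ≤ 2 + Λ := by
    rintro m u σ β hr
    have hm : (1 : ℝ) ≤ m := by exact_mod_cast hr.1
    have h1 : E m = 2 * (ε * M ^ 2) / m + Λ * ρ := by simp only [E]; field_simp
    have h2 : E m ≤ 2 * c / m + Λ * ρ := by rw [h1]; gcongr
    refine ⟨h2, h2.trans ?_⟩
    have h3 : 2 * c / m ≤ 2 * c := div_le_self (by positivity) hm
    have h4 : Λ * ρ ≤ Λ * 1 := by gcongr; linarith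
    linarith
  have huniq : ∀ {m u σ β σ' β'}, Rich m u σ β → Rich m u σ' β' → σ = σ' ∧ β = β' := by
    intro m u σ β σ' β' hr hr'
    have hm : (1 : ℝ) ≤ m := by exact_mod_cast hr.1
    have hσ : σ = σ' := by
      have := hr.2.1.trans hr'.2.1.symm
      exact mul_left_cancel₀ (by positivity) this
    subst hσ
    refine ⟨rfl, ?_⟩
    obtain ⟨t, ht, hte⟩ := hr.2.2.2.2.2
    obtain ⟨t', ht', hte'⟩ := hr'.2.2.2.2.2
    obtain ⟨v, hv⟩ := hr.2.2.1
    obtain ⟨v', hv'⟩ := hr'.2.2.1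
    have h1 := h.intercept_sub_le (hLε _ _ t ht) (hLε _ _ t' ht') hte hte'
    have hE0 : 0 ≤ E m := (abs_nonneg _).trans hte
    have h2 : m * E m ^ 2 ≤ 8 * c ^ 2 + 2 * Λ ^ 2 * ν ^ 3 := by
      have e1 : E m ^ 2 ≤ 2 * ((2 * c / m) ^ 2 + (Λ * ρ) ^ 2) := by
        have := pow_le_pow_left₀ hE0 (hE hr).1 2
        nlinarith [sq_nonneg (2 * c / m - Λ * ρ)]
      have e2 : m * (2 * ((2 * c / m) ^ 2 + (Λ * ρ) ^ 2)) = 8 * c ^ 2 / m + 2 * Λ ^ 2 * (m * ρ ^ 2) := by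
        field_simp; ring
      have e3 : 8 * c ^ 2 / m ≤ 8 * c ^ 2 := div_le_self (by positivity) hm
      have e4 : m * ρ ^ 2 ≤ ν ^ 3 := by
        calc m * ρ ^ 2 ≤ ρ * M ^ 2 * ρ ^ 2 := by gcongr; exact hmρ hr
          _ = ρ * (ρ * M) ^ 2 := by ring
          _ ≤ ν * ν ^ 2 := by gcongr
          _ = ν ^ 3 := by ring
      have e5 : 2 * Λ ^ 2 * (m * ρ ^ 2) ≤ 2 * Λ ^ 2 * ν ^ 3 := by gcongr
      have e6 := mul_le_mul_of_nonneg_left e1 (by positivity : (0 : ℝ) ≤ m)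
      linarith
    have h3 : m * (2 * ε) ≤ 2 * c * ν := by
      calc m * (2 * ε) ≤ ρ * M ^ 2 * (2 * ε) := by gcongr; exact hmρ hr
        _ = 2 * (ε * M ^ 2) * ρ := by ring
        _ ≤ 2 * c * ν := by gcongr
    have h4 : m * |β - β'| < 1 := by
      refine lt_of_le_of_lt ?_ hν
      calc m * |β - β'| ≤ m * (E m ^ 2 * (1 / κ + Λ / κ ^ 2) + 2 * ε) := by gcongr
        _ = m * E m ^ 2 * (1 / κ + Λ / κ ^ 2) + m * (2 * ε) := by ring
        _ ≤ _ := by gcongr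
    have h5 : ((|v - v'| : ℤ) : ℝ) < 1 := by
      push_cast
      rw [← hv, ← hv', ← mul_sub, abs_mul, abs_of_nonneg (by positivity : (0 : ℝ) ≤ m)]
      exact h4
    have h6 : v = v' := by
      have : |v - v'| < 1 := by exact_mod_cast h5
      have := Int.abs_lt_one_iff.1 this
      omega
    rw [h6, ← hv'] at hv
    exact mul_left_cancel₀ (by positivity) hv
  choose! m u σ β hy hrich using hRich
  set W := |ψ 0| + 2 * Λ * T + 2 + Λ with hW
  have hW0 : 0 ≤ W := by positivity
  have huW : ∀ t ∈ R, |(u t : ℝ)| ≤ W * m t := by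
    intro t ht
    have hr := hrich t ht
    obtain ⟨t', ht', hte⟩ := hr.2.2.2.2.2
    have h1 := h.abs_deriv_le (hS t' (Finset.mem_filter.1 ht').1).1
    have h2 : |σ t| ≤ W := by
      have : |σ t| ≤ |ψ t'| + |ψ t' - σ t| := by
        have := abs_sub (ψ t') (ψ t' - σ t)
        simpa using this
      linarith [(hE hr).2]
    rw [← hr.2.1, abs_mul, Nat.abs_cast, mul_comm]
    gcongr
  have hfib : ∀ k : ℕ, ∀ l : ℤ, (((R.filter fun t => m t = k).filter fun t => u t = l).card : ℝ) ≤
      4 * ρ / (k / M ^ 2) := by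
    intro k l
    rcases ((R.filter fun t => m t = k).filter fun t => u t = l).eq_empty_or_nonempty with he | ⟨t₀, ht₀⟩
    · rw [he]; simp; positivity
    · simp only [Finset.mem_filter] at ht₀
      obtain ⟨⟨hR₀, rfl⟩, rfl⟩ := ht₀
      refine le_trans ?_ (hrich t₀ hR₀).2.2.2.2.1
      norm_cast
      refine Finset.card_le_card fun t ht => ?_
      simp only [Finset.mem_filter] at ht
      obtain ⟨⟨hR₁, h1⟩, h2⟩ := ht
      have h3 := hrich t hR₁
      rw [h1, h2] at h3
      have h4 := huniq h3 (hrich t₀ hR₀)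
      refine Finset.mem_filter.2 ⟨(hR t hR₁).1, ?_⟩
      rw [← h4.1, ← h4.2]; exact hy t hR₁
  have hfib' : ∀ k ∈ Finset.Icc 1 ⌊ρ * M ^ 2⌋₊, ((R.filter fun t => m t = k).card : ℝ) ≤
      (2 * W + 1) * (4 * ρ * M ^ 2) := by
    intro k hk
    have hk1 : (1 : ℝ) ≤ k := by exact_mod_cast (Finset.mem_Icc.1 hk).1
    rw [Finset.card_eq_sum_card_fiberwise (f := u) (t := Finset.Icc (-⌊W * k⌋) ⌊W * k⌋) (by
      intro t ht
      simp only [Finset.coe_filter, Set.mem_ofPred_eq] at ht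
      have := huW t ht.1
      rw [ht.2, abs_le] at this
      simp only [Finset.coe_Icc, Set.mem_Icc]
      constructor
      · have : -u t ≤ ⌊W * k⌋ := Int.le_floor.2 (by push_cast; linarith)
        linarith
      · exact Int.le_floor.2 this.2)]
    push_cast
    refine (Finset.sum_le_card_nsmul _ _ _ fun l _ => hfib k l).trans ?_
    rw [Int.card_Icc, nsmul_eq_mul]
    have hfl : (0 : ℤ) ≤ ⌊W * k⌋ := Int.floor_nonneg.2 (by positivity)
    have h1 : (((⌊W * k⌋ + 1 - -⌊W * k⌋).toNat : ℕ) : ℝ) ≤ 2 * (W * k) + 1 := by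
      have : (((⌊W * k⌋ + 1 - -⌊W * k⌋).toNat : ℕ) : ℤ) = 2 * ⌊W * k⌋ + 1 := by
        rw [Int.toNat_of_nonneg (by omega)]; ring
      have h2 : (((⌊W * k⌋ + 1 - -⌊W * k⌋).toNat : ℕ) : ℝ) = 2 * ⌊W * k⌋ + 1 := by exact_mod_cast this
      rw [h2]
      linarith [Int.floor_le (W * k)]
    have h2 : 2 * (W * k) + 1 ≤ (2 * W + 1) * k := by nlinarith
    calc _ ≤ (2 * W + 1) * k * (4 * ρ / (k / M ^ 2)) := by
          gcongr; exact h1.trans h2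
      _ = _ := by field_simp
  have htot : (R.card : ℝ) ≤ (ρ * M ^ 2) * ((2 * W + 1) * (4 * ρ * M ^ 2)) := by
    rw [Finset.card_eq_sum_card_fiberwise (f := m) (t := Finset.Icc 1 ⌊ρ * M ^ 2⌋₊) (by
      intro t ht
      have hr := hrich t ht
      simp only [Finset.coe_Icc, Set.mem_Icc]
      exact ⟨hr.1, Nat.le_floor (hmρ hr)⟩)]
    push_cast
    refine (Finset.sum_le_card_nsmul _ _ _ hfib').trans ?_
    rw [Nat.card_Icc, nsmul_eq_mul, Nat.add_sub_cancel]
    gcongr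
    exact Nat.floor_le (by positivity)
  refine htot.trans (le_of_eq ?_)
  calc _ = (2 * W + 1) * 4 * M ^ 4 * ρ ^ 2 := by ring
    _ = _ := by rw [hρ2]; ring

/-- Counting rational points of bounded denominator very close to a convex curve. -/
theorem card_nearRational_le (h : QuadConvex κ Λ φ ψ) {T : ℝ} (hT : 0 ≤ T) :
    ∃ c, 0 < c ∧ c ≤ 1 / 8 ∧ ∃ C, 0 < C ∧ ∀ M ε : ℝ, 1 ≤ M → 0 ≤ ε → ε * M ^ 2 ≤ c →
      ∀ S : Finset ℝ, (∀ t ∈ S, |t| ≤ T ∧ NearRational φ M ε t) →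
        (S.card : ℝ) ≤ C * (M + ε * M ^ 4) := by
  have hκ := h.pos
  have hΛ := h.upper_pos
  obtain ⟨ν, hν0, hν1, hc8, hν⟩ := exists_small_parameter hκ hΛ
  set A := (2 * (|ψ 0| + 2 * Λ * T + 2 + Λ) + 1) * (16 / κ) with hA
  have hA0 : 0 < A := by positivity
  set b := min 1 (1 / (4 * Λ)) with hb
  have hb0 : 0 < b := by positivity
  have hb1 : b ≤ 1 := min_le_left _ _
  have hbΛ : Λ * b ≤ 1 / 4 := by
    calc Λ * b ≤ Λ * (1 / (4 * Λ)) := by gcongr; exact min_le_right _ _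
      _ = 1 / 4 := by field_simp
  refine ⟨κ * ν ^ 2 / 4, by positivity, hc8, A + 2 * (2 * T / b + 2), by positivity, ?_⟩
  intro M ε hM hε0 hε S hS
  have hM0 : 0 < M := by linarith
  have hS' : ∀ t ∈ S, ∃ a b : ℤ, ∃ d : ℕ, 0 < d ∧ (d : ℝ) ≤ M ∧ t = a / d ∧ |φ t - b / d| ≤ ε :=
    fun t ht => (hS t ht).2
  choose! p q d hd hdM ht hφ using hS'
  let y : ℝ → ℝ := fun t => q t / d t
  set θ := b / M with hθ
  have hθ0 : 0 < θ := by positivity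
  let blk : ℝ → ℤ := fun t => ⌊t / θ⌋
  set R := S.filter fun t => 3 ≤ (S.filter fun t' => blk t' = blk t).card with hR
  set R' := S.filter fun t => ¬ 3 ≤ (S.filter fun t' => blk t' = blk t).card with hR'
  have hclose : ∀ {t t'}, blk t = blk t' → t' - t ≤ θ := by
    intro t t' hbt
    have h1 := Int.floor_le (t / θ)
    have h2 := Int.lt_floor_add_one (t' / θ)
    have h3 : (⌊t / θ⌋ : ℝ) = ⌊t' / θ⌋ := by exact_mod_cast hbt
    have h4 : t' / θ - t / θ ≤ 1 := by linarith
    rw [← sub_div, div_le_one hθ0] at h4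
    exact h4
  have hsmall : M ^ 3 * (Λ * θ ^ 3 + 4 * ε * θ) < 1 := by
    have e1 : M ^ 3 * (Λ * θ ^ 3 + 4 * ε * θ) = Λ * b * b ^ 2 + 4 * (ε * M ^ 2) * b := by
      rw [hθ]; field_simp
    have e2 : Λ * b * b ^ 2 ≤ 1 / 4 * 1 := by
      gcongr; exact pow_le_one₀ hb0.le hb1
    have e3 : 4 * (ε * M ^ 2) * b ≤ 4 * (1 / 8) * 1 := by
      gcongr; linarith
    rw [e1]; linarith
  have hcol : ∀ t₁ ∈ S, ∀ t₂ ∈ S, ∀ t₃ ∈ S, t₁ < t₂ → t₂ < t₃ → t₃ - t₁ ≤ θ →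
      (t₂ - t₁) * (y t₃ - y t₁) = (t₃ - t₁) * (y t₂ - y t₁) := fun t₁ h₁ t₂ h₂ t₃ h₃ h12 h23 hθ =>
    h.collinear_of_close hsmall (hd _ h₁) (hd _ h₂) (hd _ h₃) (hdM _ h₁) (hdM _ h₂) (hdM _ h₃)
      (ht _ h₁) (ht _ h₂) (ht _ h₃) (hφ _ h₁) (hφ _ h₂) (hφ _ h₃) h12 h23 hθ
  have hRcard : (R.card : ℝ) ≤ A * (ε * M ^ 4) := by
    refine h.card_rich_le hT hν0 hν1 hc8 hν hM hε0 hε (S := S) (y := y)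
      (fun t hts => ⟨(hS t hts).1, hφ t hts, p t, q t, d t, hd t hts, hdM t hts, ht t hts, rfl⟩) ?_
    intro t htR
    rw [hR, Finset.mem_filter] at htR
    refine ⟨htR.1, ?_⟩
    set F := S.filter fun t' => blk t' = blk t with hF
    have htF : t ∈ F := Finset.mem_filter.2 ⟨htR.1, rfl⟩
    obtain ⟨t', ht', hne⟩ := Finset.exists_mem_ne (by omega : 1 < F.card) t
    have hne' : t' - t ≠ 0 := sub_ne_zero.2 hne
    refine ⟨(y t' - y t) / (t' - t), y t - (y t' - y t) / (t' - t) * t, by ring, ?_⟩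
    refine htR.2.trans (Finset.card_le_card fun x hx => ?_)
    refine Finset.mem_filter.2 ⟨(Finset.mem_filter.1 hx).1, ?_⟩
    have hb : ∀ v ∈ F, ∀ w ∈ F, w - v ≤ θ := fun v hv w hw =>
      hclose ((Finset.mem_filter.1 hv).2.trans (Finset.mem_filter.1 hw).2.symm)
    have hFS : ∀ v ∈ F, v ∈ S := fun v hv => (Finset.mem_filter.1 hv).1
    have hcol' : ∀ v ∈ F, ∀ w ∈ F, ∀ z ∈ F, v < w → w < z →
        (w - v) * (y z - y v) = (z - v) * (y w - y v) := fun v hv w hw z hz h1 h2 =>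
      hcol v (hFS v hv) w (hFS w hw) z (hFS z hz) h1 h2 (hb v hv z hz)
    have key : (t' - t) * (y x - y t) = (x - t) * (y t' - y t) := by
      rcases lt_trichotomy x t with h1 | h1 | h1 <;> rcases lt_trichotomy x t' with h2 | h2 | h2 <;>
        rcases lt_or_gt_of_ne hne with h3 | h3 <;> subst_vars <;> first
        | ring1
        | linarith
        | linarith [hcol' x hx t htF t' ht' (by assumption) (by assumption)]
        | linarith [hcol' x hx t' ht' t htF (by assumption) (by assumption)]
        | linarith [hcol' t htF x hx t' ht' (by assumption) (by assumption)]
        | linarith [hcol' t' ht' x hx t htF (by assumption) (by assumption)]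
        | linarith [hcol' t htF t' ht' x hx (by assumption) (by assumption)]
        | linarith [hcol' t' ht' t htF x hx (by assumption) (by assumption)]
    field_simp
    linarith
  have hR'card : (R'.card : ℝ) ≤ 2 * (2 * T / b + 2) * M := by
    have h1 : R'.card ≤ 2 * (R'.image blk).card := by
      refine Finset.card_le_mul_card_image _ _ fun a ha => ?_
      obtain ⟨t, htR, rfl⟩ := Finset.mem_image.1 ha
      have h2 : (R'.filter fun t' => blk t' = blk t).card ≤ (S.filter fun t' => blk t' = blk t).card :=
        Finset.card_le_card (Finset.filter_subset_filter _ (Finset.filter_subset _ _))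
      have := (Finset.mem_filter.1 htR).2
      omega
    have h2 : R'.image blk ⊆ Finset.Icc (-⌈T / θ⌉) ⌊T / θ⌋ := by
      intro a ha
      obtain ⟨t, htR, rfl⟩ := Finset.mem_image.1 ha
      have h3 := abs_le.1 (hS t (Finset.mem_filter.1 htR).1).1
      rw [Finset.mem_Icc, ← Int.floor_neg, ← neg_div]
      constructor <;> apply Int.floor_le_floor <;> gcongr
      · exact h3.1
      · exact h3.2
    have h3 := Finset.card_le_card h2
    rw [Int.card_Icc] at h3
    have hTθ : 0 ≤ T / θ := by positivity
    have h4 : ((R'.image blk).card : ℝ) ≤ 2 * T / b * M + 2 := by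
      have h5 : (((⌊T / θ⌋ + 1 - -⌈T / θ⌉).toNat : ℕ) : ℝ) = ⌊T / θ⌋ + 1 + ⌈T / θ⌉ := by
        have : (((⌊T / θ⌋ + 1 - -⌈T / θ⌉).toNat : ℕ) : ℤ) = ⌊T / θ⌋ + 1 + ⌈T / θ⌉ := by
          rw [Int.toNat_of_nonneg]
          · ring
          · have := Int.floor_nonneg.2 hTθ
            have := Int.ceil_nonneg hTθ
            omega
        exact_mod_cast this
      have h6 : ((R'.image blk).card : ℝ) ≤ (((⌊T / θ⌋ + 1 - -⌈T / θ⌉).toNat : ℕ) : ℝ) := by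
        exact_mod_cast h3
      have h7 := Int.floor_le (T / θ)
      have h8 := Int.ceil_lt_add_one (T / θ)
      have h9 : 2 * T / b * M = T / θ + T / θ := by rw [hθ]; field_simp; ring
      linarith
    have h1' : (R'.card : ℝ) ≤ 2 * (R'.image blk).card := by exact_mod_cast h1
    nlinarith
  have hcard : (S.card : ℝ) = R.card + R'.card := by
    have := Finset.card_filter_add_card_filter_not (s := S)
      (fun t => 3 ≤ (S.filter fun t' => blk t' = blk t).card)
    exact_mod_cast this.symm
  have hk : 0 ≤ 2 * (2 * T / b + 2) * (ε * M ^ 4) := by positivity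
  have hk' : 0 ≤ A * M := by positivity
  rw [hcard]
  nlinarith

end QuadConvex

/-- The common divisor of the entries of a triple `(a, d, n)`. -/
def tripleGcd (w : ℤ × ℕ × ℤ) : ℕ := Nat.gcd (Nat.gcd w.1.natAbs w.2.1) w.2.2.natAbs

lemma tripleGcd_mul (w : ℤ × ℕ × ℤ) (m : ℕ) :
    tripleGcd (w.1 * m, w.2.1 * m, w.2.2 * m) = tripleGcd w * m := by
  simp only [tripleGcd, Int.natAbs_mul, Int.natAbs_natCast, Nat.gcd_mul_right]

lemma tripleGcd_dvd (w : ℤ × ℕ × ℤ) :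
    (tripleGcd w : ℤ) ∣ w.1 ∧ tripleGcd w ∣ w.2.1 ∧ (tripleGcd w : ℤ) ∣ w.2.2 := by
  refine ⟨?_, (Nat.gcd_dvd_left _ _).trans (Nat.gcd_dvd_right _ _), ?_⟩
  · exact Int.natCast_dvd.2 ((Nat.gcd_dvd_left _ _).trans (Nat.gcd_dvd_left _ _))
  · exact Int.natCast_dvd.2 (Nat.gcd_dvd_right _ _)

lemma sum_inv_floor_le {M : ℝ} (hM : 1 ≤ M) :
    ∑ k ∈ Finset.Icc 1 ⌊M⌋₊, (1 : ℝ) / k ≤ 1 + Real.log M := by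
  have := harmonic_floor_le_one_add_log M hM
  rw [harmonic_eq_sum_Icc] at this
  push_cast at this
  simpa only [one_div] using this

lemma sum_inv_sq_floor_le (N : ℕ) : ∑ k ∈ Finset.Icc 1 N, (1 : ℝ) / (k : ℝ) ^ 2 ≤ 2 := by
  have h := sum_Ioo_inv_sq_le (α := ℝ) 0 (N + 1)
  have h2 : Finset.Ioo 0 (N + 1) = Finset.Icc 1 N := by
    ext k
    simp only [Finset.mem_Ioo, Finset.mem_Icc]
    omega
  rw [h2] at h
  simpa only [one_div, Nat.cast_zero, zero_add, div_one] using h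

lemma div_eq_div_of_near {φ : ℝ → ℝ} {M c : ℝ} (hc : c < 1 / 8) {w w' : ℤ × ℕ × ℤ}
    (hw : M / 2 < w.2.1 ∧ (w.2.1 : ℝ) ≤ M ∧ |w.2.1 * φ (w.1 / w.2.1) - w.2.2| ≤ c / w.2.1)
    (hw' : M / 2 < w'.2.1 ∧ (w'.2.1 : ℝ) ≤ M ∧ |w'.2.1 * φ (w'.1 / w'.2.1) - w'.2.2| ≤ c / w'.2.1)
    (hM : 0 < M) (ht : (w.1 : ℝ) / w.2.1 = w'.1 / w'.2.1) :
    w.2.2 * w'.2.1 = w'.2.2 * w.2.1 := by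
  obtain ⟨h1, h2, h3⟩ := hw
  obtain ⟨h1', h2', h3'⟩ := hw'
  rw [← ht] at h3'
  set y := φ (w.1 / w.2.1)
  have hD : (0 : ℝ) < w.2.1 := by linarith
  have hD' : (0 : ℝ) < w'.2.1 := by linarith
  have hc0 : 0 ≤ c := by
    have := (abs_nonneg _).trans h3
    rw [div_nonneg_iff] at this
    rcases this with h | h <;> linarith
  have e1 : |w.2.1 * y - w.2.2| * w'.2.1 ≤ 2 * c := by
    calc |w.2.1 * y - w.2.2| * w'.2.1 ≤ c / w.2.1 * M := by gcongr
      _ = c * (M / w.2.1) := by ring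
      _ ≤ c * 2 := by gcongr; rw [div_le_iff₀ hD]; linarith
      _ = 2 * c := by ring
  have e2 : |w'.2.1 * y - w'.2.2| * w.2.1 ≤ 2 * c := by
    calc |w'.2.1 * y - w'.2.2| * w.2.1 ≤ c / w'.2.1 * M := by gcongr
      _ = c * (M / w'.2.1) := by ring
      _ ≤ c * 2 := by gcongr; rw [div_le_iff₀ hD']; linarith
      _ = 2 * c := by ring
  have e3 : |((w.2.2 * w'.2.1 - w'.2.2 * w.2.1 : ℤ) : ℝ)| < 1 := by
    push_cast
    calc |(w.2.2 : ℝ) * w'.2.1 - w'.2.2 * w.2.1|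
        = |(w'.2.1 * y - w'.2.2) * w.2.1 - (w.2.1 * y - w.2.2) * w'.2.1| := by ring_nf
      _ ≤ |(w'.2.1 * y - w'.2.2) * w.2.1| + |(w.2.1 * y - w.2.2) * w'.2.1| := abs_sub _ _
      _ = |w'.2.1 * y - w'.2.2| * w.2.1 + |w.2.1 * y - w.2.2| * w'.2.1 := by
        rw [abs_mul, abs_mul, abs_of_pos hD, abs_of_pos hD']
      _ < 1 := by linarith
  have e4 : |w.2.2 * w'.2.1 - w'.2.2 * w.2.1| < 1 := by exact_mod_cast e3
  exact sub_eq_zero.1 (Int.abs_lt_one_iff.1 e4)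

lemma eq_of_div_eq_div {w w' : ℤ × ℕ × ℤ} (hw : 0 < w.2.1) (hw' : 0 < w'.2.1)
    (ht : (w.1 : ℝ) / w.2.1 = w'.1 / w'.2.1) (hn : w.2.2 * w'.2.1 = w'.2.2 * w.2.1)
    (hg : tripleGcd w = tripleGcd w') : w = w' := by
  have h1 : w.1 * w'.2.1 = w'.1 * w.2.1 := by
    rw [div_eq_div_iff (by positivity) (by positivity)] at ht
    exact_mod_cast ht
  have h2 := tripleGcd_mul w w'.2.1
  rw [h1, hn, mul_comm w.2.1, tripleGcd_mul w' w.2.1, hg] at h2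
  have h3 : 0 < tripleGcd w' := Nat.gcd_pos_of_pos_left _ (Nat.gcd_pos_of_pos_right _ hw')
  have h4 : w.2.1 = w'.2.1 := Nat.eq_of_mul_eq_mul_left h3 h2
  have h5 : (w'.2.1 : ℤ) ≠ 0 := by omega
  rw [h4] at h1 hn
  exact Prod.ext (mul_right_cancel₀ h5 h1) (Prod.ext h4 (mul_right_cancel₀ h5 hn))

lemma QuadConvex.card_near_integer_le {κ Λ : ℝ} {φ ψ : ℝ → ℝ} (h : QuadConvex κ Λ φ ψ) {T : ℝ}
    (hT : 0 ≤ T) : ∃ c : ℝ, 0 < c ∧ c < 1 / 8 ∧ ∃ C : ℝ, 0 < C ∧ ∀ M E : ℝ, 1 ≤ M → 0 ≤ E →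
      ∀ W : Finset (ℤ × ℕ × ℤ), (∀ w ∈ W, M / 2 < w.2.1 ∧ (w.2.1 : ℝ) ≤ M ∧
        |(w.1 : ℝ)| ≤ T * w.2.1 ∧ |w.2.1 * φ (w.1 / w.2.1) - w.2.2| ≤ E ∧
        |w.2.1 * φ (w.1 / w.2.1) - w.2.2| ≤ c / w.2.1) →
      (W.card : ℝ) ≤ C * (M * (1 + Real.log M) + E * M ^ 3) := by
  obtain ⟨c, hc, hc8, C, hC, hmain⟩ := h.card_nearRational_le hT
  refine ⟨c / 4, by positivity, by linarith, 4 * C, by positivity, fun M E hM hE W hW => ?_⟩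
  have hM0 : 0 < M := by linarith
  have hD : ∀ w ∈ W, 0 < w.2.1 := fun w hw => by
    have : (0 : ℝ) < w.2.1 := by linarith [(hW w hw).1]
    exact_mod_cast this
  have hmaps : ∀ w ∈ W, tripleGcd w ∈ Finset.Icc 1 ⌊M⌋₊ := by
    intro w hw
    refine Finset.mem_Icc.2 ⟨Nat.gcd_pos_of_pos_left _ (Nat.gcd_pos_of_pos_right _ (hD w hw)), ?_⟩
    exact (Nat.le_of_dvd (hD w hw) (tripleGcd_dvd w).2.1).trans (Nat.le_floor (hW w hw).2.1)
  have hfib : ∀ k ∈ Finset.Icc 1 ⌊M⌋₊, (((W.filter fun w => tripleGcd w = k).card : ℕ) : ℝ) ≤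
      C * M * (1 / k) + 2 * C * E * M ^ 3 * (1 / (k : ℝ) ^ 2) := by
    intro k hk
    obtain ⟨hk1, hkM⟩ := Finset.mem_Icc.1 hk
    have hk1' : (1 : ℝ) ≤ k := by exact_mod_cast hk1
    have hkM' : (k : ℝ) ≤ M := (Nat.le_floor_iff hM0.le).1 hkM
    have hk0 : (0 : ℝ) < k := by linarith
    set F := W.filter fun w => tripleGcd w = k with hF
    have hinj : Set.InjOn (fun w : ℤ × ℕ × ℤ => (w.1 : ℝ) / w.2.1) F := by
      intro w hw w' hw' ht
      obtain ⟨hwW, hwk⟩ := Finset.mem_filter.1 (Finset.mem_coe.1 hw)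
      obtain ⟨hwW', hwk'⟩ := Finset.mem_filter.1 (Finset.mem_coe.1 hw')
      have a := hW w hwW
      have a' := hW w' hwW'
      exact eq_of_div_eq_div (hD w hwW) (hD w' hwW') ht
        (div_eq_div_of_near (by linarith) ⟨a.1, a.2.1, a.2.2.2.2⟩ ⟨a'.1, a'.2.1, a'.2.2.2.2⟩ hM0 ht)
        (hwk.trans hwk'.symm)
    rw [← Finset.card_image_of_injOn hinj]
    set ε := min (2 * E / M) (c / M ^ 2) with hε
    have hε0 : 0 ≤ ε := by positivity
    have hb := hmain (M / k) ε (by rw [le_div_iff₀ hk0]; linarith) hε0 ?_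
      (F.image fun w : ℤ × ℕ × ℤ => (w.1 : ℝ) / w.2.1) ?_
    · refine hb.trans ?_
      have h1 : ε * (M / k) ^ 4 ≤ 2 * E * M ^ 3 * (1 / (k : ℝ) ^ 2) := by
        calc ε * (M / k) ^ 4 ≤ 2 * E / M * (M / k) ^ 4 := by gcongr; exact min_le_left _ _
          _ = 2 * E * M ^ 3 * (1 / (k : ℝ) ^ 4) := by field_simp
          _ ≤ 2 * E * M ^ 3 * (1 / (k : ℝ) ^ 2) := by gcongr; norm_num [hk1']
      calc C * (M / k + ε * (M / k) ^ 4) ≤ C * (M / k + 2 * E * M ^ 3 * (1 / (k : ℝ) ^ 2)) := by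
            gcongr
        _ = _ := by ring
    · calc ε * (M / k) ^ 2 ≤ c / M ^ 2 * (M / 1) ^ 2 := by
            gcongr
            exact min_le_right _ _
        _ = c := by field_simp
    · intro t ht
      obtain ⟨w, hw, rfl⟩ := Finset.mem_image.1 ht
      obtain ⟨hwW, hwk⟩ := Finset.mem_filter.1 hw
      obtain ⟨w1, w2, w3, w4, w5⟩ := hW w hwW
      have hw0 : (0 : ℝ) < w.2.1 := by exact_mod_cast hD w hwW
      obtain ⟨⟨a, ha⟩, ⟨d, hd⟩, ⟨n, hn⟩⟩ := hwk ▸ tripleGcd_dvd w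
      have ha' : (w.1 : ℝ) = k * a := by exact_mod_cast ha
      have hd' : (w.2.1 : ℝ) = k * d := by exact_mod_cast hd
      have hn' : (w.2.2 : ℝ) = k * n := by exact_mod_cast hn
      have hd0 : 0 < d := by
        have := hD w hwW
        rw [hd] at this
        exact Nat.pos_of_mul_pos_left this
      have hd0' : (0 : ℝ) < d := by exact_mod_cast hd0
      refine ⟨?_, a, n, d, hd0, ?_, ?_, ?_⟩
      · rw [abs_div, abs_of_pos hw0, div_le_iff₀ hw0]
        exact w3
      · rw [le_div_iff₀ hk0]; linarith
      · rw [ha', hd']; field_simp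
      · have e1 : |φ ((w.1 : ℝ) / w.2.1) - n / d| =
            |w.2.1 * φ ((w.1 : ℝ) / w.2.1) - w.2.2| / w.2.1 := by
          rw [eq_div_iff hw0.ne', ← abs_of_pos hw0, ← abs_mul, abs_of_pos hw0, hn']
          congr 1
          generalize φ _ = y
          rw [hd']
          field_simp
        rw [e1]
        refine le_min ?_ ?_
        · rw [div_le_iff₀ hw0]
          refine w4.trans ?_
          rw [div_mul_eq_mul_div, le_div_iff₀ hM0]
          nlinarith
        · rw [div_le_iff₀ hw0]
          refine w5.trans ?_
          rw [div_mul_eq_mul_div, div_div, div_le_div_iff₀ (by positivity) (by positivity)]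
          have : M ^ 2 ≤ 4 * (w.2.1 : ℝ) ^ 2 := by nlinarith
          nlinarith
  rw [Finset.card_eq_sum_card_fiberwise hmaps, Nat.cast_sum]
  calc _ ≤ ∑ k ∈ Finset.Icc 1 ⌊M⌋₊, (C * M * (1 / k) + 2 * C * E * M ^ 3 * (1 / (k : ℝ) ^ 2)) :=
        Finset.sum_le_sum hfib
    _ = C * M * ∑ k ∈ Finset.Icc 1 ⌊M⌋₊, (1 : ℝ) / k +
        2 * C * E * M ^ 3 * ∑ k ∈ Finset.Icc 1 ⌊M⌋₊, 1 / (k : ℝ) ^ 2 := by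
      rw [Finset.sum_add_distrib, Finset.mul_sum, Finset.mul_sum]
    _ ≤ C * M * (1 + Real.log M) + 2 * C * E * M ^ 3 * 2 := by
      gcongr
      · exact sum_inv_floor_le hM
      · exact sum_inv_sq_floor_le _
    _ ≤ 4 * C * (M * (1 + Real.log M) + E * M ^ 3) := by
      have : 0 ≤ C * (M * (1 + Real.log M)) := by
        have := Real.log_nonneg hM
        positivity
      nlinarith

lemma sum_le_of_card_sublevel_le {ι : Type*} {e f : ι → ℝ} {A B L c : ℝ} (hB : 0 ≤ B)
    (hL : 0 ≤ L) (hc : 0 ≤ c) (s : Finset ι) : (∀ i ∈ s, 0 ≤ f i) → (∀ i ∈ s, 0 ≤ e i) → (∀ i ∈ s, f i ≤ c) →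
    (∀ i ∈ s, f i * √(e i) ≤ L) →
    (∀ E, 0 ≤ E → ((s.filter fun i => e i ≤ E).card : ℝ) ≤ A + B * E) →
    ∑ i ∈ s, f i ≤ c * (A + 1) + 2 * L * √(B * max (s.card - A) 0) := by
  induction s using Finset.induction_on_max_value e with
  | empty =>
    intro _ _ _ _ h
    have hA := h 0 le_rfl
    simp only [Finset.filter_empty, Finset.card_empty, Nat.cast_zero] at hA
    have : 0 ≤ A := by linarith
    rw [Finset.sum_empty]
    positivity
  | insert a s ha hmax ih =>
    intro h0 he hfc hfe hcard
    have hall : (insert a s).filter (fun i => e i ≤ e a) = insert a s := by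
      refine Finset.filter_true_of_mem fun i hi => ?_
      rcases Finset.mem_insert.1 hi with rfl | hi
      · exact le_rfl
      · exact hmax i hi
    have hn := hcard (e a) (he a (Finset.mem_insert_self a s))
    rw [hall] at hn
    by_cases hsmall : ((insert a s).card : ℝ) ≤ A + 1
    · calc ∑ i ∈ insert a s, f i ≤ (insert a s).card • c := Finset.sum_le_card_nsmul _ _ _ hfc
        _ = c * (insert a s).card := by rw [nsmul_eq_mul, mul_comm]
        _ ≤ c * (A + 1) := by gcongr
        _ ≤ _ := le_add_of_nonneg_right (by positivity)
    push Not at hsmall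
    have hins : ∀ i ∈ s, i ∈ insert a s := fun i hi => Finset.mem_insert_of_mem hi
    have hih := ih (fun i hi => h0 i (hins i hi)) (fun i hi => he i (hins i hi))
      (fun i hi => hfc i (hins i hi)) (fun i hi => hfe i (hins i hi)) fun E hE => by
        refine le_trans ?_ (hcard E hE)
        exact_mod_cast Finset.card_le_card (Finset.filter_subset_filter _ (Finset.subset_insert a s))
    have hcard1 : ((insert a s).card : ℝ) = s.card + 1 := by
      rw [Finset.card_insert_of_notMem ha]; push_cast; ring
    rw [hcard1] at hn hsmall ⊢
    rw [Finset.sum_insert ha]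
    rw [max_eq_left (by linarith)] at hih ⊢
    set u := √(B * (s.card + 1 - A)) with hu
    set v := √(B * (s.card - A)) with hv
    have hu2 : u ^ 2 = B * (s.card + 1 - A) := Real.sq_sqrt (by nlinarith)
    have hv2 : v ^ 2 = B * (s.card - A) := Real.sq_sqrt (by nlinarith)
    have hu0 : 0 ≤ u := Real.sqrt_nonneg _
    have hv0 : 0 ≤ v := Real.sqrt_nonneg _
    have hea := he a (Finset.mem_insert_self a s)
    have hBpos : 0 < B := by
      rcases hB.lt_or_eq with h | h
      · exact h
      · rw [← h] at hn; linarith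
    set r := √(e a) with hr
    have hr0 : 0 ≤ r := Real.sqrt_nonneg _
    have hr2 : r ^ 2 = e a := Real.sq_sqrt hea
    have huv : v ≤ u := Real.sqrt_le_sqrt (by nlinarith)
    have hur : u ≤ B * r := by
      refine le_of_sq_le_sq ?_ (by positivity)
      rw [hu2, mul_pow, hr2]
      nlinarith
    have h1 : 1 ≤ 2 * r * (u - v) := by
      have : B * 1 ≤ B * (2 * r * (u - v)) := by
        calc B * 1 = (u + v) * (u - v) := by linarith
          _ ≤ (2 * (B * r)) * (u - v) := by
            gcongr
            · linarith
          _ = _ := by ring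
      exact le_of_mul_le_mul_left this hBpos
    have hfa := h0 a (Finset.mem_insert_self a s)
    have hfa' := hfe a (Finset.mem_insert_self a s)
    have h2 : f a ≤ 2 * L * (u - v) := by
      calc f a = f a * 1 := (mul_one _).symm
        _ ≤ f a * (2 * r * (u - v)) := by gcongr
        _ = 2 * (f a * r) * (u - v) := by ring
        _ ≤ 2 * L * (u - v) := by
          gcongr
    linarith

/-- A form of partial summation: the sublevel sets of `e` control the sum of a function which is
bounded by `c` and by `L e ^ (-1/2)`. -/
lemma sum_le_of_card_sublevel_le_of_le {ι : Type*} {e f : ι → ℝ} {A B L c E : ℝ} (hB : 0 ≤ B)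
    (hL : 0 ≤ L) (hc : 0 ≤ c) (hE : 0 ≤ E) (s : Finset ι) (h0 : ∀ i ∈ s, 0 ≤ f i)
    (he : ∀ i ∈ s, 0 ≤ e i) (hfc : ∀ i ∈ s, f i ≤ c) (hfe : ∀ i ∈ s, f i * √(e i) ≤ L)
    (hsE : ∀ i ∈ s, e i ≤ E)
    (hcard : ∀ E, 0 ≤ E → ((s.filter fun i => e i ≤ E).card : ℝ) ≤ A + B * E) :
    ∑ i ∈ s, f i ≤ c * (A + 1) + 2 * L * (B * √E) := by
  refine (sum_le_of_card_sublevel_le hB hL hc s h0 he hfc hfe hcard).trans ?_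
  have h1 := hcard E hE
  rw [Finset.filter_true_of_mem hsE] at h1
  have h2 : √(B * max (s.card - A) 0) ≤ B * √E := by
    have : B * √E = √(B * (B * E)) := by
      rw [← mul_assoc, Real.sqrt_mul (by positivity), Real.sqrt_mul_self hB]
    rw [this]
    gcongr
    exact max_le (by linarith) (by positivity)
  gcongr

lemma one_add_log_le_two_mul_sqrt {x : ℝ} (hx : 1 ≤ x) : 1 + Real.log x ≤ 2 * √x := by
  have h1 : Real.log (√x) ≤ √x - 1 := Real.log_le_sub_one_of_pos (Real.sqrt_pos.2 (by linarith))
  rw [Real.log_sqrt (by linarith)] at h1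
  linarith

lemma sum_le_of_dyadic_blocks {ι : Type*} {d g : ι → ℝ} {a b J : ℝ} (ha : 0 ≤ a) (hb : 0 ≤ b)
    (s : Finset ι) (hd : ∀ i ∈ s, 1 ≤ d i)
    (hblock : ∀ M, 1 ≤ M → M ≤ J →
      ∑ i ∈ s.filter (fun i => M / 2 < d i ∧ d i ≤ M), g i ≤ a * √M + b * M ^ 2) (N : ℕ) :
    ∀ M, 0 ≤ M → M ≤ J → M < 2 ^ N →
      ∑ i ∈ s.filter (fun i => d i ≤ M), g i ≤ 4 * a * √M + 2 * b * M ^ 2 := by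
  have hsmall : ∀ M, 0 ≤ M → M < 1 →
      ∑ i ∈ s.filter (fun i => d i ≤ M), g i ≤ 4 * a * √M + 2 * b * M ^ 2 := by
    intro M hM0 hM1
    rw [Finset.filter_false_of_mem fun i hi => by linarith [hd i hi], Finset.sum_empty]
    positivity
  induction N with
  | zero =>
    intro M hM0 _ hM1
    exact hsmall M hM0 (by simpa using hM1)
  | succ N ih =>
    intro M hM0 hMJ hMN
    by_cases hM1 : M < 1
    · exact hsmall M hM0 hM1
    push Not at hM1
    have h1 := ih (M / 2) (by positivity) (by linarith) (by rw [pow_succ] at hMN; linarith)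
    have h2 := hblock M hM1 hMJ
    have hsplit : ∑ i ∈ s.filter (fun i => d i ≤ M), g i =
        ∑ i ∈ s.filter (fun i => d i ≤ M / 2), g i +
          ∑ i ∈ s.filter (fun i => M / 2 < d i ∧ d i ≤ M), g i := by
      rw [← Finset.sum_filter_add_sum_filter_not _ (fun i => d i ≤ M / 2), Finset.filter_filter,
        Finset.filter_filter]
      congr 2
      · ext i
        simp only [Finset.mem_filter]
        exact ⟨fun h => ⟨h.1, h.2.2⟩, fun h => ⟨h.1, by linarith [h.2], h.2⟩⟩
      · ext i
        simp only [Finset.mem_filter, not_le]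
        tauto
    rw [hsplit]
    have h3 : √(M / 2) ≤ 3 / 4 * √M := by
      rw [show (3 : ℝ) / 4 * √M = √((9 / 16) * M) by
        rw [Real.sqrt_mul (by norm_num), show (9 : ℝ) / 16 = (3 / 4) ^ 2 by norm_num,
          Real.sqrt_sq (by norm_num)]]
      gcongr
      linarith
    have h4 : 4 * a * √(M / 2) ≤ 4 * a * (3 / 4 * √M) := by gcongr
    have h5 : 0 ≤ b * M ^ 2 := by positivity
    nlinarith

namespace QuadConvex

variable {κ Λ : ℝ} {φ ψ : ℝ → ℝ}

/-- The contribution of the integer points very close to the dilates of the curve. -/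
lemma sum_near_integer_le (h : QuadConvex κ Λ φ ψ) {T : ℝ} (hT : 0 ≤ T) :
    ∃ c : ℝ, 0 < c ∧ c < 1 / 8 ∧ ∃ C : ℝ, 0 < C ∧ ∀ η J : ℝ, 0 < η → 1 ≤ J →
      ∀ W : Finset (ℤ × ℕ × ℤ), (∀ w ∈ W, 1 ≤ w.2.1 ∧ (w.2.1 : ℝ) ≤ J ∧
        |(w.1 : ℝ)| ≤ T * w.2.1 ∧ |w.2.1 * φ (w.1 / w.2.1) - w.2.2| ≤ c / w.2.1) →
      ∑ w ∈ W, 1 / √((η + |w.2.1 * φ (w.1 / w.2.1) - w.2.2|) * w.2.1) *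
          (1 + Real.log ((η + |w.2.1 * φ (w.1 / w.2.1) - w.2.2|) / η)) ≤
        C * (√J / √η * (1 + Real.log J) + J ^ 2 * (1 + Real.log (1 + 1 / η))) := by
  obtain ⟨c, hc, hc8, C, hC, hcard⟩ := h.card_near_integer_le hT
  refine ⟨c, hc, hc8, 4 * (4 * (C + 1)) + 2 * (4 * C), by positivity, fun η J hη hJ W hW => ?_⟩
  set e : ℤ × ℕ × ℤ → ℝ := fun w => |w.2.1 * φ (w.1 / w.2.1) - w.2.2| with he
  set f : ℤ × ℕ × ℤ → ℝ := fun w => 1 / √(η + e w) * (1 + Real.log ((η + e w) / η)) with hf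
  have he0 : ∀ w, 0 ≤ e w := fun w => abs_nonneg _
  have hlog0 : ∀ w, 0 ≤ Real.log ((η + e w) / η) := fun w =>
    Real.log_nonneg (by rw [le_div_iff₀ hη]; linarith [he0 w])
  have hf0 : ∀ w, 0 ≤ f w := fun w => by
    have := hlog0 w
    have := he0 w
    positivity
  set L := 1 + Real.log (1 + 1 / η) with hL
  have hL1 : 1 ≤ L := by
    have : 0 ≤ Real.log (1 + 1 / η) := Real.log_nonneg (by
      have : 0 ≤ 1 / η := by positivity
      linarith)
    linarith
  have hblock : ∀ M, 1 ≤ M → M ≤ J →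
      ∑ w ∈ W.filter (fun w => M / 2 < (w.2.1 : ℝ) ∧ (w.2.1 : ℝ) ≤ M),
        1 / √((η + e w) * w.2.1) * (1 + Real.log ((η + e w) / η)) ≤
      4 * (C + 1) * (1 / √η * (1 + Real.log J)) * √M + 4 * C * L * M ^ 2 := by
    intro M hM hMJ
    have hM0 : 0 < M := by linarith
    set F := W.filter (fun w => M / 2 < (w.2.1 : ℝ) ∧ (w.2.1 : ℝ) ≤ M) with hF
    have hFm : ∀ w ∈ F, M / 2 < w.2.1 ∧ (w.2.1 : ℝ) ≤ M ∧
        |(w.1 : ℝ)| ≤ T * w.2.1 ∧ e w ≤ c / w.2.1 := fun w hw => by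
      obtain ⟨h1, h2, h3⟩ := Finset.mem_filter.1 hw
      obtain ⟨-, -, h4, h5⟩ := hW w h1
      exact ⟨h2, h3, h4, h5⟩
    have heM : ∀ w ∈ F, e w ≤ 1 / (4 * M) := fun w hw => by
      obtain ⟨h1, h2, h3, h4⟩ := hFm w hw
      refine h4.trans ?_
      rw [div_le_div_iff₀ (by linarith) (by positivity)]
      nlinarith
    have hlogM : 0 ≤ Real.log M := Real.log_nonneg hM
    have hsum := sum_le_of_card_sublevel_le_of_le (e := e) (f := f)
      (A := C * (M * (1 + Real.log M))) (B := C * M ^ 3) (L := L) (c := 2 / √η) (E := 1 / (4 * M))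
      (by positivity) (by positivity) (by positivity) (by positivity) F (fun w _ => hf0 w)
      (fun w _ => he0 w) ?_ ?_ heM ?_
    · have h1 : ∀ w ∈ F, 1 / √((η + e w) * w.2.1) * (1 + Real.log ((η + e w) / η)) ≤
          2 / √M * f w := fun w hw => by
        obtain ⟨h1, h2, h3, h4⟩ := hFm w hw
        have h5 : 1 / √(w.2.1 : ℝ) ≤ 2 / √M := by
          rw [div_le_div_iff₀ (Real.sqrt_pos.2 (by linarith)) (Real.sqrt_pos.2 hM0)]
          rw [one_mul, show (2 : ℝ) = √4 by
            rw [show (4 : ℝ) = 2 ^ 2 by norm_num, Real.sqrt_sq (by norm_num)],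
            ← Real.sqrt_mul (by norm_num)]
          gcongr
          linarith
        have h6 := he0 w
        calc _ = 1 / √(w.2.1 : ℝ) * f w := by
              rw [Real.sqrt_mul (by positivity), hf]
              field_simp
          _ ≤ _ := mul_le_mul_of_nonneg_right h5 (hf0 w)
      have hMs : √M ^ 2 = M := Real.sq_sqrt hM0.le
      have hMs0 : 0 < √M := Real.sqrt_pos.2 hM0
      have h7 : √(1 / (4 * M)) = 1 / (2 * √M) := by
        rw [Real.sqrt_div zero_le_one, Real.sqrt_one, Real.sqrt_mul (by norm_num),
          show (4 : ℝ) = 2 ^ 2 by norm_num, Real.sqrt_sq (by norm_num)]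
      have h8 : M * (1 + Real.log M) * C + 1 ≤ M * (1 + Real.log J) * (C + 1) := by
        have hlJ : Real.log M ≤ Real.log J := Real.log_le_log hM0 hMJ
        have h9 : M * (1 + Real.log M) * C ≤ M * (1 + Real.log J) * C := by gcongr
        have h10 : 1 ≤ M * (1 + Real.log J) := by nlinarith
        linarith
      calc _ ≤ ∑ w ∈ F, 2 / √M * f w := Finset.sum_le_sum h1
        _ = 2 / √M * ∑ w ∈ F, f w := by rw [Finset.mul_sum]
        _ ≤ 2 / √M * (2 / √η * (C * (M * (1 + Real.log M)) + 1) +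
            2 * L * (C * M ^ 3 * √(1 / (4 * M)))) := by gcongr
        _ = 4 / √η / √M * (M * (1 + Real.log M) * C + 1) + 2 * C * L * (M ^ 3 / √M ^ 2) := by
          rw [h7]; field_simp; ring
        _ ≤ 4 / √η / √M * (M * (1 + Real.log J) * (C + 1)) + 4 * C * L * (M ^ 3 / √M ^ 2) := by
          gcongr
          norm_num
        _ = 4 * (C + 1) * (1 / √η * (1 + Real.log J)) * (√M ^ 2 / √M) +
            4 * C * L * (M ^ 3 / √M ^ 2) := by rw [hMs]; ring
        _ = _ := by
          rw [show √M ^ 2 / √M = √M by field_simp, hMs]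
          field_simp
    · intro w _
      have h1 := he0 w
      have h2 := one_add_log_le_two_mul_sqrt (x := (η + e w) / η) (by
        rw [le_div_iff₀ hη]; linarith)
      rw [Real.sqrt_div (by positivity)] at h2
      have h3 : 0 < √(η + e w) := Real.sqrt_pos.2 (by positivity)
      calc f w ≤ 1 / √(η + e w) * (2 * (√(η + e w) / √η)) := by
            simp only [hf]
            gcongr
        _ = 2 / √η := by field_simp
    · intro w hw
      have h1 := he0 w
      have h2 : √(e w) ≤ √(η + e w) := Real.sqrt_le_sqrt (by linarith)
      have h3 : 0 < √(η + e w) := Real.sqrt_pos.2 (by positivity)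
      have h4 : 1 + Real.log ((η + e w) / η) ≤ L := by
        have h5 : e w ≤ 1 := (heM w hw).trans (by
          rw [div_le_one (by positivity)]; linarith)
        rw [hL, add_div, div_self hη.ne']
        gcongr
      calc f w * √(e w) ≤ f w * √(η + e w) := mul_le_mul_of_nonneg_left h2 (hf0 w)
        _ = 1 + Real.log ((η + e w) / η) := by simp only [hf]; field_simp
        _ ≤ L := h4
    · intro E hE
      refine (hcard M E hM hE _ fun w hw => ?_).trans (le_of_eq (by ring))
      obtain ⟨hw1, hw2⟩ := Finset.mem_filter.1 hw
      obtain ⟨h1, h2, h3, h4⟩ := hFm w hw1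
      exact ⟨h1, h2, h3, hw2, h4⟩
  have hlogJ : 0 ≤ Real.log J := Real.log_nonneg hJ
  obtain ⟨N, hN⟩ := pow_unbounded_of_one_lt J (one_lt_two)
  have hfin := sum_le_of_dyadic_blocks (d := fun w : ℤ × ℕ × ℤ => (w.2.1 : ℝ)) (J := J)
    (by positivity) (by positivity) W (fun w hw => by exact_mod_cast (hW w hw).1) hblock N J
    (by linarith) le_rfl hN
  rw [Finset.filter_true_of_mem fun w hw => (hW w hw).2.1] at hfin
  refine hfin.trans ?_
  have p1 : 0 ≤ √J / √η * (1 + Real.log J) := by positivity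
  have p2 : 0 ≤ J ^ 2 * L := by positivity
  have e1 : 4 * (4 * (C + 1) * (1 / √η * (1 + Real.log J))) * √J =
      4 * (4 * (C + 1)) * (√J / √η * (1 + Real.log J)) := by ring
  rw [e1]
  have p3 := mul_nonneg hC.le p1
  have p4 := mul_nonneg hC.le p2
  nlinarith

end QuadConvex

/-- Sampling the reciprocal of a perturbed quadratic function along a separated set. -/
lemma sum_inv_quadratic_le {κ Λ B : ℝ} (hκ : 0 < κ) (hΛ : 0 < Λ) (hB : 0 < B) :
    ∃ C : ℝ, 0 < C ∧ ∀ η h d e : ℝ, 0 < η → 0 < h → 0 < d → h * √((η + |e|) * d) ≤ B * η →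
      ∀ (ρ : ℝ → ℝ) (U : Finset ℝ), Separated h U → (∀ u ∈ U, 0 ≤ u) →
      (∀ u ∈ U, κ * u ^ 2 ≤ ρ u ∧ ρ u ≤ Λ * u ^ 2) →
      (∀ u ∈ U, ∀ u' ∈ U, u < u' → κ * (u' - u) * u' ≤ ρ u' - ρ u) →
      ∑ u ∈ U, 1 / (η + |e - d * ρ u|) ≤
        C * (1 / (h * √((η + |e|) * d)) * (1 + Real.log ((η + |e|) / η))) := by
  set α := 1 / (2 * (1 + Λ)) with hα
  have hα0 : 0 < α := by positivity
  have hαΛ : Λ * α ^ 2 ≤ 1 / 4 := by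
    rw [hα, div_pow, one_pow, mul_one_div, div_le_div_iff₀ (by positivity) (by norm_num)]
    nlinarith
  set β := 2 * (1 + 1 / κ) with hβ
  have hβ0 : 0 < β := by positivity
  have hβκ : 2 ≤ κ * β ^ 2 := by
    have : κ * β ^ 2 = 4 * κ + 8 + 4 / κ := by rw [hβ]; field_simp; ring
    rw [this]
    have : 0 < 4 / κ := by positivity
    linarith
  set ℓ := Real.log (2 + Λ * β ^ 2) with hℓ
  have hℓ0 : 0 ≤ ℓ := Real.log_nonneg (by have : 0 < Λ * β ^ 2 := by positivity
                                          linarith)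
  refine ⟨(2 * B + 2 * α) + (2 * B / (κ * β ^ 2) + 2 / (κ * β)) +
    (2 * B + 2 / (κ * α) * (1 + ℓ)), by positivity, ?_⟩
  intro η h d e hη hh hd hS ρ U hU hU0 hρ hinc
  set e' := η + |e| with he'
  have hee' : |e| ≤ e' := by linarith
  have hηe' : η ≤ e' := by linarith [abs_nonneg e]
  have he'0 : 0 < e' := by linarith
  set S := h * √(e' * d) with hSdef
  set τ := √(e' / d) with hτ
  have hτ0 : 0 < τ := Real.sqrt_pos.2 (by positivity)
  have hτ2 : d * τ ^ 2 = e' := by rw [hτ, Real.sq_sqrt (by positivity)]; field_simp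
  have hSτ : S = h * d * τ := by
    rw [hSdef, mul_assoc, ← hτ2, show d * τ ^ 2 * d = (d * τ) ^ 2 by ring,
      Real.sqrt_sq (by positivity)]
  have hS0 : 0 < S := by rw [hSτ]; positivity
  have hηS : 1 / η ≤ B / S := by
    rw [div_le_div_iff₀ hη hS0]; linarith
  have he'S : 1 / e' ≤ B / S := (one_div_le_one_div_of_le hη hηe').trans hηS
  have hlog0 : 0 ≤ Real.log (e' / η) := Real.log_nonneg (by rwa [le_div_iff₀ hη, one_mul])
  have hnear : ∑ u ∈ U with u ≤ α * τ, 1 / (η + |e - d * ρ u|) ≤ (2 * B + 2 * α) / S := by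
    have h1 : ∀ u ∈ U.filter (fun u => u ≤ α * τ), 1 / (η + |e - d * ρ u|) ≤ 2 / e' := by
      intro u hu
      obtain ⟨hu, hun⟩ := Finset.mem_filter.1 hu
      have h2 : ρ u ≤ Λ * (α * τ) ^ 2 := (hρ u hu).2.trans (by
        have := hU0 u hu
        gcongr)
      have h3 : d * ρ u ≤ e' / 4 := by
        calc d * ρ u ≤ d * (Λ * (α * τ) ^ 2) := by gcongr
          _ = (Λ * α ^ 2) * (d * τ ^ 2) := by ring
          _ ≤ 1 / 4 * (d * τ ^ 2) := by gcongr
          _ = e' / 4 := by rw [hτ2]; ring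
      have h4 : 0 ≤ d * ρ u := mul_nonneg hd.le (le_trans (by positivity) (hρ u hu).1)
      have h5 : |e| ≤ |e - d * ρ u| + |d * ρ u| := by
        simpa using abs_add_le (e - d * ρ u) (d * ρ u)
      rw [abs_of_nonneg h4] at h5
      rw [div_le_div_iff₀ (by positivity) he'0]
      linarith
    have h6 := card_separated_le hh (ℓ := α * τ) (u := 0) (by positivity)
      (hU.mono (Finset.filter_subset (fun u => u ≤ α * τ) U)) fun u hu => by
        obtain ⟨hu, hun⟩ := Finset.mem_filter.1 hu
        exact ⟨hU0 u hu, by linarith⟩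
    calc _ ≤ _ := Finset.sum_le_card_nsmul _ _ _ h1
      _ = ((U.filter fun u => u ≤ α * τ).card : ℝ) * (2 / e') := nsmul_eq_mul _ _
      _ ≤ (1 + α * τ / h) * (2 / e') := by gcongr
      _ = 2 * (1 / e') + 2 * α / S := by rw [hSτ, ← hτ2]; field_simp
      _ ≤ 2 * (B / S) + 2 * α / S := by gcongr
      _ = _ := by ring
  have hfar : ∑ u ∈ U with β * τ < u, 1 / (η + |e - d * ρ u|) ≤
      (2 * B / (κ * β ^ 2) + 2 / (κ * β)) / S := by
    have h1 : ∀ u ∈ U.filter (fun u => β * τ < u), 1 / (η + |e - d * ρ u|) ≤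
        2 / (κ * d) * (1 / u ^ 2) := by
      intro u hu
      obtain ⟨hu, hun⟩ := Finset.mem_filter.1 hu
      have hu0 : 0 < u := lt_trans (by positivity) hun
      have h2 : 2 * e' ≤ d * (κ * u ^ 2) := by
        calc 2 * e' = 2 * (d * τ ^ 2) := by rw [hτ2]
          _ ≤ (κ * β ^ 2) * (d * τ ^ 2) := by gcongr
          _ = d * (κ * (β * τ) ^ 2) := by ring
          _ ≤ d * (κ * u ^ 2) := by gcongr
      have h3 : d * (κ * u ^ 2) ≤ d * ρ u := by
        have := (hρ u hu).1
        gcongr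
      have h4 : d * ρ u ≤ |e - d * ρ u| + |e| := by
        have := abs_sub_abs_le_abs_sub (d * ρ u) e
        rw [abs_sub_comm] at this
        linarith [le_abs_self (d * ρ u)]
      rw [show 2 / (κ * d) * (1 / u ^ 2) = 1 / (d * (κ * u ^ 2) / 2) by field_simp]
      refine one_div_le_one_div_of_le (by positivity) ?_
      linarith
    calc _ ≤ ∑ u ∈ U with β * τ < u, 2 / (κ * d) * (1 / u ^ 2) := Finset.sum_le_sum h1
      _ = 2 / (κ * d) * ∑ u ∈ U with β * τ < u, 1 / u ^ 2 := by rw [Finset.mul_sum]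
      _ ≤ 2 / (κ * d) * (1 / (β * τ) ^ 2 + 1 / (h * (β * τ))) := by
        gcongr
        refine sum_inv_sq_le hh (by positivity)
          (hU.mono (Finset.filter_subset (fun u => β * τ < u) U)) fun u hu => ?_
        exact (Finset.mem_filter.1 hu).2.le
      _ = 2 / (κ * β ^ 2) * (1 / e') + 2 / (κ * β) / S := by rw [hSτ, ← hτ2]; field_simp
      _ ≤ 2 / (κ * β ^ 2) * (B / S) + 2 / (κ * β) / S := by gcongr
      _ = _ := by ring
  have hmid : ∑ u ∈ U with ¬ u ≤ α * τ ∧ ¬ β * τ < u, 1 / (η + |e - d * ρ u|) ≤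
      (2 * B + 2 / (κ * α) * (ℓ + Real.log (e' / η))) / S := by
    set W := U.filter fun u => ¬ u ≤ α * τ ∧ ¬ β * τ < u with hW
    have hstep : ∀ u ∈ W, ∀ u' ∈ W, u < u' → e - d * ρ u' + κ * α * S ≤ e - d * ρ u := by
      intro u hu u' hu' huu
      obtain ⟨hu, hu1, hu2⟩ := Finset.mem_filter.1 hu
      obtain ⟨hu', hu1', hu2'⟩ := Finset.mem_filter.1 hu'
      push Not at hu1 hu1'
      have h1 := hinc u hu u' hu' huu
      have h2 := hU u hu u' hu' huu
      have h3 : κ * h * (α * τ) ≤ κ * (u' - u) * u' := by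
        gcongr
        linarith
      have h4 : κ * α * S ≤ d * (ρ u' - ρ u) := by
        calc κ * α * S = d * (κ * h * (α * τ)) := by rw [hSτ]; ring
          _ ≤ d * (ρ u' - ρ u) := by
            gcongr
            exact h3.trans h1
      linarith
    have hσ0 : 0 < κ * α * S := by positivity
    have hinj : ∀ u ∈ W, ∀ u' ∈ W, e - d * ρ u = e - d * ρ u' → u = u' := by
      intro u hu u' hu' heq
      rcases lt_trichotomy u u' with hlt | heq' | hlt
      · linarith [hstep u hu u' hu' hlt]
      · exact heq'
      · linarith [hstep u' hu' u hu hlt]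
    have hsep : Separated (κ * α * S) (W.image fun u => e - d * ρ u) := by
      intro x hx y hy hxy
      obtain ⟨u, hu, rfl⟩ := Finset.mem_image.1 hx
      obtain ⟨u', hu', rfl⟩ := Finset.mem_image.1 hy
      rcases lt_trichotomy u u' with hlt | heq' | hlt
      · linarith [hstep u hu u' hu' hlt]
      · rw [heq'] at hxy
        exact absurd hxy (lt_irrefl _)
      · exact hstep u' hu' u hu hlt
    have hbd : ∀ v ∈ W.image (fun u => e - d * ρ u), |v| ≤ (1 + Λ * β ^ 2) * e' := by
      intro v hv
      obtain ⟨u, hu, rfl⟩ := Finset.mem_image.1 hv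
      obtain ⟨hu, hu1, hu2⟩ := Finset.mem_filter.1 hu
      push Not at hu2
      have h4 : 0 ≤ d * ρ u := mul_nonneg hd.le (le_trans (by positivity) (hρ u hu).1)
      have h2 : ρ u ≤ Λ * (β * τ) ^ 2 := (hρ u hu).2.trans (by
        have := hU0 u hu
        gcongr)
      have h3 : d * ρ u ≤ Λ * β ^ 2 * e' := by
        calc d * ρ u ≤ d * (Λ * (β * τ) ^ 2) := by gcongr
          _ = Λ * β ^ 2 * (d * τ ^ 2) := by ring
          _ = _ := by rw [hτ2]
      have h5 := abs_sub e (d * ρ u)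
      rw [abs_of_nonneg h4] at h5
      linarith
    have hsum := sum_inv_add_abs_le hσ0 hη (by positivity) hsep hbd
    rw [Finset.sum_image hinj] at hsum
    have hlog : Real.log (1 + (1 + Λ * β ^ 2) * e' / η) ≤ ℓ + Real.log (e' / η) := by
      rw [hℓ, ← Real.log_mul (by positivity) (by positivity)]
      refine Real.log_le_log (by positivity) ?_
      have : 1 ≤ e' / η := by rwa [le_div_iff₀ hη, one_mul]
      rw [mul_div_assoc]
      nlinarith
    calc _ ≤ 2 * (1 / η + 1 / (κ * α * S) * Real.log (1 + (1 + Λ * β ^ 2) * e' / η)) := hsum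
      _ ≤ 2 * (B / S + 1 / (κ * α * S) * (ℓ + Real.log (e' / η))) := by gcongr
      _ = _ := by field_simp
  have hsplit : ∑ u ∈ U, 1 / (η + |e - d * ρ u|) ≤
      ∑ u ∈ U with u ≤ α * τ, 1 / (η + |e - d * ρ u|) +
      ∑ u ∈ U with β * τ < u, 1 / (η + |e - d * ρ u|) +
      ∑ u ∈ U with ¬ u ≤ α * τ ∧ ¬ β * τ < u, 1 / (η + |e - d * ρ u|) := by
    rw [← Finset.sum_filter_add_sum_filter_not U (fun u => u ≤ α * τ), add_assoc]
    refine add_le_add le_rfl ?_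
    rw [← Finset.sum_filter_add_sum_filter_not (U.filter fun u => ¬ u ≤ α * τ) (fun u => β * τ < u),
      Finset.filter_filter, Finset.filter_filter]
    refine add_le_add ?_ le_rfl
    refine Finset.sum_le_sum_of_subset_of_nonneg (fun u hu => ?_) fun u _ _ => by positivity
    simp only [Finset.mem_filter] at hu ⊢
    exact ⟨hu.1, hu.2.2⟩
  have hfinal : (2 * B + 2 * α) / S + (2 * B / (κ * β ^ 2) + 2 / (κ * β)) / S +
      (2 * B + 2 / (κ * α) * (ℓ + Real.log (e' / η))) / S ≤
      ((2 * B + 2 * α) + (2 * B / (κ * β ^ 2) + 2 / (κ * β)) + (2 * B + 2 / (κ * α) * (1 + ℓ))) *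
        (1 / S * (1 + Real.log (e' / η))) := by
    rw [← add_div, ← add_div, one_div_mul_eq_div, ← mul_div_assoc _ _ S]
    refine div_le_div_of_nonneg_right ?_ hS0.le
    have p1 : 0 ≤ ((2 * B + 2 * α) + (2 * B / (κ * β ^ 2) + 2 / (κ * β)) + 2 * B) *
      Real.log (e' / η) := by positivity
    have p2 : 0 ≤ 2 / (κ * α) := by positivity
    have p3 : 0 ≤ 2 / (κ * α) * (ℓ * Real.log (e' / η)) := by positivity
    nlinarith
  linarith

namespace QuadConvex

variable {κ Λ : ℝ} {φ ψ : ℝ → ℝ}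

/-- Sampling along a separated set the height at `x` of the tangent lines of a dilated curve. -/
lemma sum_inv_tangent_le (h : QuadConvex κ Λ φ ψ) {B : ℝ} (hB : 0 < B) :
    ∃ C : ℝ, 0 < C ∧ ∀ η δ d x n : ℝ, 0 < η → 0 < δ → 0 < d →
      δ * √((η + |d * φ x - n|) * d) ≤ B * η → ∀ X : Finset ℝ, Separated δ X →
      ∑ t ∈ X, 1 / (η + |d * (φ t + ψ t * (x - t)) - n|) ≤
        C * (1 / (δ * √((η + |d * φ x - n|) * d)) *
          (1 + Real.log ((η + |d * φ x - n|) / η))) := by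
  obtain ⟨C, hC, hmain⟩ := sum_inv_quadratic_le h.pos h.upper_pos hB
  refine ⟨2 * C, by positivity, fun η δ d x n hη hδ hd hS X hX => ?_⟩
  have hinc : ∀ t t', 0 ≤ (t - x) * (t' - t) → κ * (t' - t) * (t' - x) ≤
      (φ x - φ t' - ψ t' * (x - t')) - (φ x - φ t - ψ t * (x - t)) := by
    intro t t' hpos
    have h1 := h.lower t' t
    have h2 := h.lower t t'
    have h3 : 2 * κ * ((t' - t) * (t - x)) ≤ (ψ t' - ψ t) * (t - x) := by
      rcases eq_or_ne t' t with rfl | hne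
      · simp
      · have h4 : 0 < (t' - t) ^ 2 := by
          have := sub_ne_zero.2 hne
          positivity
        have h5 : 2 * κ * (t' - t) ^ 2 ≤ (ψ t' - ψ t) * (t' - t) := by nlinarith
        have h6 : 2 * κ * (t' - t) ^ 2 * ((t - x) * (t' - t)) ≤
            (ψ t' - ψ t) * (t' - t) * ((t - x) * (t' - t)) := by gcongr
        refine le_of_mul_le_mul_left ?_ h4
        linarith
    have h7 := mul_nonneg h.pos.le hpos
    nlinarith
  rw [← Finset.sum_filter_add_sum_filter_not X (fun t => x ≤ t)]
  have hright : ∑ t ∈ X with x ≤ t, 1 / (η + |d * (φ t + ψ t * (x - t)) - n|) ≤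
      C * (1 / (δ * √((η + |d * φ x - n|) * d)) * (1 + Real.log ((η + |d * φ x - n|) / η))) := by
    set Y := X.filter fun t => x ≤ t with hY
    have := hmain η δ d (d * φ x - n) hη hδ hd hS
      (fun u => φ x - φ (x + u) - ψ (x + u) * (x - (x + u))) (Y.image fun t => t - x) ?_ ?_ ?_ ?_
    · refine le_trans (le_of_eq ?_) this
      rw [Finset.sum_image fun a _ b _ hab => by simpa using hab]
      refine Finset.sum_congr rfl fun t _ => ?_
      rw [add_sub_cancel]
      congr 3
      ring
    · intro a ha b hb hab
      obtain ⟨t, ht, rfl⟩ := Finset.mem_image.1 ha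
      obtain ⟨t', ht', rfl⟩ := Finset.mem_image.1 hb
      linarith [hX t (Finset.mem_filter.1 ht).1 t' (Finset.mem_filter.1 ht').1 (by linarith)]
    · intro a ha
      obtain ⟨t, ht, rfl⟩ := Finset.mem_image.1 ha
      linarith [(Finset.mem_filter.1 ht).2]
    · intro a _
      have h1 := h.lower (x + a) x
      have h2 := h.upper (x + a) x
      constructor <;> nlinarith
    · intro a ha b _ hab
      obtain ⟨t, ht, rfl⟩ := Finset.mem_image.1 ha
      have h0 := (Finset.mem_filter.1 ht).2
      have := hinc (x + (t - x)) (x + b) (mul_nonneg (by linarith) (by linarith))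
      refine le_trans (le_of_eq ?_) this
      ring
  have hleft : ∑ t ∈ X with ¬ x ≤ t, 1 / (η + |d * (φ t + ψ t * (x - t)) - n|) ≤
      C * (1 / (δ * √((η + |d * φ x - n|) * d)) * (1 + Real.log ((η + |d * φ x - n|) / η))) := by
    set Y := X.filter fun t => ¬ x ≤ t with hY
    have := hmain η δ d (d * φ x - n) hη hδ hd hS
      (fun u => φ x - φ (x - u) - ψ (x - u) * (x - (x - u))) (Y.image fun t => x - t) ?_ ?_ ?_ ?_
    · refine le_trans (le_of_eq ?_) this
      rw [Finset.sum_image fun a _ b _ hab => by simpa using hab]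
      refine Finset.sum_congr rfl fun t _ => ?_
      rw [sub_sub_cancel]
      congr 3
      ring
    · intro a ha b hb hab
      obtain ⟨t, ht, rfl⟩ := Finset.mem_image.1 ha
      obtain ⟨t', ht', rfl⟩ := Finset.mem_image.1 hb
      linarith [hX t' (Finset.mem_filter.1 ht').1 t (Finset.mem_filter.1 ht).1 (by linarith)]
    · intro a ha
      obtain ⟨t, ht, rfl⟩ := Finset.mem_image.1 ha
      linarith [not_le.1 (Finset.mem_filter.1 ht).2]
    · intro a _
      have h1 := h.lower (x - a) x
      have h2 := h.upper (x - a) x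
      constructor <;> nlinarith
    · intro a ha b _ hab
      obtain ⟨t, ht, rfl⟩ := Finset.mem_image.1 ha
      have h0 := not_le.1 (Finset.mem_filter.1 ht).2
      have := hinc (x - (x - t)) (x - b)
        (mul_nonneg_of_nonpos_of_nonpos (by linarith) (by linarith))
      refine le_trans (le_of_eq ?_) this
      ring
  linarith

end QuadConvex

lemma Separated.image_of_le_abs_sub {σ δ : ℝ} (hσ : 0 < σ) {X : Finset ℝ} {v : ℝ → ℝ}
    (hX : Separated δ X)
    (hv : ∀ t ∈ X, ∀ t' ∈ X, t + δ ≤ t' → σ ≤ |v t - v t'|) :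
    Separated σ (X.image v) ∧ ∀ t ∈ X, ∀ t' ∈ X, v t = v t' → t = t' := by
  have key : ∀ t ∈ X, ∀ t' ∈ X, t ≠ t' → σ ≤ |v t - v t'| := by
    intro t ht t' ht' hne
    rcases lt_or_gt_of_ne hne with hlt | hlt
    · exact hv t ht t' ht' (hX t ht t' ht' hlt)
    · rw [abs_sub_comm]
      exact hv t' ht' t ht (hX t' ht' t ht hlt)
  refine ⟨?_, fun t ht t' ht' heq => ?_⟩
  · intro x hx y hy hxy
    obtain ⟨t, ht, rfl⟩ := Finset.mem_image.1 hx
    obtain ⟨t', ht', rfl⟩ := Finset.mem_image.1 hy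
    have := key t ht t' ht' (by rintro rfl; exact lt_irrefl _ hxy)
    rw [abs_sub_comm, abs_of_pos (by linarith)] at this
    linarith
  · by_contra hne
    have := key t ht t' ht' hne
    rw [heq, sub_self, abs_zero] at this
    linarith

lemma sum_inv_nint_le {σ η Y : ℝ} (hσ : 0 < σ) (hη : 0 < η) (hY : 0 ≤ Y) {V : Finset ℝ}
    (hV : Separated σ V) (hu : ∀ v ∈ V, |v| ≤ Y) :
    ∑ v ∈ V, 1 / (η + nint v) ≤ (2 * Y + 2) * (2 * (1 / η + 1 / σ * Real.log (1 + 1 / η))) := by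
  set m : ℕ := ⌊Y + 1 / 2⌋₊ with hm
  have hmaps : ∀ v ∈ V, round v ∈ Finset.Icc (-(m : ℤ)) m := by
    intro v hv
    have h1 := abs_sub_round v
    have h2 := hu v hv
    have h3 : |((round v : ℤ) : ℝ)| ≤ Y + 1 / 2 := by
      have := abs_sub_abs_le_abs_sub (round v : ℝ) v
      rw [abs_sub_comm] at this
      linarith
    have h4 : (round v).natAbs ≤ m := Nat.le_floor (by
      rw [Nat.cast_natAbs, Int.cast_abs]; exact h3)
    rw [Finset.mem_Icc]
    omega
  rw [← Finset.sum_fiberwise_of_maps_to hmaps]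
  have hfib : ∀ n ∈ Finset.Icc (-(m : ℤ)) m, ∑ v ∈ V with round v = n, 1 / (η + nint v) ≤
      2 * (1 / η + 1 / σ * Real.log (1 + 1 / η)) := by
    intro n _
    have hsep : Separated σ ((V.filter fun v => round v = n).image fun v => v - n) := by
      intro x hx y hy hxy
      obtain ⟨t, ht, rfl⟩ := Finset.mem_image.1 hx
      obtain ⟨t', ht', rfl⟩ := Finset.mem_image.1 hy
      linarith [hV t (Finset.mem_filter.1 ht).1 t' (Finset.mem_filter.1 ht').1 (by linarith)]
    have h1 := sum_inv_add_abs_le hσ hη zero_le_one hsep fun v hv => by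
      obtain ⟨t, ht, rfl⟩ := Finset.mem_image.1 hv
      have h2 := abs_sub_round t
      rw [(Finset.mem_filter.1 ht).2] at h2
      linarith
    rw [Finset.sum_image fun a _ b _ hab => by simpa using hab] at h1
    refine le_trans (le_of_eq (Finset.sum_congr rfl fun v hv => ?_)) h1
    rw [nint, (Finset.mem_filter.1 hv).2]
  refine (Finset.sum_le_card_nsmul _ _ _ hfib).trans ?_
  have hlog : 0 ≤ Real.log (1 + 1 / η) := Real.log_nonneg (by
    have : 0 < 1 / η := by positivity
    linarith)
  rw [nsmul_eq_mul, Int.card_Icc]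
  refine mul_le_mul_of_nonneg_right ?_ (by positivity)
  have h2 : ((m : ℤ) + 1 - -(m : ℤ)).toNat = 2 * m + 1 := by omega
  rw [h2]
  have h3 : (m : ℝ) ≤ Y + 1 / 2 := Nat.floor_le (by positivity)
  push_cast
  linarith

namespace QuadConvex

variable {κ Λ : ℝ} {φ ψ : ℝ → ℝ}

lemma abs_legendre_sub_le (h : QuadConvex κ Λ φ ψ) {T t t' : ℝ} (ht : |t| ≤ T) (ht' : |t'| ≤ T) :
    |(φ t - t * ψ t) - (φ t' - t' * ψ t')| ≤ T * |ψ t - ψ t'| := by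
  have h1 : 0 ≤ φ t' - φ t - ψ t * (t' - t) :=
    le_trans (mul_nonneg h.pos.le (sq_nonneg _)) (h.lower t t')
  have h2 : 0 ≤ φ t - φ t' - ψ t' * (t - t') :=
    le_trans (mul_nonneg h.pos.le (sq_nonneg _)) (h.lower t' t)
  have h3 : |t * (ψ t - ψ t')| ≤ T * |ψ t - ψ t'| := by rw [abs_mul]; gcongr
  have h4 : |t' * (ψ t - ψ t')| ≤ T * |ψ t - ψ t'| := by rw [abs_mul]; gcongr
  rw [abs_le] at h3 h4 ⊢
  constructor <;> linarith

/-- Sampling a linear combination of `ψ` and `φ - t ψ` in which the first term dominates. -/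
lemma sum_inv_nint_of_dominant_le (h : QuadConvex κ Λ φ ψ) {T B : ℝ} (hT : 1 ≤ T) (hB : 0 < B) :
    ∃ C : ℝ, 0 < C ∧ ∀ η δ J a d : ℝ, 0 < η → 0 < δ → 1 ≤ J → δ * J ≤ B * η → 1 ≤ |a| →
      |a| ≤ J → 2 * T * |d| ≤ |a| → ∀ X : Finset ℝ, Separated δ X → (∀ t ∈ X, |t| ≤ T) →
      ∑ t ∈ X, 1 / (η + nint (a * ψ t + d * (φ t - t * ψ t))) ≤
        C / δ * (1 + Real.log (1 + 1 / η)) := by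
  have hκ := h.pos
  have hΛ := h.upper_pos
  have hT0 : 0 < T := by linarith
  set P := |ψ 0| + 2 * Λ * T with hP
  set Y := P + (|φ 0| + T * (2 * Λ * T)) with hY
  have hY0 : 0 ≤ Y := by positivity
  refine ⟨(2 * Y + 2) * (2 * (B + 1 / κ)), by positivity, ?_⟩
  intro η δ J a d hη hδ hJ hδJ ha1 haJ had X hX hXT
  have ha0 : 0 < |a| := by linarith
  set v : ℝ → ℝ := fun t => a * ψ t + d * (φ t - t * ψ t) with hv
  have hσ : 0 < κ * |a| * δ := by positivity
  have hsep : ∀ t ∈ X, ∀ t' ∈ X, t + δ ≤ t' → κ * |a| * δ ≤ |v t - v t'| := by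
    intro t ht t' ht' htt
    have h1 := h.abs_legendre_sub_le (hXT t ht) (hXT t' ht')
    have h2 := h.le_deriv_sub t' t
    have h3 : δ ≤ |t - t'| := by rw [abs_sub_comm]; exact le_abs.2 (Or.inl (by linarith))
    have h4 : |a| * |ψ t - ψ t'| ≤ |v t - v t'| + |d| * (T * |ψ t - ψ t'|) := by
      calc |a| * |ψ t - ψ t'| = |(v t - v t') -
            d * ((φ t - t * ψ t) - (φ t' - t' * ψ t'))| := by
            rw [← abs_mul]; congr 1; simp only [hv]; ring
        _ ≤ |v t - v t'| + |d * ((φ t - t * ψ t) - (φ t' - t' * ψ t'))| := abs_sub _ _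
        _ ≤ |v t - v t'| + |d| * (T * |ψ t - ψ t'|) := by rw [abs_mul]; gcongr
    have h5 : 2 * T * |d| * |ψ t - ψ t'| ≤ |a| * |ψ t - ψ t'| := by gcongr
    have h6 : |a| * (2 * κ * δ) ≤ |a| * |ψ t - ψ t'| := by
      have : 2 * κ * δ ≤ 2 * κ * |t - t'| := by gcongr
      gcongr
      linarith
    linarith
  have hbd : ∀ t ∈ X, |v t| ≤ Y * |a| := by
    intro t ht
    have h1 := h.abs_deriv_le (hXT t ht)
    have h2 := h.abs_legendre_sub_le (hXT t ht) (t' := 0) (by simpa using hT0.le)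
    have h3 := h.deriv_sub_le 0 t
    have h4 : |t - 0| ≤ T := by simpa using hXT t ht
    have h5 : |φ t - t * ψ t| ≤ |φ 0| + T * (2 * Λ * T) := by
      have h6 : T * |ψ t - ψ 0| ≤ T * (2 * Λ * T) := by
        have : 2 * Λ * |t - 0| ≤ 2 * Λ * T := by gcongr
        gcongr
        linarith
      have h7 := abs_sub_abs_le_abs_sub (φ t - t * ψ t) (φ 0 - 0 * ψ 0)
      rw [zero_mul, sub_zero] at h7 h2
      linarith
    have h8 : |d| ≤ |a| := by nlinarith [abs_nonneg d]
    calc |v t| ≤ |a * ψ t| + |d * (φ t - t * ψ t)| := abs_add_le _ _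
      _ = |a| * |ψ t| + |d| * |φ t - t * ψ t| := by rw [abs_mul, abs_mul]
      _ ≤ |a| * P + |a| * (|φ 0| + T * (2 * Λ * T)) := by gcongr
      _ = Y * |a| := by ring
  obtain ⟨hs, hinj⟩ := hX.image_of_le_abs_sub hσ hsep
  have hsum := sum_inv_nint_le hσ hη (by positivity) hs (Y := Y * |a|) fun x hx => by
    obtain ⟨t, ht, rfl⟩ := Finset.mem_image.1 hx
    exact hbd t ht
  rw [Finset.sum_image hinj] at hsum
  have hlog : 0 ≤ Real.log (1 + 1 / η) := Real.log_nonneg (by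
    have : 0 < 1 / η := by positivity
    linarith)
  have hηδ : 1 / η ≤ B / (δ * |a|) := by
    rw [div_le_div_iff₀ hη (by positivity)]
    have : δ * |a| ≤ δ * J := by gcongr
    linarith
  calc _ ≤ _ := hsum
    _ ≤ ((2 * Y + 2) * |a|) * (2 * (B / (δ * |a|) + 1 / (κ * |a| * δ) * Real.log (1 + 1 / η))) := by
      gcongr
      nlinarith
    _ = (2 * Y + 2) * 2 * (B + 1 / κ * Real.log (1 + 1 / η)) / δ := by field_simp
    _ ≤ (2 * Y + 2) * 2 * ((B + 1 / κ) * (1 + Real.log (1 + 1 / η))) / δ := by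
      gcongr
      have : 0 ≤ B * Real.log (1 + 1 / η) := by positivity
      have : 0 < 1 / κ := by positivity
      nlinarith
    _ = _ := by ring

end QuadConvex

lemma sum_inv_sqrt_truncated_le {c d C : ℝ} (hc : 0 < c) (hd : 0 < d) (hC : 0 ≤ C) {V : Finset ℝ}
    (hV : Separated 1 V) (hu : ∀ v ∈ V, |v| ≤ C * d) :
    ∑ v ∈ V, 1 / √(max |v| (c / d) * d) ≤ 2 * (1 / √c + 2 * √C) := by
  refine sum_abs_le_of_halves (σ := 1) (Y := C * d) (f := fun v => 1 / √(max v (c / d) * d))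
    (fun W hW hWY => ?_) hV hu
  have hsc : 0 < √c := Real.sqrt_pos.2 hc
  have hsd : 0 < √d := Real.sqrt_pos.2 hd
  have key := sum_separated_le (σ := 1) (τ := 0) (K := 1 / √c)
    (f := fun v => 1 / √(max v (c / d) * d)) (P := fun y => 2 * √y / √d) ?_ (by positivity)
    (fun _ _ => by positivity) ?_ (fun a b _ hab => by gcongr) W hW (C * d) (by positivity) hWY
  · refine key.trans (le_of_eq ?_)
    rw [Real.sqrt_mul hC]
    field_simp
  · intro a ha
    have h1 : 1 / √(max a (c / d) * d) ≤ 1 / √c := by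
      refine one_div_le_one_div_of_le hsc (Real.sqrt_le_sqrt ?_)
      calc c = c / d * d := by field_simp
        _ ≤ max a (c / d) * d := by gcongr; exact le_max_right _ _
    have : 0 ≤ 2 * √a / √d := by positivity
    linarith
  · intro a b hb hab
    have ha : 0 < a := by linarith
    have hsa : 0 < √a := Real.sqrt_pos.2 ha
    have hsb : 0 ≤ √b := Real.sqrt_nonneg b
    have hsa2 : √a ^ 2 = a := Real.sq_sqrt ha.le
    have hsb2 : √b ^ 2 = b := Real.sq_sqrt hb
    have h1 : 1 / √(max a (c / d) * d) ≤ 1 / √a / √d := by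
      rw [div_div, ← Real.sqrt_mul ha.le]
      refine one_div_le_one_div_of_le (Real.sqrt_pos.2 (by positivity)) (Real.sqrt_le_sqrt ?_)
      gcongr
      exact le_max_left _ _
    have h2 : 1 / √a ≤ 2 * √a - 2 * √b := by
      rw [div_le_iff₀ hsa]
      nlinarith [sq_nonneg (√a - √b)]
    have h3 : 1 / √a / √d ≤ (2 * √a - 2 * √b) / √d := by gcongr
    rw [sub_div] at h3
    linarith

namespace QuadConvex

variable {κ Λ : ℝ} {φ ψ : ℝ → ℝ}

/-- The contribution of the integer points far from the dilates of the curve. -/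
lemma sum_far_integer_le {c C η : ℝ} (hc : 0 < c) (hC : 0 ≤ C) (hη : 0 < η) {J : ℕ} (hJ : 1 ≤ J)
    (φ : ℝ → ℝ) (W : Finset (ℤ × ℕ × ℤ)) (hW : ∀ w ∈ W, w.1 ∈ Finset.Icc (-(J : ℤ)) J ∧
      w.2.1 ∈ Finset.Icc 1 J ∧ |w.2.1 * φ (w.1 / w.2.1) - w.2.2| ≤ C * w.2.1 ∧
      c / w.2.1 < |w.2.1 * φ (w.1 / w.2.1) - w.2.2|) :
    ∑ w ∈ W, 1 / √((η + |w.2.1 * φ (w.1 / w.2.1) - w.2.2|) * w.2.1) *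
        (1 + Real.log ((η + |w.2.1 * φ (w.1 / w.2.1) - w.2.2|) / η)) ≤
      6 * (1 / √c + 2 * √C) * (J ^ 2 * (1 + Real.log (1 + C * J / η))) := by
  set e : ℤ × ℕ × ℤ → ℝ := fun w => w.2.1 * φ (w.1 / w.2.1) - w.2.2 with he
  set L := 1 + Real.log (1 + C * J / η) with hL
  have hL0 : 0 ≤ L := by
    have : 0 ≤ Real.log (1 + C * J / η) := Real.log_nonneg (by
      have : 0 ≤ C * J / η := by positivity
      linarith)
    linarith
  have hpt : ∀ w ∈ W, 1 / √((η + |e w|) * w.2.1) * (1 + Real.log ((η + |e w|) / η)) ≤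
      L * (1 / √(max |e w| (c / w.2.1) * w.2.1)) := by
    intro w hw
    obtain ⟨-, h1, h2, h3⟩ := hW w hw
    obtain ⟨h4, h5⟩ := Finset.mem_Icc.1 h1
    have hd : (0 : ℝ) < w.2.1 := by exact_mod_cast h4
    have hdJ : (w.2.1 : ℝ) ≤ J := by exact_mod_cast h5
    have h0 : 0 < |e w| := lt_trans (by positivity) h3
    rw [max_eq_left h3.le, mul_comm L]
    have hlog0 : 0 ≤ Real.log ((η + |e w|) / η) :=
      Real.log_nonneg (by rw [le_div_iff₀ hη]; linarith)
    gcongr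
    · linarith
    · rw [hL, add_div, div_self hη.ne']
      gcongr
      exact h2.trans (by gcongr)
  refine (Finset.sum_le_sum hpt).trans ?_
  rw [← Finset.mul_sum]
  have hmaps : ∀ w ∈ W, (w.1, w.2.1) ∈ Finset.Icc (-(J : ℤ)) J ×ˢ Finset.Icc 1 J := fun w hw =>
    Finset.mem_product.2 ⟨(hW w hw).1, (hW w hw).2.1⟩
  rw [← Finset.sum_fiberwise_of_maps_to hmaps]
  have hfib : ∀ p ∈ Finset.Icc (-(J : ℤ)) J ×ˢ Finset.Icc 1 J,
      ∑ w ∈ W with (w.1, w.2.1) = p, 1 / √(max |e w| (c / w.2.1) * w.2.1) ≤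
        2 * (1 / √c + 2 * √C) := by
    intro p hp
    have hp1 := Finset.mem_Icc.1 (Finset.mem_product.1 hp).2
    have hd : (0 : ℝ) < p.2 := by exact_mod_cast hp1.1
    set F := W.filter fun w => (w.1, w.2.1) = p with hF
    have hFe : ∀ w ∈ F, w.2.1 = p.2 ∧ e w = p.2 * φ (p.1 / p.2) - w.2.2 := by
      intro w hw
      have := (Finset.mem_filter.1 hw).2
      rw [← this]
      exact ⟨rfl, rfl⟩
    have hinj : ∀ w ∈ F, ∀ w' ∈ F, e w = e w' → w = w' := by
      intro w hw w' hw' heq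
      rw [(hFe w hw).2, (hFe w' hw').2, sub_right_inj] at heq
      have h1 : w.2.2 = w'.2.2 := by exact_mod_cast heq
      have h2 := (Finset.mem_filter.1 hw).2.trans (Finset.mem_filter.1 hw').2.symm
      rw [Prod.mk.injEq] at h2
      exact Prod.ext h2.1 (Prod.ext h2.2 h1)
    have hsep : Separated 1 (F.image e) := by
      intro x hx y hy hxy
      obtain ⟨w, hw, rfl⟩ := Finset.mem_image.1 hx
      obtain ⟨w', hw', rfl⟩ := Finset.mem_image.1 hy
      rw [(hFe w hw).2, (hFe w' hw').2] at hxy ⊢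
      have h1 : w'.2.2 < w.2.2 := by
        have : (w'.2.2 : ℝ) < w.2.2 := by linarith
        exact_mod_cast this
      have h2 : (w'.2.2 : ℝ) + 1 ≤ w.2.2 := by exact_mod_cast h1
      linarith
    have h1 := sum_inv_sqrt_truncated_le hc hd hC hsep fun x hx => by
      obtain ⟨w, hw, rfl⟩ := Finset.mem_image.1 hx
      rw [← (hFe w hw).1]
      exact (hW w (Finset.mem_filter.1 hw).1).2.2.1
    rw [Finset.sum_image hinj] at h1
    refine le_trans (le_of_eq (Finset.sum_congr rfl fun w hw => ?_)) h1
    rw [(hFe w hw).1]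
  have h1 := Finset.sum_le_card_nsmul _ _ _ hfib
  rw [nsmul_eq_mul] at h1
  have h2 : (((Finset.Icc (-(J : ℤ)) J ×ˢ Finset.Icc 1 J).card : ℕ) : ℝ) ≤ 3 * (J : ℝ) ^ 2 := by
    rw [Finset.card_product, Int.card_Icc, Nat.card_Icc,
      show ((J : ℤ) + 1 - -(J : ℤ)).toNat = 2 * J + 1 by omega, Nat.add_sub_cancel]
    have : (1 : ℝ) ≤ J := by exact_mod_cast hJ
    push_cast
    nlinarith
  calc _ ≤ L * (3 * (J : ℝ) ^ 2 * (2 * (1 / √c + 2 * √C))) := by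
        refine mul_le_mul_of_nonneg_left (h1.trans ?_) hL0
        gcongr
    _ = _ := by ring

/-- Sampling the linear combinations of `ψ` and `φ - t ψ` which may have a stationary point. -/
lemma sum_stationary_le (h : QuadConvex κ Λ φ ψ) {T B : ℝ} (hT : 1 ≤ T) (hB : 0 < B) :
    ∃ C : ℝ, 0 < C ∧ ∀ (η δ : ℝ) (J : ℕ), 0 < η → η ≤ 1 → 0 < δ → 1 ≤ J → δ * J ≤ B * η →
      ∀ X : Finset ℝ, Separated δ X → (∀ t ∈ X, |t| ≤ T) →
      ∑ p ∈ Finset.Icc (-(J : ℤ)) J ×ˢ Finset.Icc 1 J with |(p.1 : ℝ)| ≤ 2 * T * (p.2 : ℝ),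
        ∑ t ∈ X, 1 / (η + nint (p.1 * ψ t + p.2 * (φ t - t * ψ t))) ≤
      C / δ * (√J / √η * (1 + Real.log J) + J ^ 2 * (1 + Real.log (1 + J / η))) := by
  have hκ := h.pos
  have hΛ := h.upper_pos
  have hT0 : 0 < T := by linarith
  set A := 9 * Λ * T ^ 2 + 1 with hA
  have hA0 : 0 < A := by positivity
  obtain ⟨C₁, hC₁, htan⟩ := h.sum_inv_tangent_le (B := (1 + A) * B) (by positivity)
  obtain ⟨c, hc, -, C₂, hC₂, hnear⟩ := h.sum_near_integer_le (T := 2 * T) (by positivity)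
  have hlA : 0 ≤ Real.log (1 + A) := Real.log_nonneg (by linarith)
  refine ⟨C₁ * (C₂ + 6 * (1 / √c + 2 * √A) * (1 + Real.log (1 + A))), by positivity, ?_⟩
  intro η δ J hη hη1 hδ hJ hδJ X hX hXT
  have hJ1 : (1 : ℝ) ≤ J := by exact_mod_cast hJ
  set P := (Finset.Icc (-(J : ℤ)) J ×ˢ Finset.Icc 1 J).filter
    fun p => |(p.1 : ℝ)| ≤ 2 * T * (p.2 : ℝ) with hP
  set v : ℤ × ℕ → ℝ → ℝ := fun p t => p.1 * ψ t + p.2 * (φ t - t * ψ t) with hv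
  set e : ℤ × ℕ × ℤ → ℝ := fun w => w.2.1 * φ (w.1 / w.2.1) - w.2.2 with he
  set g : ℤ × ℕ × ℤ → ℝ := fun w =>
    1 / √((η + |e w|) * w.2.1) * (1 + Real.log ((η + |e w|) / η)) with hg
  have hPd : ∀ p ∈ P, 1 ≤ p.2 ∧ p.2 ≤ J ∧ p.1 ∈ Finset.Icc (-(J : ℤ)) J ∧
      |(p.1 : ℝ)| ≤ 2 * T * (p.2 : ℝ) := fun p hp => by
    obtain ⟨h1, h2⟩ := Finset.mem_filter.1 hp
    obtain ⟨h3, h4⟩ := Finset.mem_product.1 h1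
    obtain ⟨h5, h6⟩ := Finset.mem_Icc.1 h4
    exact ⟨h5, h6, h3, h2⟩
  have hvtan : ∀ p ∈ P, ∀ t, v p t = p.2 * (φ t + ψ t * ((p.1 : ℝ) / p.2 - t)) := by
    intro p hp t
    have : (0 : ℝ) < p.2 := by exact_mod_cast (hPd p hp).1
    simp only [hv]
    field_simp
    ring
  set R : Finset ℤ := (P ×ˢ X).image fun y => round (v y.1 y.2) with hR
  set Ω := (Finset.Icc (-(J : ℤ)) J ×ˢ (Finset.Icc 1 J ×ˢ R)).filter
    fun w => |(w.1 : ℝ)| ≤ 2 * T * (w.2.1 : ℝ) ∧ |e w| ≤ A * w.2.1 with hΩ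
  have hΩm : ∀ w ∈ Ω, (w.1, w.2.1) ∈ P ∧ |e w| ≤ A * w.2.1 := by
    intro w hw
    obtain ⟨h1, h2, h3⟩ := Finset.mem_filter.1 hw
    obtain ⟨h4, h5⟩ := Finset.mem_product.1 h1
    exact ⟨Finset.mem_filter.2 ⟨Finset.mem_product.2 ⟨h4, (Finset.mem_product.1 h5).1⟩, h2⟩, h3⟩
  have hround : ∀ p ∈ P, ∀ t ∈ X, (p.1, p.2, round (v p t)) ∈ Ω := by
    intro p hp t ht
    obtain ⟨h1, h2, h3, h4⟩ := hPd p hp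
    have hd : (0 : ℝ) < p.2 := by exact_mod_cast h1
    have hd1 : (1 : ℝ) ≤ p.2 := by exact_mod_cast h1
    refine Finset.mem_filter.2 ⟨Finset.mem_product.2 ⟨h3, Finset.mem_product.2
      ⟨Finset.mem_Icc.2 ⟨h1, h2⟩, Finset.mem_image.2 ⟨(p, t), Finset.mem_product.2 ⟨hp, ht⟩, rfl⟩⟩⟩,
      h4, ?_⟩
    have hx : |(p.1 : ℝ) / p.2| ≤ 2 * T := by
      rw [abs_div, abs_of_pos hd, div_le_iff₀ hd]; exact h4
    have h5 := h.lower t ((p.1 : ℝ) / p.2)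
    have h6 := h.upper t ((p.1 : ℝ) / p.2)
    have h7 : ((p.1 : ℝ) / p.2 - t) ^ 2 ≤ 9 * T ^ 2 := by
      have h8 : |(p.1 : ℝ) / p.2 - t| ≤ 3 * T := (abs_sub _ _).trans (by linarith [hXT t ht])
      calc ((p.1 : ℝ) / p.2 - t) ^ 2 = |(p.1 : ℝ) / p.2 - t| ^ 2 := (sq_abs _).symm
        _ ≤ (3 * T) ^ 2 := by gcongr
        _ = _ := by ring
    have h9 : |p.2 * φ ((p.1 : ℝ) / p.2) - v p t| ≤ 9 * Λ * T ^ 2 * p.2 := by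
      rw [hvtan p hp t]
      have h10 : 0 ≤ κ * ((p.1 : ℝ) / p.2 - t) ^ 2 := by positivity
      have h11 : Λ * ((p.1 : ℝ) / p.2 - t) ^ 2 ≤ Λ * (9 * T ^ 2) := by gcongr
      rw [← mul_sub, abs_mul, abs_of_pos hd, mul_comm]
      gcongr
      rw [abs_le]
      constructor <;> linarith
    have h12 := abs_sub_round (v p t)
    calc |e (p.1, p.2, round (v p t))|
        = |(p.2 * φ ((p.1 : ℝ) / p.2) - v p t) + (v p t - round (v p t))| := by
          simp only [he]; congr 1; ring
      _ ≤ _ := abs_add_le _ _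
      _ ≤ 9 * Λ * T ^ 2 * p.2 + 1 / 2 := by linarith
      _ ≤ A * p.2 := by rw [hA]; linarith
  have hunfold : ∑ p ∈ P, ∑ t ∈ X, 1 / (η + nint (v p t)) ≤
      ∑ w ∈ Ω, ∑ t ∈ X, 1 / (η + |v (w.1, w.2.1) t - w.2.2|) := by
    rw [Finset.sum_comm, Finset.sum_comm (s := Ω)]
    refine Finset.sum_le_sum fun t ht => ?_
    calc ∑ p ∈ P, 1 / (η + nint (v p t))
        = ∑ w ∈ P.image (fun p => (p.1, p.2, round (v p t))),
            1 / (η + |v (w.1, w.2.1) t - w.2.2|) := by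
          rw [Finset.sum_image]
          · rfl
          · intro p _ p' _ hpp
            simp only [Prod.mk.injEq] at hpp
            exact Prod.ext hpp.1 hpp.2.1
      _ ≤ _ := by
          refine Finset.sum_le_sum_of_subset_of_nonneg (fun w hw => ?_) fun w _ _ => by positivity
          obtain ⟨p, hp, rfl⟩ := Finset.mem_image.1 hw
          exact hround p hp t ht
  have hsample : ∀ w ∈ Ω, ∑ t ∈ X, 1 / (η + |v (w.1, w.2.1) t - w.2.2|) ≤ C₁ / δ * g w := by
    intro w hw
    obtain ⟨hp, hwe⟩ := hΩm w hw
    obtain ⟨h1, h2, h3, h4⟩ := hPd _ hp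
    have hd1 : (1 : ℝ) ≤ w.2.1 := by exact_mod_cast h1
    have hd : (0 : ℝ) < w.2.1 := by linarith
    have hdJ : (w.2.1 : ℝ) ≤ J := by exact_mod_cast h2
    have h5 : √((η + |e w|) * w.2.1) ≤ (1 + A) * J := by
      refine Real.sqrt_le_iff.2 ⟨by positivity, ?_⟩
      calc (η + |e w|) * w.2.1 ≤ (J + A * J) * J := by
            gcongr
            · linarith
            · exact hwe.trans (by gcongr)
        _ = (1 + A) * J ^ 2 := by ring
        _ ≤ (1 + A) ^ 2 * J ^ 2 := by gcongr; nlinarith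
        _ = _ := by ring
    have h6 : δ * √((η + |e w|) * w.2.1) ≤ (1 + A) * B * η := by
      calc _ ≤ δ * ((1 + A) * J) := by gcongr
        _ = (1 + A) * (δ * J) := by ring
        _ ≤ (1 + A) * (B * η) := by gcongr
        _ = _ := by ring
    have h7 := htan η δ w.2.1 (w.1 / w.2.1) w.2.2 hη hδ hd h6 X hX
    calc _ = ∑ t ∈ X, 1 / (η + |w.2.1 * (φ t + ψ t * ((w.1 : ℝ) / w.2.1 - t)) - w.2.2|) :=
          Finset.sum_congr rfl fun t _ => by rw [hvtan _ hp t]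
      _ ≤ _ := h7
      _ = C₁ / δ * g w := by simp only [hg, he]; field_simp
  have hg_near : ∑ w ∈ Ω with |e w| ≤ c / w.2.1, g w ≤
      C₂ * (√J / √η * (1 + Real.log J) + J ^ 2 * (1 + Real.log (1 + 1 / η))) := by
    refine hnear η J hη hJ1 _ fun w hw => ?_
    obtain ⟨hw1, hw2⟩ := Finset.mem_filter.1 hw
    obtain ⟨h1, h2, h3, h4⟩ := hPd _ (hΩm w hw1).1
    exact ⟨h1, by exact_mod_cast h2, h4, hw2⟩
  have hg_far : ∑ w ∈ Ω with ¬ |e w| ≤ c / w.2.1, g w ≤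
      6 * (1 / √c + 2 * √A) * (J ^ 2 * (1 + Real.log (1 + A * J / η))) := by
    refine sum_far_integer_le hc hA0.le hη hJ φ _ fun w hw => ?_
    obtain ⟨hw1, hw2⟩ := Finset.mem_filter.1 hw
    obtain ⟨h1, h2, h3, h4⟩ := hPd _ (hΩm w hw1).1
    exact ⟨h3, Finset.mem_Icc.2 ⟨h1, h2⟩, (hΩm w hw1).2, not_le.1 hw2⟩
  have hJη : 0 ≤ (J : ℝ) / η := by positivity
  have hl0 : 0 ≤ Real.log (1 + J / η) := Real.log_nonneg (by linarith)
  have hl1 : Real.log (1 + 1 / η) ≤ Real.log (1 + J / η) := by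
    refine Real.log_le_log (by positivity) ?_
    gcongr
  have hl2 : Real.log (1 + A * J / η) ≤ Real.log (1 + A) + Real.log (1 + J / η) := by
    rw [← Real.log_mul (by positivity) (by positivity)]
    refine Real.log_le_log (by positivity) ?_
    rw [mul_div_assoc]
    nlinarith
  have hlJ : 0 ≤ Real.log J := Real.log_nonneg hJ1
  set k := 6 * (1 / √c + 2 * √A) with hk
  have hk0 : 0 ≤ k := by positivity
  set N := √J / √η * (1 + Real.log J) with hN
  have hN0 : 0 ≤ N := by positivity
  set Q := (J : ℝ) ^ 2 * (1 + Real.log (1 + J / η)) with hQ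
  have hQ0 : 0 ≤ Q := by positivity
  have hgsum : ∑ w ∈ Ω, g w ≤ (C₂ + k * (1 + Real.log (1 + A))) * (N + Q) := by
    rw [← Finset.sum_filter_add_sum_filter_not Ω (fun w => |e w| ≤ c / w.2.1)]
    have h1 : C₂ * (N + J ^ 2 * (1 + Real.log (1 + 1 / η))) ≤ C₂ * (N + Q) := by
      rw [hQ]; gcongr
    have h2 : k * (J ^ 2 * (1 + Real.log (1 + A * J / η))) ≤
        k * (1 + Real.log (1 + A)) * (N + Q) := by
      refine (mul_le_mul_of_nonneg_left ?_ hk0).trans_eq (mul_assoc _ _ _).symm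
      calc (J : ℝ) ^ 2 * (1 + Real.log (1 + A * J / η))
          ≤ (J : ℝ) ^ 2 * ((1 + Real.log (1 + A)) * (1 + Real.log (1 + J / η))) := by
            gcongr
            nlinarith [mul_nonneg hlA hl0]
        _ = (1 + Real.log (1 + A)) * Q := by rw [hQ]; ring
        _ ≤ (1 + Real.log (1 + A)) * (N + Q) := by gcongr; linarith
    linarith
  calc _ ≤ _ := hunfold
    _ ≤ ∑ w ∈ Ω, C₁ / δ * g w := Finset.sum_le_sum hsample
    _ = C₁ / δ * ∑ w ∈ Ω, g w := by rw [Finset.mul_sum]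
    _ ≤ C₁ / δ * ((C₂ + k * (1 + Real.log (1 + A))) * (N + Q)) := by gcongr
    _ = _ := by ring

end QuadConvex

lemma nint_nonneg (y : ℝ) : 0 ≤ nint y := abs_nonneg _

lemma nint_neg (y : ℝ) : nint (-y) = nint y := by
  have key : ∀ z, nint (-z) ≤ nint z := fun z => by
    have h := round_le (-z) (-round z)
    push_cast at h
    rwa [show -z - -(round z : ℝ) = -(z - round z) by ring, abs_neg] at h
  refine le_antisymm (key y) ?_
  simpa using key (-y)

lemma QuadConvex.sum_box_le {κ Λ : ℝ} {φ ψ : ℝ → ℝ} (h : QuadConvex κ Λ φ ψ) {T B : ℝ} (hT : 1 ≤ T)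
    (hB : 0 < B) :
    ∃ C : ℝ, 0 < C ∧ ∀ (η δ : ℝ) (J : ℕ), 0 < η → η ≤ 1 → 0 < δ → 1 ≤ J → δ * J ≤ B * η →
      ∀ X : Finset ℝ, Separated δ X → (∀ t ∈ X, |t| ≤ T) →
      ∑ j ∈ (Finset.Icc (-(J : ℤ)) J ×ˢ Finset.Icc (-(J : ℤ)) J).erase (0, 0),
        ∑ t ∈ X, 1 / (η + nint (j.1 * ψ t + j.2 * (φ t - t * ψ t))) ≤
      C / δ * (√J / √η * (1 + Real.log J) + J ^ 2 * (1 + Real.log (1 + J / η))) := by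
  obtain ⟨C₁, hC₁, hst⟩ := h.sum_stationary_le hT hB
  obtain ⟨C₂, hC₂, hdom⟩ := h.sum_inv_nint_of_dominant_le hT hB
  refine ⟨2 * C₁ + 9 * C₂, by positivity, fun η δ J hη hη1 hδ hJ hδJ X hX hXT => ?_⟩
  have hJ1 : (1 : ℝ) ≤ J := by exact_mod_cast hJ
  set G : ℤ × ℤ → ℝ := fun j =>
    ∑ t ∈ X, 1 / (η + nint (j.1 * ψ t + j.2 * (φ t - t * ψ t))) with hG
  have hG0 : ∀ j, 0 ≤ G j := fun j => Finset.sum_nonneg fun t _ => by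
    have := nint_nonneg (j.1 * ψ t + j.2 * (φ t - t * ψ t))
    positivity
  have hGneg : ∀ a b : ℤ, G (-a, -b) = G (a, b) := fun a b => by
    refine Finset.sum_congr rfl fun t _ => ?_
    rw [← nint_neg]
    push_cast
    congr 3
    ring
  set S := √J / √η * (1 + Real.log J) + J ^ 2 * (1 + Real.log (1 + J / η)) with hS
  have hJη : 0 ≤ (J : ℝ) / η := by positivity
  have hl0 : 0 ≤ Real.log (1 + J / η) := Real.log_nonneg (by linarith)
  have hlJ : 0 ≤ Real.log J := Real.log_nonneg hJ1
  have hst' := hst η δ J hη hη1 hδ hJ hδJ X hX hXT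
  set P := (Finset.Icc (-(J : ℤ)) J ×ˢ Finset.Icc 1 J).filter
    fun p => |(p.1 : ℝ)| ≤ 2 * T * (p.2 : ℝ) with hP
  have hPsum : ∑ p ∈ P, G (p.1, (p.2 : ℤ)) ≤ C₁ / δ * S := by
    simpa only [hG, Int.cast_natCast] using hst'
  set Ω := (Finset.Icc (-(J : ℤ)) J ×ˢ Finset.Icc (-(J : ℤ)) J).erase (0, 0) with hΩ
  have hΩm : ∀ j ∈ Ω, j ≠ (0, 0) ∧ (-(J : ℤ) ≤ j.1 ∧ j.1 ≤ J) ∧ (-(J : ℤ) ≤ j.2 ∧ j.2 ≤ J) := by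
    intro j hj
    obtain ⟨h1, h2⟩ := Finset.mem_erase.1 hj
    obtain ⟨h3, h4⟩ := Finset.mem_product.1 h2
    exact ⟨h1, Finset.mem_Icc.1 h3, Finset.mem_Icc.1 h4⟩
  have hdominant : ∑ j ∈ Ω with 2 * T * |(j.2 : ℝ)| ≤ |(j.1 : ℝ)|, G j ≤ 9 * C₂ / δ * S := by
    have h1 : ∀ j ∈ Ω.filter (fun j => 2 * T * |(j.2 : ℝ)| ≤ |(j.1 : ℝ)|),
        G j ≤ C₂ / δ * (1 + Real.log (1 + 1 / η)) := by
      intro j hj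
      obtain ⟨hj1, hj2⟩ := Finset.mem_filter.1 hj
      obtain ⟨hne, hb1, hb2⟩ := hΩm j hj1
      have ha : j.1 ≠ 0 := by
        intro h0
        rw [h0, Int.cast_zero, abs_zero] at hj2
        have h3 : |(j.2 : ℝ)| ≤ 0 := by
          by_contra hpos
          push Not at hpos
          nlinarith
        have h4 : (j.2 : ℝ) = 0 := abs_eq_zero.1 (le_antisymm h3 (abs_nonneg _))
        exact hne (Prod.ext h0 (by exact_mod_cast h4))
      refine hdom η δ J j.1 j.2 hη hδ hJ1 hδJ ?_ ?_ hj2 X hX hXT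
      · exact_mod_cast Int.one_le_abs ha
      · exact_mod_cast abs_le.2 hb1
    refine (Finset.sum_le_card_nsmul _ _ _ h1).trans ?_
    rw [nsmul_eq_mul]
    have h2 : ((Ω.filter fun j => 2 * T * |(j.2 : ℝ)| ≤ |(j.1 : ℝ)|).card : ℝ) ≤ 9 * (J : ℝ) ^ 2 := by
      have h3 := (Finset.card_filter_le Ω fun j => 2 * T * |(j.2 : ℝ)| ≤ |(j.1 : ℝ)|).trans
        (Finset.card_erase_le (s := Finset.Icc (-(J : ℤ)) J ×ˢ Finset.Icc (-(J : ℤ)) J) (a := (0, 0)))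
      rw [Finset.card_product, Int.card_Icc,
        show ((J : ℤ) + 1 - -(J : ℤ)).toNat = 2 * J + 1 by omega] at h3
      calc _ ≤ (((2 * J + 1) * (2 * J + 1) : ℕ) : ℝ) := by exact_mod_cast h3
        _ ≤ _ := by push_cast; nlinarith
    have hl1 : Real.log (1 + 1 / η) ≤ Real.log (1 + J / η) := by
      refine Real.log_le_log (by positivity) ?_
      gcongr
    have hl2 : 0 ≤ Real.log (1 + 1 / η) := Real.log_nonneg (by
      have : 0 < 1 / η := by positivity
      linarith)
    calc _ ≤ 9 * (J : ℝ) ^ 2 * (C₂ / δ * (1 + Real.log (1 + J / η))) := by gcongr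
      _ = 9 * C₂ / δ * (J ^ 2 * (1 + Real.log (1 + J / η))) := by ring
      _ ≤ 9 * C₂ / δ * S := by
        gcongr
        exact le_add_of_nonneg_left (by positivity)
  have hrest : ∀ (s : Finset (ℤ × ℤ)) (i : ℤ × ℕ → ℤ × ℤ), Function.Injective i →
      (∀ p, G (i p) = G (p.1, (p.2 : ℤ))) → (∀ j ∈ s, ∃ p ∈ P, i p = j) →
      ∑ j ∈ s, G j ≤ C₁ / δ * S := by
    intro s i hi hGi hs
    calc ∑ j ∈ s, G j ≤ ∑ j ∈ P.image i, G j := by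
          refine Finset.sum_le_sum_of_subset_of_nonneg (fun j hj => ?_) fun j _ _ => hG0 j
          exact Finset.mem_image.2 (hs j hj)
      _ = ∑ p ∈ P, G (p.1, (p.2 : ℤ)) := by
          rw [Finset.sum_image fun a _ b _ hab => hi hab]
          exact Finset.sum_congr rfl fun p _ => hGi p
      _ ≤ _ := hPsum
  have hstationary : ∀ (a : ℤ) (d : ℕ), 1 ≤ d → (d : ℤ) ≤ J → -(J : ℤ) ≤ a → a ≤ J →
      |(a : ℝ)| < 2 * T * d → (a, d) ∈ P := fun a d h1 h2 h3 h4 h5 =>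
    Finset.mem_filter.2 ⟨Finset.mem_product.2 ⟨Finset.mem_Icc.2 ⟨h3, h4⟩,
      Finset.mem_Icc.2 ⟨h1, by exact_mod_cast h2⟩⟩, h5.le⟩
  rw [← Finset.sum_filter_add_sum_filter_not Ω (fun j => 2 * T * |(j.2 : ℝ)| ≤ |(j.1 : ℝ)|),
    ← Finset.sum_filter_add_sum_filter_not
      (Ω.filter fun j => ¬ 2 * T * |(j.2 : ℝ)| ≤ |(j.1 : ℝ)|) (fun j => 0 ≤ j.2)]
  have hne0 : ∀ j : ℤ × ℤ, ¬ 2 * T * |(j.2 : ℝ)| ≤ |(j.1 : ℝ)| → j.2 ≠ 0 := by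
    intro j hj h0
    rw [h0, Int.cast_zero, abs_zero, mul_zero] at hj
    exact hj (abs_nonneg _)
  have hpos := hrest ((Ω.filter fun j => ¬ 2 * T * |(j.2 : ℝ)| ≤ |(j.1 : ℝ)|).filter
    fun j => 0 ≤ j.2) (fun p => (p.1, (p.2 : ℤ)))
    (fun p p' hpp => by
      simp only [Prod.mk.injEq, Nat.cast_inj] at hpp
      exact Prod.ext hpp.1 hpp.2) (fun _ => rfl) (fun j hj => by
      obtain ⟨hj1, hj2⟩ := Finset.mem_filter.1 hj
      obtain ⟨hj3, hj4⟩ := Finset.mem_filter.1 hj1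
      obtain ⟨-, hb1, hb2⟩ := hΩm j hj3
      have hne := hne0 j hj4
      obtain ⟨d, hd⟩ := Int.eq_ofNat_of_zero_le hj2
      rw [hd] at hj4 hb2 hne
      rw [Int.cast_natCast, Nat.abs_cast, not_le] at hj4
      exact ⟨(j.1, d), hstationary j.1 d (by omega) hb2.2 hb1.1 hb1.2 hj4, Prod.ext rfl hd.symm⟩)
  have hneg := hrest ((Ω.filter fun j => ¬ 2 * T * |(j.2 : ℝ)| ≤ |(j.1 : ℝ)|).filter
    fun j => ¬ 0 ≤ j.2) (fun p => (-p.1, -(p.2 : ℤ)))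
    (fun p p' hpp => by
      simp only [Prod.mk.injEq, neg_inj, Nat.cast_inj] at hpp
      exact Prod.ext hpp.1 hpp.2) (fun p => hGneg _ _) (fun j hj => by
      obtain ⟨hj1, hj2⟩ := Finset.mem_filter.1 hj
      obtain ⟨hj3, hj4⟩ := Finset.mem_filter.1 hj1
      obtain ⟨-, hb1, hb2⟩ := hΩm j hj3
      obtain ⟨d, hd⟩ := Int.eq_ofNat_of_zero_le (a := -j.2) (by omega)
      have hd' : j.2 = -(d : ℤ) := by omega
      rw [hd'] at hj4 hb2 hj2
      rw [Int.cast_neg, Int.cast_natCast, abs_neg, Nat.abs_cast, not_le] at hj4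
      refine ⟨(-j.1, d), hstationary (-j.1) d (by omega) (by omega) (by omega) (by omega) ?_,
        Prod.ext (neg_neg _) hd'.symm⟩
      rwa [Int.cast_neg, abs_neg])
  have : (2 * C₁ + 9 * C₂) / δ * S = 9 * C₂ / δ * S + (C₁ / δ * S + C₁ / δ * S) := by ring
  rw [this]
  exact add_le_add hdominant (add_le_add hpos hneg)

lemma add_deriv_mul_sub_le {G G' : ℝ → ℝ} (hG : ∀ x, HasDerivAt G (G' x) x) (hmono : Monotone G')
    (s t : ℝ) : G s + G' s * (t - s) ≤ G t := by
  have hc : Continuous G := continuous_iff_continuousAt.2 fun x => (hG x).continuousAt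
  rcases lt_trichotomy s t with h | h | h
  · obtain ⟨c, hc', h'⟩ := exists_hasDerivAt_eq_slope G G' h hc.continuousOn fun x _ => hG x
    rw [eq_div_iff (by linarith)] at h'
    nlinarith [hmono hc'.1.le, mul_le_mul_of_nonneg_right (hmono hc'.1.le) (sub_nonneg.2 h.le)]
  · simp [h]
  · obtain ⟨c, hc', h'⟩ := exists_hasDerivAt_eq_slope G G' h hc.continuousOn fun x _ => hG x
    rw [eq_div_iff (by linarith)] at h'
    nlinarith [mul_le_mul_of_nonneg_right (hmono hc'.2.le) (sub_nonneg.2 h.le)]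

lemma quadConvex_of_deriv {m M : ℝ} {φ ψ : ℝ → ℝ} (hm : 0 < m) (hφ : ∀ x, HasDerivAt φ (ψ x) x)
    (hψ : ∀ x y, x ≤ y → m * (y - x) ≤ ψ y - ψ x ∧ ψ y - ψ x ≤ M * (y - x)) :
    QuadConvex (m / 2) (M / 2) φ ψ := by
  refine ⟨by positivity, fun s t => ?_, fun s t => ?_⟩
  · have := add_deriv_mul_sub_le (G := fun x => φ x - m / 2 * x ^ 2) (G' := fun x => ψ x - m * x)
      (fun x => ((hφ x).sub ((hasDerivAt_pow 2 x).const_mul (m / 2))).congr_deriv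
        (by push_cast; ring))
      (fun x y hxy => by have := (hψ x y hxy).1; simp only; linarith) s t
    nlinarith
  · have := add_deriv_mul_sub_le (G := fun x => M / 2 * x ^ 2 - φ x) (G' := fun x => M * x - ψ x)
      (fun x => (((hasDerivAt_pow 2 x).const_mul (M / 2)).sub (hφ x)).congr_deriv
        (by push_cast; ring))
      (fun x y hxy => by have := (hψ x y hxy).2; simp only; linarith) s t
    nlinarith

/-- A bi-Lipschitz monotone relation between `t` and `u` extends to a function of `t` on all of `ℝ`
with the same constants. -/
lemma exists_monotone_extension {ι : Type*} [Nonempty ι] {t u : ι → ℝ} {m M C : ℝ} (hmM : m ≤ M)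
    (hC : ∀ x, C ≤ u x - m * t x)
    (h : ∀ x y, t x ≤ t y → m * (t y - t x) ≤ u y - u x ∧ u y - u x ≤ M * (t y - t x)) :
    ∃ ψ : ℝ → ℝ, (∀ x, ψ (t x) = u x) ∧
      ∀ y z, y ≤ z → m * (z - y) ≤ ψ z - ψ y ∧ ψ z - ψ y ≤ M * (z - y) := by
  set F : ℝ → ι → ℝ := fun y x => u x - m * t x + (M - m) * max (y - t x) 0 with hF
  have hbdd : ∀ y, BddBelow (Set.range (F y)) := fun y => by
    refine ⟨C, ?_⟩
    rintro _ ⟨x, rfl⟩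
    have := mul_nonneg (sub_nonneg.2 hmM) (le_max_right (y - t x) 0)
    simp only [hF]
    linarith [hC x]
  refine ⟨fun y => m * y + ⨅ x, F y x, fun x₀ => ?_, fun y z hyz => ⟨?_, ?_⟩⟩
  · have : ⨅ x, F (t x₀) x = u x₀ - m * t x₀ := by
      refine le_antisymm ((ciInf_le (hbdd _) x₀).trans (by simp [hF])) (le_ciInf fun x => ?_)
      simp only [hF]
      rcases le_total (t x) (t x₀) with hx | hx
      · rw [max_eq_left (by linarith)]
        linarith [(h x x₀ hx).2]
      · rw [max_eq_right (by linarith)]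
        linarith [(h x₀ x hx).1]
    simp only [this]; ring
  · have : ⨅ x, F y x ≤ ⨅ x, F z x := le_ciInf fun x => (ciInf_le (hbdd _) x).trans (by
      have : max (y - t x) 0 ≤ max (z - t x) 0 := max_le_max (by linarith) le_rfl
      simp only [hF]
      linarith [mul_le_mul_of_nonneg_left this (sub_nonneg.2 hmM)])
    simp only; linarith
  · have : (⨅ x, F z x) - (M - m) * (z - y) ≤ ⨅ x, F y x := le_ciInf fun x => by
      have h1 := ciInf_le (hbdd z) x
      have : max (z - t x) 0 ≤ max (y - t x) 0 + (z - y) :=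
        max_le (by linarith [le_max_left (y - t x) 0]) (by linarith [le_max_right (y - t x) 0])
      have := mul_le_mul_of_nonneg_left this (sub_nonneg.2 hmM)
      simp only [hF] at h1 ⊢
      linarith
    simp only; linarith

lemma monotoneOn_of_hasDerivWithinAt {f f' : ℝ → ℝ} {a b : ℝ}
    (hf : ∀ x ∈ Icc a b, HasDerivWithinAt f (f' x) (Icc a b) x) (h0 : ∀ x ∈ Icc a b, 0 ≤ f' x) :
    MonotoneOn f (Icc a b) :=
  monotoneOn_of_hasDerivWithinAt_nonneg (convex_Icc a b)
    (fun x hx => (hf x hx).continuousWithinAt)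
    (fun x hx => (hf x (interior_subset hx)).mono interior_subset)
    (fun x hx => h0 x (interior_subset hx))

/-- A planar curve `(u, w)` whose slope is `t` is a Legendre curve over the parameter `t`. -/
lemma exists_quadConvex_parametrization {a m M s : ℝ} {t t' u u' w w' : ℝ → ℝ} (ha : 0 < a)
    (hm : 0 < m) (hmM : m ≤ M) (hs : s = 1 ∨ s = -1)
    (ht : ∀ x ∈ Icc (0 : ℝ) 1, HasDerivWithinAt t (t' x) (Icc (0 : ℝ) 1) x)
    (hu : ∀ x ∈ Icc (0 : ℝ) 1, HasDerivWithinAt u (u' x) (Icc (0 : ℝ) 1) x)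
    (hw : ∀ x ∈ Icc (0 : ℝ) 1, HasDerivWithinAt w (w' x) (Icc (0 : ℝ) 1) x)
    (hta : ∀ x ∈ Icc (0 : ℝ) 1, a ≤ s * t' x)
    (hum : ∀ x ∈ Icc (0 : ℝ) 1, m * (s * t' x) ≤ s * u' x)
    (huM : ∀ x ∈ Icc (0 : ℝ) 1, s * u' x ≤ M * (s * t' x))
    (hwt : ∀ x ∈ Icc (0 : ℝ) 1, w' x = t x * u' x) :
    (∀ x ∈ Icc (0 : ℝ) 1, ∀ y ∈ Icc (0 : ℝ) 1, a * |x - y| ≤ |t x - t y|) ∧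
    ∃ φ ψ : ℝ → ℝ, QuadConvex (m / 2) (M / 2) φ ψ ∧
      ∀ x ∈ Icc (0 : ℝ) 1, ψ (t x) = u x ∧ φ (t x) - t x * ψ (t x) = -w x := by
  have h1 : MonotoneOn (fun x => s * t x - a * x) (Icc (0 : ℝ) 1) :=
    monotoneOn_of_hasDerivWithinAt (f' := fun x => s * t' x - a * 1)
      (fun x hx => ((ht x hx).const_mul s).sub ((hasDerivWithinAt_id x _).const_mul a))
      (fun x hx => by linarith [hta x hx])
  have h2 : MonotoneOn (fun x => s * u x - m * (s * t x)) (Icc (0 : ℝ) 1) :=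
    monotoneOn_of_hasDerivWithinAt
      (fun x hx => ((hu x hx).const_mul s).sub (((ht x hx).const_mul s).const_mul m))
      (fun x hx => by linarith [hum x hx])
  have h3 : MonotoneOn (fun x => M * (s * t x) - s * u x) (Icc (0 : ℝ) 1) :=
    monotoneOn_of_hasDerivWithinAt
      (fun x hx => (((ht x hx).const_mul s).const_mul M).sub ((hu x hx).const_mul s))
      (fun x hx => by linarith [huM x hx])
  have hsabs : |s| = 1 := by rcases hs with rfl | rfl <;> simp
  have hlip : ∀ x ∈ Icc (0 : ℝ) 1, ∀ y ∈ Icc (0 : ℝ) 1, x ≤ y → a * (y - x) ≤ s * (t y - t x) :=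
    fun x hx y hy hxy => by have := h1 hx hy hxy; simp only at this; linarith
  have habs : ∀ x ∈ Icc (0 : ℝ) 1, ∀ y ∈ Icc (0 : ℝ) 1, x ≤ y → a * |x - y| ≤ |t x - t y| := by
    intro x hx y hy hxy
    rw [abs_sub_comm, abs_of_nonneg (sub_nonneg.2 hxy), abs_sub_comm (t x)]
    calc _ ≤ s * (t y - t x) := hlip x hx y hy hxy
      _ ≤ |s * (t y - t x)| := le_abs_self _
      _ = _ := by rw [abs_mul, hsabs, one_mul]
  refine ⟨fun x hx y hy => ?_, ?_⟩
  · rcases le_total x y with hxy | hxy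
    · exact habs x hx y hy hxy
    · rw [abs_sub_comm, abs_sub_comm (t x)]
      exact habs y hy x hx hxy
  have hut : ∀ x y : Icc (0 : ℝ) 1, t x ≤ t y →
      m * (t y - t x) ≤ u y - u x ∧ u y - u x ≤ M * (t y - t x) := by
    intro x y hxy
    have key : ∀ x ∈ Icc (0 : ℝ) 1, ∀ y ∈ Icc (0 : ℝ) 1, x ≤ y →
        m * (s * (t y - t x)) ≤ s * (u y - u x) ∧ s * (u y - u x) ≤ M * (s * (t y - t x)) :=
      fun x hx y hy hxy => by
        have h2 := h2 hx hy hxy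
        have h3 := h3 hx hy hxy
        simp only at h2 h3
        constructor <;> linarith
    rcases le_total x.1 y.1 with h | h
    · have k := key x x.2 y y.2 h
      have l := hlip x x.2 y y.2 h
      rcases hs with rfl | rfl
      · simpa using k
      · have : (y : ℝ) = x := by nlinarith
        simp [this]
    · have k := key y y.2 x x.2 h
      have l := hlip y y.2 x x.2 h
      rcases hs with rfl | rfl
      · have : (y : ℝ) = x := by nlinarith
        simp [this]
      · constructor <;> linarith
  have hcont : ContinuousOn (fun x => u x - m * t x) (Icc (0 : ℝ) 1) := fun x hx =>
    ((hu x hx).sub ((ht x hx).const_mul m)).continuousWithinAt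
  obtain ⟨C, hC⟩ := (isCompact_Icc.image_of_continuousOn hcont).bddBelow
  obtain ⟨ψ, hψu, hψ⟩ := exists_monotone_extension (ι := Icc (0 : ℝ) 1) (t := fun x => t x)
    (u := fun x => u x) hmM (fun x => hC (mem_image_of_mem _ x.2)) hut
  replace hψu : ∀ x ∈ Icc (0 : ℝ) 1, ψ (t x) = u x := fun x hx => hψu ⟨x, hx⟩
  have hψc : Continuous ψ := by
    refine (LipschitzWith.of_le_add_mul M.toNNReal fun x y => ?_).continuous
    rw [Real.dist_eq, Real.coe_toNNReal _ (hm.le.trans hmM)]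
    rcases le_total x y with hxy | hxy
    · nlinarith [(hψ x y hxy).1, mul_nonneg hm.le (sub_nonneg.2 hxy),
        mul_nonneg (hm.le.trans hmM) (abs_nonneg (x - y))]
    · rw [abs_of_nonneg (sub_nonneg.2 hxy)]
      linarith [(hψ y x hxy).2]
  set Φ : ℝ → ℝ := fun y => ∫ z in (0 : ℝ)..y, ψ z with hΦ
  have hΦd : ∀ y, HasDerivAt Φ (ψ y) y := fun y => (hψc.integral_hasStrictDerivAt 0 y).hasDerivAt
  set F : ℝ → ℝ := fun x => Φ (t x) - t x * u x + w x with hF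
  have hFd : ∀ x ∈ Icc (0 : ℝ) 1, HasDerivWithinAt F 0 (Icc (0 : ℝ) 1) x := fun x hx => by
    have := (((hΦd (t x)).comp_hasDerivWithinAt x (ht x hx)).sub ((ht x hx).mul (hu x hx))).add
      (hw x hx)
    rw [hwt x hx, hψu x hx] at this
    exact this.congr_deriv (by ring)
  have hF0 : ∀ x ∈ Icc (0 : ℝ) 1, F x = F 0 :=
    constant_of_has_deriv_right_zero (fun x hx => (hFd x hx).continuousWithinAt) fun x hx =>
      (hFd x (Ico_subset_Icc_self hx)).mono_of_mem_nhdsWithin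
        (mem_nhdsWithin.2 ⟨Iio 1, isOpen_Iio, hx.2, fun z hz => ⟨hx.1.trans hz.2, hz.1.le⟩⟩)
  refine ⟨fun y => Φ y - F 0, ψ, quadConvex_of_deriv hm (fun x => (hΦd x).sub_const _) hψ,
    fun x hx => ⟨hψu x hx, ?_⟩⟩
  have := hF0 x hx
  rw [hψu x hx, ← this]
  simp only [hF]
  ring

lemma exists_sign_mul_bounds {f : ℝ → ℝ} (hf : ContinuousOn f (Icc (0 : ℝ) 1))
    (h0 : ∀ x ∈ Icc (0 : ℝ) 1, f x ≠ 0) :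
    ∃ s a A : ℝ, (s = 1 ∨ s = -1) ∧ 0 < a ∧ a ≤ A ∧
      ∀ x ∈ Icc (0 : ℝ) 1, a ≤ s * f x ∧ s * f x ≤ A := by
  have hne : (Icc (0 : ℝ) 1).Nonempty := ⟨0, by simp⟩
  have h0mem : (0 : ℝ) ∈ Icc (0 : ℝ) 1 := by simp
  obtain ⟨s, hs, hpos⟩ : ∃ s : ℝ, (s = 1 ∨ s = -1) ∧ ∀ x ∈ Icc (0 : ℝ) 1, 0 < s * f x := by
    rcases lt_or_gt_of_ne (h0 0 h0mem) with h | h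
    · refine ⟨-1, Or.inr rfl, fun x hx => ?_⟩
      by_contra hcon
      obtain ⟨y, hy, hfy⟩ := isPreconnected_Icc.intermediate_value h0mem hx hf
        (show (0 : ℝ) ∈ Icc (f 0) (f x) from ⟨h.le, by linarith⟩)
      exact h0 y hy hfy
    · refine ⟨1, Or.inl rfl, fun x hx => ?_⟩
      by_contra hcon
      obtain ⟨y, hy, hfy⟩ := isPreconnected_Icc.intermediate_value hx h0mem hf
        (show (0 : ℝ) ∈ Icc (f x) (f 0) from ⟨by linarith, h.le⟩)
      exact h0 y hy hfy
  have hc : ContinuousOn (fun x => s * f x) (Icc (0 : ℝ) 1) := hf.const_mul s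
  obtain ⟨x, hx, hmin⟩ := isCompact_Icc.exists_isMinOn hne hc
  obtain ⟨y, hy, hmax⟩ := isCompact_Icc.exists_isMaxOn hne hc
  exact ⟨s, s * f x, s * f y, hs, hpos x hx, hmin hy, fun z hz => ⟨hmin hz, hmax hz⟩⟩

/-- A nondegenerate pair `(f₁', f₂')` is, up to a sign, the Legendre curve of a function pinched
between two parabolas. -/
lemma exists_quadConvex_of_torsion {f₁' f₁'' f₁''' f₂' f₂'' f₂''' : ℝ → ℝ}
    (hf₁' : ∀ x ∈ Icc (0:ℝ) 1, HasDerivWithinAt f₁' (f₁'' x) (Icc (0:ℝ) 1) x)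
    (hf₁'' : ∀ x ∈ Icc (0:ℝ) 1, HasDerivWithinAt f₁'' (f₁''' x) (Icc (0:ℝ) 1) x)
    (hf₁''' : ContinuousOn f₁''' (Icc (0:ℝ) 1))
    (hf₂' : ∀ x ∈ Icc (0:ℝ) 1, HasDerivWithinAt f₂' (f₂'' x) (Icc (0:ℝ) 1) x)
    (hf₂'' : ∀ x ∈ Icc (0:ℝ) 1, HasDerivWithinAt f₂'' (f₂''' x) (Icc (0:ℝ) 1) x)
    (hf₂''' : ContinuousOn f₂''' (Icc (0:ℝ) 1))
    (hne : ∀ x ∈ Icc (0:ℝ) 1, f₁'' x ≠ 0)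
    (htor : ∀ x ∈ Icc (0:ℝ) 1, f₁'' x * f₂''' x - f₂'' x * f₁''' x ≠ 0) :
    ∃ (a T κ Λ e : ℝ) (t φ ψ : ℝ → ℝ), 0 < a ∧ 1 ≤ T ∧ (e = 1 ∨ e = -1) ∧
      QuadConvex κ Λ φ ψ ∧ (∀ x ∈ Icc (0:ℝ) 1, |t x| ≤ T) ∧
      (∀ x ∈ Icc (0 : ℝ) 1, ∀ y ∈ Icc (0 : ℝ) 1, a * |x - y| ≤ |t x - t y|) ∧
      ∀ x ∈ Icc (0 : ℝ) 1, f₁' x = ψ (t x) ∧ f₂' x = e * (φ (t x) - t x * ψ (t x)) := by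
  have hc₁ : ContinuousOn f₁'' (Icc (0:ℝ) 1) := fun x hx => (hf₁'' x hx).continuousWithinAt
  have hc₂ : ContinuousOn f₂'' (Icc (0:ℝ) 1) := fun x hx => (hf₂'' x hx).continuousWithinAt
  obtain ⟨s, c, B, hs, hc, hcB, hf⟩ := exists_sign_mul_bounds hc₁ hne
  obtain ⟨d, a, A, hd, ha, haA, hg⟩ := exists_sign_mul_bounds
    (f := fun x => (f₂''' x * f₁'' x - f₂'' x * f₁''' x) / f₁'' x ^ 2)
    (((hf₂'''.mul hc₁).sub (hc₂.mul hf₁''')).div (hc₁.pow 2) fun x hx => pow_ne_zero 2 (hne x hx))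
    (fun x hx => div_ne_zero (by rw [mul_comm]; exact htor x hx) (pow_ne_zero 2 (hne x hx)))
  have hss : s * s = 1 := by rcases hs with rfl | rfl <;> norm_num
  have hdd : d * d = 1 := by rcases hd with rfl | rfl <;> norm_num
  have hsd : s * d = 1 ∨ s * d = -1 := by
    rcases hs with rfl | rfl <;> rcases hd with rfl | rfl <;> norm_num
  have hA : 0 < A := ha.trans_le haA
  have hB : 0 < B := hc.trans_le hcB
  have ht : ∀ x ∈ Icc (0 : ℝ) 1, HasDerivWithinAt (fun x => s * d * (f₂'' x / f₁'' x))
      (s * d * ((f₂''' x * f₁'' x - f₂'' x * f₁''' x) / f₁'' x ^ 2)) (Icc (0 : ℝ) 1) x :=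
    fun x hx => ((hf₂'' x hx).div (hf₁'' x hx) (hne x hx)).const_mul _
  have hst : ∀ y : ℝ, s * (s * d * y) = d * y := fun y => by linear_combination d * y * hss
  obtain ⟨hlip, φ, ψ, hφ, hrep⟩ := exists_quadConvex_parametrization (m := c / A) (M := B / a)
    (s := s) (w := fun x => s * d * f₂' x) (w' := fun x => s * d * f₂'' x) ha (by positivity)
    (div_le_div₀ hB.le hcB ha haA) hs ht hf₁' (fun x hx => (hf₂' x hx).const_mul _)
    (fun x hx => by rw [hst]; exact (hg x hx).1)
    (fun x hx => by
      rw [hst]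
      calc _ ≤ c / A * A := mul_le_mul_of_nonneg_left (hg x hx).2 (by positivity)
        _ = c := by field_simp
        _ ≤ _ := (hf x hx).1)
    (fun x hx => by
      rw [hst]
      calc _ ≤ B := (hf x hx).2
        _ = B / a * a := by field_simp
        _ ≤ _ := mul_le_mul_of_nonneg_left (hg x hx).1 (by positivity))
    (fun x hx => by have := hne x hx; field_simp)
  obtain ⟨T, hT⟩ := isCompact_Icc.exists_bound_of_continuousOn
    (f := fun x => s * d * (f₂'' x / f₁'' x)) fun x hx => (ht x hx).continuousWithinAt
  refine ⟨a, max 1 T, c / A / 2, B / a / 2, -(s * d), _, φ, ψ, ha, le_max_left _ _, ?_, hφ,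
    fun x hx => (hT x hx).trans (le_max_right _ _), hlip, fun x hx => ⟨(hrep x hx).1.symm, ?_⟩⟩
  · rcases hsd with h | h <;> simp [h]
  · rw [(hrep x hx).2]
    linear_combination (-(f₂' x)) * d * d * hss - f₂' x * hdd

lemma truncated_inv_le {Q n : ℝ} (hQ : 0 < Q) (hn : 0 ≤ n) :
    (if n = 0 then Q else min Q n⁻¹) ≤ 2 * (1 / (1 / Q + n)) := by
  rw [mul_one_div, le_div_iff₀ (by positivity)]
  split_ifs with h
  · rw [h, add_zero, mul_one_div_cancel hQ.ne']
    norm_num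
  · have hn' : 0 < n := lt_of_le_of_ne hn (Ne.symm h)
    rw [mul_add]
    have h1 : min Q n⁻¹ * (1 / Q) ≤ Q * (1 / Q) := by gcongr; exact min_le_left _ _
    have h2 : min Q n⁻¹ * n ≤ n⁻¹ * n := by gcongr; exact min_le_right _ _
    rw [mul_one_div_cancel hQ.ne'] at h1
    rw [inv_mul_cancel₀ h] at h2
    linarith

lemma sum_box_sign {e : ℝ} (he : e = 1 ∨ e = -1) (J : ℤ) (F : ℝ → ℝ → ℝ) :
    ∑ j ∈ (Finset.Icc (-J) J ×ˢ Finset.Icc (-J) J).erase (0, 0), F (j.1 : ℝ) (e * (j.2 : ℝ)) =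
      ∑ j ∈ (Finset.Icc (-J) J ×ˢ Finset.Icc (-J) J).erase (0, 0), F (j.1 : ℝ) (j.2 : ℝ) := by
  rcases he with rfl | rfl
  · simp
  · refine Finset.sum_nbij' (fun j => (j.1, -j.2)) (fun j => (j.1, -j.2)) ?_ ?_ ?_ ?_ ?_
    · rintro ⟨j, k⟩ h
      simp only [Finset.mem_erase, Finset.mem_product, Finset.mem_Icc, ne_eq, Prod.mk.injEq] at h ⊢
      omega
    · rintro ⟨j, k⟩ h
      simp only [Finset.mem_erase, Finset.mem_product, Finset.mem_Icc, ne_eq, Prod.mk.injEq] at h ⊢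
      omega
    · simp
    · simp
    · simp

lemma separated_lattice {h : ℝ} (hh : 0 < h) (S : Finset ℤ) :
    Separated h (S.image fun s : ℤ => h * (s : ℝ)) ∧
      ∀ s ∈ S, ∀ s' ∈ S, h * (s : ℝ) = h * (s' : ℝ) → s = s' := by
  refine ⟨fun x hx y hy hxy => ?_, fun s _ s' _ heq => ?_⟩
  · obtain ⟨s, -, rfl⟩ := Finset.mem_image.1 hx
    obtain ⟨s', -, rfl⟩ := Finset.mem_image.1 hy
    have hlt : (s : ℝ) < s' := lt_of_mul_lt_mul_left hxy hh.le
    have : (s : ℝ) + 1 ≤ s' := by exact_mod_cast hlt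
    have := mul_le_mul_of_nonneg_left this hh.le
    linarith
  · exact_mod_cast mul_left_cancel₀ hh.ne' heq

lemma numeric_bound {C a c Q D q₀ J : ℝ} (hC : 0 < C) (ha : 0 < a) (hc : 1 ≤ c) (hQ : 2 ≤ Q)
    (hD : 0 < D) (hD2 : D < 1 / 2) (hDQ : 2 * c / Q ≤ D) (hq₀ : 1 ≤ q₀)
    (hle : q₀ ≤ √(D * Q / (2 * c))) (hlt : √(D * Q / (2 * c)) < q₀ + 1) (hJ1 : 1 ≤ J)
    (hJ : J ≤ 1 / D) :
    9 * D ^ 2 * (2 * (C / (a * (q₀ / Q)) * (√J / √(1 / q₀) * (1 + Real.log J) +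
      J ^ 2 * (1 + Real.log (1 + J / (1 / q₀)))))) ≤
    5 * (36 * C / a * √(2 * c)) * (D ^ (-(1 : ℝ) / 2) * Q ^ ((1 : ℝ) / 2) * Real.log Q +
      D ^ ((5 : ℝ) / 4) * Q ^ ((3 : ℝ) / 4) * Real.log (1 / D)) := by
  have hQ0 : 0 < Q := by linarith
  have hq0 : 0 < q₀ := by linarith
  have hJ0 : 0 < J := by linarith
  have hc2 : 0 < 2 * c := by linarith
  have hlogD : 1 / 2 ≤ Real.log (1 / D) := by
    have : Real.log 2 ≤ Real.log (1 / D) :=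
      Real.log_le_log (by norm_num) (by rw [le_div_iff₀ hD]; linarith)
    linarith [Real.log_two_gt_d9]
  have hlogQ : 1 / 2 ≤ Real.log Q := by
    have : Real.log 2 ≤ Real.log Q := Real.log_le_log (by norm_num) hQ
    linarith [Real.log_two_gt_d9]
  have hlogJ : 1 + Real.log J ≤ 5 * Real.log (1 / D) := by
    have := Real.log_le_log hJ0 hJ
    linarith
  have hsq : q₀ ^ 2 ≤ D * Q / (2 * c) := by
    rw [← Real.sq_sqrt (show 0 ≤ D * Q / (2 * c) by positivity)]
    gcongr
  have hq0Q : q₀ ≤ Q := by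
    have : D * Q / (2 * c) ≤ Q := by
      rw [div_le_iff₀ hc2]
      nlinarith
    nlinarith
  have hJQ : J ≤ Q := by
    have : 1 / D ≤ Q := by
      rw [div_le_iff₀ hD]
      rw [div_le_iff₀ hQ0] at hDQ
      linarith
    linarith
  have hlogJq : 1 + Real.log (1 + J / (1 / q₀)) ≤ 5 * Real.log Q := by
    have h1 : 1 + J / (1 / q₀) ≤ Q ^ 3 := by
      rw [div_div_eq_mul_div, div_one]
      have : J * q₀ ≤ Q * Q := mul_le_mul hJQ hq0Q hq0.le hQ0.le
      nlinarith [mul_nonneg (sq_nonneg Q) (sub_nonneg.2 hQ)]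
    have := Real.log_le_log (by positivity) h1
    rw [Real.log_pow] at this
    push_cast at this
    linarith
  -- fourth roots of the two parameters
  obtain ⟨p, hp, hpQ⟩ : ∃ p : ℝ, 0 < p ∧ Q = p ^ 4 :=
    ⟨Q ^ ((1 : ℝ) / 4), by positivity, by rw [← Real.rpow_natCast, ← Real.rpow_mul hQ0.le]; norm_num⟩
  obtain ⟨w, hw, hwD⟩ : ∃ w : ℝ, 0 < w ∧ D = w ^ 4 :=
    ⟨D ^ ((1 : ℝ) / 4), by positivity, by rw [← Real.rpow_natCast, ← Real.rpow_mul hD.le]; norm_num⟩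
  have hp2 : Q ^ ((1 : ℝ) / 2) = p ^ 2 := by
    rw [hpQ, ← Real.rpow_natCast, ← Real.rpow_mul hp.le, ← Real.rpow_natCast]; norm_num
  have hp3 : Q ^ ((3 : ℝ) / 4) = p ^ 3 := by
    rw [hpQ, ← Real.rpow_natCast, ← Real.rpow_mul hp.le, ← Real.rpow_natCast]; norm_num
  have hw5 : D ^ ((5 : ℝ) / 4) = w ^ 5 := by
    rw [hwD, ← Real.rpow_natCast, ← Real.rpow_mul hw.le, ← Real.rpow_natCast]; norm_num
  have hw2 : D ^ (-(1 : ℝ) / 2) = 1 / w ^ 2 := by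
    rw [hwD, ← Real.rpow_natCast, ← Real.rpow_mul hw.le, one_div, ← Real.rpow_natCast w 2,
      ← Real.rpow_neg hw.le]
    norm_num
  have hsqrt : √(D * Q / (2 * c)) = w ^ 2 * p ^ 2 / √(2 * c) := by
    rw [Real.sqrt_div (by positivity), hwD, hpQ, show w ^ 4 * p ^ 4 = (w ^ 2 * p ^ 2) ^ 2 by ring,
      Real.sqrt_sq (by positivity)]
  have hr1 : 1 ≤ √(2 * c) := Real.one_le_sqrt.2 (by linarith)
  have hr : 0 < √(2 * c) := by linarith
  have hQq : C / (a * (q₀ / Q)) ≤ 2 * C / a * √(2 * c) * (p ^ 2 / w ^ 2) := by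
    have : w ^ 2 * p ^ 2 ≤ 2 * q₀ * √(2 * c) := by
      rw [hsqrt, div_lt_iff₀ hr] at hlt
      nlinarith
    rw [div_le_iff₀ (by positivity), hpQ]
    calc C = C * (w ^ 2 * p ^ 2) / (w ^ 2 * p ^ 2) := by field_simp
      _ ≤ C * (2 * q₀ * √(2 * c)) / (w ^ 2 * p ^ 2) := by gcongr
      _ = _ := by field_simp
  have hsJ : √J ≤ 1 / w ^ 2 := by
    rw [Real.sqrt_le_left (by positivity)]
    calc J ≤ 1 / D := hJ
      _ = _ := by rw [hwD]; field_simp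
  have hsq0 : √q₀ ≤ w * p := by
    rw [Real.sqrt_le_left (by positivity)]
    calc q₀ ≤ w ^ 2 * p ^ 2 / √(2 * c) := hsqrt ▸ hle
      _ ≤ w ^ 2 * p ^ 2 := div_le_self (by positivity) hr1
      _ = _ := by ring
  have hJ2 : J ^ 2 ≤ 1 / w ^ 8 := by
    calc J ^ 2 ≤ (1 / D) ^ 2 := by gcongr
      _ = _ := by rw [hwD]; field_simp
  have hfirst : √J / √(1 / q₀) * (1 + Real.log J) ≤ 1 / w ^ 2 * (w * p) * (5 * Real.log (1 / D)) := by
    rw [Real.sqrt_div zero_le_one, Real.sqrt_one, div_div_eq_mul_div, div_one]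
    have : 0 ≤ Real.log J := Real.log_nonneg hJ1
    gcongr
  have hsecond : J ^ 2 * (1 + Real.log (1 + J / (1 / q₀))) ≤ 1 / w ^ 8 * (5 * Real.log Q) := by
    have : 0 ≤ Real.log (1 + J / (1 / q₀)) := Real.log_nonneg (by
      have : 0 < J / (1 / q₀) := by positivity
      linarith)
    gcongr
  have hsum : 0 ≤ 1 / w ^ 2 * (w * p) * (5 * Real.log (1 / D)) + 1 / w ^ 8 * (5 * Real.log Q) := by
    have : 0 ≤ Real.log (1 / D) := by linarith
    have : 0 ≤ Real.log Q := by linarith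
    positivity
  rw [hp2, hp3, hw5, hw2]
  calc _ ≤ 9 * D ^ 2 * (2 * (2 * C / a * √(2 * c) * (p ^ 2 / w ^ 2) *
        (1 / w ^ 2 * (w * p) * (5 * Real.log (1 / D)) + 1 / w ^ 8 * (5 * Real.log Q)))) := by
        refine mul_le_mul_of_nonneg_left (mul_le_mul_of_nonneg_left ?_ (by norm_num))
          (by positivity)
        exact (mul_le_mul_of_nonneg_left (add_le_add hfirst hsecond) (by positivity)).trans
          (mul_le_mul_of_nonneg_right hQq hsum)
    _ = _ := by
        generalize Real.log (1 / D) = l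
        rw [hwD]
        field_simp
        ring

theorem E_q_delta_bound
    (c₃ : ℝ) (hc₃ : 0 < c₃)
    (f₁ f₁' f₁'' f₁''' f₂ f₂' f₂'' f₂''' : ℝ → ℝ)
    (hf₁ : ∀ x ∈ Icc (0:ℝ) 1, HasDerivWithinAt f₁ (f₁' x) (Icc (0:ℝ) 1) x)
    (hf₁' : ∀ x ∈ Icc (0:ℝ) 1, HasDerivWithinAt f₁' (f₁'' x) (Icc (0:ℝ) 1) x)
    (hf₁'' : ∀ x ∈ Icc (0:ℝ) 1, HasDerivWithinAt f₁'' (f₁''' x) (Icc (0:ℝ) 1) x)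
    (hf₁''' : ContinuousOn f₁''' (Icc (0:ℝ) 1))
    (hf₂ : ∀ x ∈ Icc (0:ℝ) 1, HasDerivWithinAt f₂ (f₂' x) (Icc (0:ℝ) 1) x)
    (hf₂' : ∀ x ∈ Icc (0:ℝ) 1, HasDerivWithinAt f₂' (f₂'' x) (Icc (0:ℝ) 1) x)
    (hf₂'' : ∀ x ∈ Icc (0:ℝ) 1, HasDerivWithinAt f₂'' (f₂''' x) (Icc (0:ℝ) 1) x)
    (hf₂''' : ContinuousOn f₂''' (Icc (0:ℝ) 1))
    (hc3 : ∀ x ∈ Icc (0:ℝ) 1, c₃ ≤ |f₁'' x|)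
    (htor : ∀ x ∈ Icc (0:ℝ) 1, f₁'' x * f₂''' x - f₂'' x * f₁''' x ≠ 0) :
    ∃ K : ℝ, 0 < K ∧
      ∀ (q : ℕ), 2 ≤ q → ∀ δ : ℝ, 0 < δ → δ < 1/2 →
      ∀ c₄ : ℝ,
        IsGreatest (insert 1
          ((fun x => max (max (max |f₁ x| |f₁' x|) (max |f₁'' x| |f₁''' x|))
            (max (max |f₂ x| |f₂' x|) (max |f₂'' x| |f₂''' x|))) '' Icc (0:ℝ) 1)) c₄ →
        2 * c₄ / q ≤ δ →
      ∀ q₀ r Jn : ℤ,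
        q₀ = ⌊Real.sqrt (δ * q / (2 * c₄))⌋ →
        r = ⌊(q : ℝ) / (q₀ : ℝ)⌋ →
        Jn = ⌊1 / δ⌋ →
        9 * δ ^ 2 *
          ∑ s ∈ Finset.Icc (0:ℤ) r,
            ∑ j ∈ (Finset.Icc (-Jn) Jn ×ˢ Finset.Icc (-Jn) Jn).erase (0, 0),
              (if nint ((j.1 : ℝ) * f₁' ((q₀ : ℝ) * s / q) + (j.2 : ℝ) * f₂' ((q₀ : ℝ) * s / q)) = 0
                then (q₀ : ℝ)
                else min (q₀ : ℝ)
                  (nint ((j.1 : ℝ) * f₁' ((q₀ : ℝ) * s / q) + (j.2 : ℝ) * f₂' ((q₀ : ℝ) * s / q)))⁻¹)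
        ≤ K * (δ ^ (-(1 : ℝ)/2) * (q : ℝ) ^ ((1 : ℝ)/2) * Real.log q
                + δ ^ ((5 : ℝ)/4) * (q : ℝ) ^ ((3 : ℝ)/4) * Real.log (1 / δ)) := by
  obtain ⟨a, T, κ, Λ, e, t, φ, ψ, ha, hT, he, hφ, htT, hlip, hrep⟩ :=
    exists_quadConvex_of_torsion hf₁' hf₁'' hf₁''' hf₂' hf₂'' hf₂'''
      (fun x hx h0 => by have := hc3 x hx; rw [h0, abs_zero] at this; linarith) htor
  obtain ⟨C, hC, hbox⟩ := hφ.sum_box_le hT ha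
  by_cases hex : ∃ c₄ : ℝ, IsGreatest (insert 1
      ((fun x => max (max (max |f₁ x| |f₁' x|) (max |f₁'' x| |f₁''' x|))
        (max (max |f₂ x| |f₂' x|) (max |f₂'' x| |f₂''' x|))) '' Icc (0:ℝ) 1)) c₄
  swap
  · exact ⟨1, one_pos, fun _ _ _ _ _ c₄ hc₄ => (hex ⟨c₄, hc₄⟩).elim⟩
  obtain ⟨c, hcg⟩ := hex
  have hc1 : 1 ≤ c := hcg.2 (mem_insert _ _)
  refine ⟨5 * (36 * C / a * √(2 * c)), by positivity, ?_⟩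
  intro q hq δ hδ hδ2 c₄ hc₄ hδq q₀ r Jn hq₀ hr hJn
  obtain rfl : c₄ = c := hc₄.unique hcg
  have hQ : (2 : ℝ) ≤ q := by exact_mod_cast hq
  have hQ0 : (0 : ℝ) < q := by linarith
  have hq₀1 : 1 ≤ q₀ := by
    rw [hq₀, Int.le_floor, Int.cast_one, Real.one_le_sqrt, le_div_iff₀ (by linarith)]
    rwa [one_mul, ← div_le_iff₀ hQ0]
  have hq₀R : (1 : ℝ) ≤ q₀ := by exact_mod_cast hq₀1
  have hle : (q₀ : ℝ) ≤ √(δ * q / (2 * c₄)) := hq₀ ▸ Int.floor_le _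
  have hlt : √(δ * q / (2 * c₄)) < q₀ + 1 := hq₀ ▸ Int.lt_floor_add_one _
  obtain ⟨J, rfl⟩ : ∃ J : ℕ, Jn = J :=
    Int.eq_ofNat_of_zero_le (hJn ▸ Int.floor_nonneg.2 (by positivity))
  have hJle : (J : ℝ) ≤ 1 / δ := by
    have := Int.floor_le (1 / δ)
    rwa [← hJn, Int.cast_natCast] at this
  have hJ1 : 1 ≤ J := by
    have : (1 : ℤ) ≤ J := by
      rw [hJn, Int.le_floor, Int.cast_one, le_div_iff₀ hδ]
      linarith
    exact_mod_cast this
  have hJR : (1 : ℝ) ≤ J := by exact_mod_cast hJ1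
  -- the sample points
  have hstep : (0 : ℝ) < q₀ / q := by positivity
  have hmem : ∀ s ∈ Finset.Icc (0 : ℤ) r, (q₀ : ℝ) / q * s ∈ Icc (0 : ℝ) 1 := by
    intro s hs
    obtain ⟨hs0, hsr⟩ := Finset.mem_Icc.1 hs
    have h0 : (0 : ℝ) ≤ s := by exact_mod_cast hs0
    refine ⟨by positivity, ?_⟩
    rw [hr, Int.le_floor, le_div_iff₀ (by linarith)] at hsr
    rw [div_mul_eq_mul_div, div_le_one hQ0]
    linarith
  obtain ⟨hsep, hinj⟩ := separated_lattice hstep (Finset.Icc (0 : ℤ) r)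
  have hmem' : ∀ x ∈ (Finset.Icc (0 : ℤ) r).image (fun s : ℤ => (q₀ : ℝ) / q * s),
      x ∈ Icc (0 : ℝ) 1 := fun x hx => by
    obtain ⟨s, hs, rfl⟩ := Finset.mem_image.1 hx
    exact hmem s hs
  obtain ⟨hsepX, hinjX⟩ := hsep.image_of_le_abs_sub (mul_pos ha hstep) (v := t)
    fun x hx y hy hxy => by
      refine le_trans ?_ (hlip x (hmem' x hx) y (hmem' y hy))
      rw [abs_sub_comm, abs_of_nonneg (by linarith)]
      gcongr
      linarith
  have hspacing : a * ((q₀ : ℝ) / q) * J ≤ a * (1 / q₀) := by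
    have hsq : (q₀ : ℝ) ^ 2 ≤ δ * q / (2 * c₄) := by
      rw [← Real.sq_sqrt (show 0 ≤ δ * q / (2 * c₄) by positivity)]
      gcongr
    have hsq' : (q₀ : ℝ) ^ 2 ≤ δ * q :=
      hsq.trans (div_le_self (by positivity) (by linarith))
    rw [mul_assoc]
    refine mul_le_mul_of_nonneg_left ?_ ha.le
    rw [le_div_iff₀ (by linarith), div_mul_eq_mul_div, div_mul_eq_mul_div, div_le_one hQ0]
    rw [le_div_iff₀ hδ] at hJle
    calc (q₀ : ℝ) * J * q₀ = q₀ ^ 2 * J := by ring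
      _ ≤ δ * q * J := by gcongr
      _ = J * δ * q := by ring
      _ ≤ 1 * q := by gcongr
      _ = q := one_mul _
  have hmain := hbox (1 / q₀) (a * ((q₀ : ℝ) / q)) J (by positivity)
    ((div_le_one (by linarith)).2 hq₀R) (by positivity) hJ1 hspacing _ hsepX fun y hy => by
      obtain ⟨x, hx, rfl⟩ := Finset.mem_image.1 hy
      exact htT x (hmem' x hx)
  refine le_trans (mul_le_mul_of_nonneg_left ?_ (by positivity))
    (numeric_bound hC ha hc1 hQ hδ hδ2 hδq hq₀R hle hlt hJR hJle)
  refine le_trans ?_ (mul_le_mul_of_nonneg_left hmain zero_le_two)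
  rw [Finset.sum_comm, ← sum_box_sign he (J : ℤ) fun y z =>
    ∑ t ∈ _, 1 / (1 / (q₀ : ℝ) + nint (y * ψ t + z * (φ t - t * ψ t))), Finset.mul_sum]
  refine Finset.sum_le_sum fun j _ => ?_
  rw [Finset.sum_image hinjX, Finset.sum_image hinj, Finset.mul_sum]
  refine Finset.sum_le_sum fun s hs => ?_
  obtain ⟨h1, h2⟩ := hrep _ (hmem s hs)
  rw [mul_div_right_comm, h1, h2, ← mul_assoc (j.2 : ℝ) e, mul_comm (j.2 : ℝ) e]
  exact truncated_inv_le (by linarith) (nint_nonneg _)
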